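/- Suppose p_c > 0 and let s > 0. For any monotonic enhancement of site percolation on the square lattice ℤ², the following are equivalent: (i) there exists π(s) < p_c such that θ(p,s) > 0 for all p > π(s); (ii) the enhancement is essential. -/

import Mathlib

open MeasureTheory Filter Set Topology
open scoped ENNReal

namespace PercEnh

/-- Sites of the lattice (vertex set `ℤ²`). -/
abbrev Site : Type := ℤ × ℤ

/-- A configuration: the set of open sites. -/
abbrev Config : Type := Set Site

/-- Square-lattice (`ℤ²`-) adjacency: `‖x − y‖₁ = 1`. -/
def adjZ2 (x y : Site) : Prop := |x.1 - y.1| + |x.2 - y.2| = 1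

/-- Matching (star) adjacency: `x ≠ y` and `‖x − y‖_∞ = 1`. -/
def adjStar (x y : Site) : Prop := x ≠ y ∧ max |x.1 - y.1| |x.2 - y.2| = 1

/-- Euclidean norm of a site. -/
noncomputable def siteNorm (x : Site) : ℝ := Real.sqrt ((x.1 : ℝ) ^ 2 + (x.2 : ℝ) ^ 2)

/-- Sites in the closed Euclidean ball of radius `r` centred at the origin. -/
def siteBall (r : ℝ) : Set Site := {x | siteNorm x ≤ r}

/-- The shifted configuration `τ_x ω = {y − x : y ∈ ω}`. -/
def shiftConfig (x : Site) (ω : Config) : Config := {y | y + x ∈ ω}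

/-- An enhancement function of (finite) range `R₀`: takes values in subsets of
`𝔹₀ = ℤ² ∩ B(R₀)` and depends only on the restriction of the configuration to `𝔹₀`. -/
def IsEnhancement (R₀ : ℝ) (φ : Config → Config) : Prop :=
  0 ≤ R₀ ∧ (∀ ω, φ ω ⊆ siteBall R₀) ∧
    ∀ ω ω' : Config, ω ∩ siteBall R₀ = ω' ∩ siteBall R₀ → φ ω = φ ω'

/-- A monotonic enhancement function. -/
def Monotonic (φ : Config → Config) : Prop := ∀ ω ω' : Config, ω ⊆ ω' → φ ω ⊆ φ ω'

/-- The translate `φ_x(ω) = x + φ₀(τ_x ω)`. -/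
def enhAt (φ : Config → Config) (x : Site) (ω : Config) : Config :=
  (fun z => z + x) '' φ (shiftConfig x ω)

/-- The enhanced configuration `ω̂(ω, α) = ω ∪ ⋃_{x : α(x)=1} φ_x(ω)`. -/
def enhanced (φ : Config → Config) (ω : Config) (α : Site → Bool) : Config :=
  ω ∪ {y | ∃ x, α x = true ∧ y ∈ enhAt φ x ω}

/-- The fully (deterministically, with `s = 1`) enhanced configuration `ω̃`. -/
def fullyEnhanced (φ : Config → Config) (ω : Config) : Config :=
  ω ∪ {y | ∃ x, y ∈ enhAt φ x ω}

/-- `ω` contains a doubly-infinite self-repelling path (w.r.t. adjacency `adj`):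
a two-sided sequence of distinct sites of `ω` in which exactly the consecutive
pairs are adjacent. -/
def HasDISRPath (adj : Site → Site → Prop) (ω : Config) : Prop :=
  ∃ γ : ℤ → Site, Function.Injective γ ∧ (∀ i, γ i ∈ ω) ∧
    ∀ i j : ℤ, adj (γ i) (γ j) ↔ (j = i + 1 ∨ i = j + 1)

/-- The enhancement is essential: some configuration without a doubly-infinite
self-repelling path acquires one upon enhancement at the origin. -/
def Essential (adj : Site → Site → Prop) (φ : Config → Config) : Prop :=
  ∃ ω : Config, ¬ HasDISRPath adj ω ∧ HasDISRPath adj (ω ∪ φ ω)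

/-- A (finite, nonempty) path w.r.t. adjacency `adj`: distinct sites,
consecutive ones adjacent. -/
def IsPathOn (adj : Site → Site → Prop) (l : List Site) : Prop :=
  l ≠ [] ∧ l.Nodup ∧ l.Chain' adj

/-- `x` and `y` are joined by a path of sites of `ω`. -/
def ConnectedIn (adj : Site → Site → Prop) (ω : Config) (x y : Site) : Prop :=
  ∃ l : List Site, IsPathOn adj l ∧ (∀ z ∈ l, z ∈ ω) ∧
    l.head? = some x ∧ l.getLast? = some y

/-- `x` belongs to an infinite open cluster of `ω`. -/
def InInfiniteCluster (adj : Site → Site → Prop) (ω : Config) (x : Site) : Prop :=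
  {y | ConnectedIn adj ω x y}.Infinite

/-- `ω` contains an infinite open cluster. -/
def HasInfiniteCluster (adj : Site → Site → Prop) (ω : Config) : Prop :=
  ∃ x, InInfiniteCluster adj ω x

/-- The configuration corresponding to `η : Site → Bool`. -/
def toConfig (η : Site → Bool) : Config := {x | η x = true}

/-- A cylinder event. -/
def cylinder (F : Finset Site) (b : Site → Bool) : Set (Site → Bool) :=
  {η | ∀ x ∈ F, η x = b x}

/-- `μ` is the Bernoulli product measure with density `p` of open sites. -/
def IsBernoulli (p : ℝ) (μ : Measure (Site → Bool)) : Prop :=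
  IsProbabilityMeasure μ ∧
    ∀ (F : Finset Site) (b : Site → Bool),
      μ (cylinder F b) = ∏ x ∈ F, ENNReal.ofReal (if b x then p else 1 - p)

/-- The percolation probability `θ`: the probability that the origin lies in an
infinite open cluster. -/
noncomputable def theta (adj : Site → Site → Prop) (μ : Measure (Site → Bool)) : ℝ :=
  (μ {η | InInfiniteCluster adj (toConfig η) 0}).toReal

/-- The percolation probability of the enhanced process (`μ` the law of the
configuration, `ν` the law of the activation variables). -/
noncomputable def thetaEnh (adj : Site → Site → Prop) (φ : Config → Config)
    (μ ν : Measure (Site → Bool)) : ℝ :=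
  ((μ.prod ν) {ηα | InInfiniteCluster adj (enhanced φ (toConfig ηα.1) ηα.2) 0}).toReal

/-- The critical point `p_c = sup {p ∈ [0,1] : θ(p) = 0}` for the family `P`. -/
noncomputable def pcOf (adj : Site → Site → Prop) (P : ℝ → Measure (Site → Bool)) : ℝ :=
  sSup {p | p ∈ Icc (0:ℝ) 1 ∧ theta adj (P p) = 0}

/-- The connectivity function `τ_p(x)`. -/
noncomputable def tau (adj : Site → Site → Prop) (μ : Measure (Site → Bool)) (x : Site) : ℝ :=
  (μ {η | ConnectedIn adj (toConfig η) 0 x}).toReal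

/-- The connectivity function `τ_{p,s}(x)` of the enhanced process. -/
noncomputable def tauEnh (adj : Site → Site → Prop) (φ : Config → Config)
    (μ ν : Measure (Site → Bool)) (x : Site) : ℝ :=
  ((μ.prod ν) {ηα | ConnectedIn adj (enhanced φ (toConfig ηα.1) ηα.2) 0 x}).toReal

/-- The mean cluster size `χ(p) = E_p‖C‖ = ∑_x τ_p(x)`. -/
noncomputable def chi (adj : Site → Site → Prop) (μ : Measure (Site → Bool)) : ℝ≥0∞ :=
  ∑' x : Site, μ {η | ConnectedIn adj (toConfig η) 0 x}

/-- The mean cluster size of the enhanced process. -/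
noncomputable def chiEnh (adj : Site → Site → Prop) (φ : Config → Config)
    (μ ν : Measure (Site → Bool)) : ℝ≥0∞ :=
  ∑' x : Site, (μ.prod ν) {ηα | ConnectedIn adj (enhanced φ (toConfig ηα.1) ηα.2) 0 x}

/-! ### Lattice geometry and connectivity -/

/-- `y` can be reached from `x` by a nearest-neighbour walk in `X`. -/
def ReachIn (X : Set Site) (x y : Site) : Prop :=
  x ∈ X ∧ Relation.ReflTransGen (fun u v => adjZ2 u v ∧ v ∈ X) x y

/-- The square box of radius `r` centred at `z`. -/
def box (z : Site) (r : ℤ) : Set Site :=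
  {v | z.1 - r ≤ v.1 ∧ v.1 ≤ z.1 + r ∧ z.2 - r ≤ v.2 ∧ v.2 ≤ z.2 + r}

theorem mem_box {z v : Site} {r : ℤ} :
    v ∈ box z r ↔ z.1 - r ≤ v.1 ∧ v.1 ≤ z.1 + r ∧ z.2 - r ≤ v.2 ∧ v.2 ≤ z.2 + r := Iff.rfl

theorem adjZ2_iff {x y : Site} : adjZ2 x y ↔
    (x.1 = y.1 ∧ (x.2 = y.2 + 1 ∨ y.2 = x.2 + 1)) ∨
      (x.2 = y.2 ∧ (x.1 = y.1 + 1 ∨ y.1 = x.1 + 1)) := by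
  unfold adjZ2
  rcases abs_cases (x.1 - y.1) with h | h <;> rcases abs_cases (x.2 - y.2) with h' | h' <;>
    omega

theorem adjZ2_comm {x y : Site} : adjZ2 x y ↔ adjZ2 y x := by
  simp only [adjZ2_iff]; omega

theorem adjZ2.symm {x y : Site} (h : adjZ2 x y) : adjZ2 y x := adjZ2_comm.1 h

theorem adjZ2.ne {x y : Site} (h : adjZ2 x y) : x ≠ y := by
  rintro rfl; rw [adjZ2_iff] at h; omega

theorem adjZ2_add_right {x y z : Site} : adjZ2 (x + z) (y + z) ↔ adjZ2 x y := by
  simp only [adjZ2_iff, Prod.fst_add, Prod.snd_add]; omega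

theorem box_mono {z : Site} {r r' : ℤ} (h : r ≤ r') : box z r ⊆ box z r' := by
  intro v hv; rw [mem_box] at *; omega

theorem box_finite (z : Site) (r : ℤ) : (box z r).Finite := by
  refine ((Set.finite_Icc (z.1 - r) (z.1 + r)).prod (Set.finite_Icc (z.2 - r) (z.2 + r))).subset ?_
  rintro v ⟨h1, h2, h3, h4⟩
  exact ⟨⟨h1, h2⟩, ⟨h3, h4⟩⟩

namespace ReachIn

variable {X Y : Set Site} {x y z : Site}

theorem refl (h : x ∈ X) : ReachIn X x x := ⟨h, .refl⟩

theorem right_mem (h : ReachIn X x y) : y ∈ X := by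
  obtain ⟨h1, h2⟩ := h
  cases h2 with
  | refl => exact h1
  | tail _ h => exact h.2

theorem trans (h : ReachIn X x y) (h' : ReachIn X y z) : ReachIn X x z :=
  ⟨h.1, h.2.trans h'.2⟩

theorem tail (h : ReachIn X x y) (ha : adjZ2 y z) (hz : z ∈ X) : ReachIn X x z :=
  ⟨h.1, h.2.tail ⟨ha, hz⟩⟩

theorem single (hx : x ∈ X) (ha : adjZ2 x y) (hy : y ∈ X) : ReachIn X x y :=
  (refl hx).tail ha hy

theorem symm (h : ReachIn X x y) : ReachIn X y x := by
  obtain ⟨h1, h2⟩ := h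
  induction h2 with
  | refl => exact refl h1
  | @tail b c hb hc ih =>
    exact (single hc.2 hc.1.symm (right_mem ⟨h1, hb⟩)).trans ih

theorem mono (hXY : X ⊆ Y) (h : ReachIn X x y) : ReachIn Y x y :=
  ⟨hXY h.1, Relation.ReflTransGen.mono (fun _ _ h => ⟨h.1, hXY h.2⟩) _ _ h.2⟩

/-- Induction along a walk. -/
theorem induct {P : Site → Prop} (h : ReachIn X x y) (h0 : P x)
    (hs : ∀ u v, ReachIn X x u → P u → adjZ2 u v → v ∈ X → P v) : P y := by
  obtain ⟨h1, h2⟩ := h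
  induction h2 with
  | refl => exact h0
  | @tail b c hb hc ih => exact hs b c ⟨h1, hb⟩ ih hc.1 hc.2

/-- A walk from outside `Q` into `Q` has a first step into `Q`. -/
theorem first_hit (Q : Set Site) (h : ReachIn X x y) (hx : x ∉ Q) (hy : y ∈ Q) :
    ∃ u v, ReachIn (X \ Q) x u ∧ adjZ2 u v ∧ v ∈ X ∧ v ∈ Q := by
  by_contra hcon
  push Not at hcon
  have : ReachIn (X \ Q) x y := by
    refine h.induct (P := fun y => ReachIn (X \ Q) x y) (refl ⟨h.1, hx⟩) ?_
    intro u v _ hu huv hv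
    exact hu.tail huv ⟨hv, hcon u v hu huv hv⟩
  exact this.right_mem.2 hy

theorem exists_fun (h : ReachIn X x y) : ∃ (N : ℕ) (w : ℕ → Site), w 0 = x ∧ w N = y ∧
    (∀ k ≤ N, w k ∈ X) ∧ ∀ k < N, adjZ2 (w k) (w (k + 1)) := by
  refine h.induct (P := fun y => ∃ (N : ℕ) (w : ℕ → Site), w 0 = x ∧ w N = y ∧
    (∀ k ≤ N, w k ∈ X) ∧ ∀ k < N, adjZ2 (w k) (w (k + 1))) ⟨0, fun _ => x, rfl, rfl, ?_, ?_⟩ ?_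
  · intro _ _; exact h.1
  · intro k hk; omega
  · rintro u v - ⟨N, w, h0, hN, hm, ha⟩ huv hv
    refine ⟨N + 1, fun k => if k ≤ N then w k else v, by simp [h0], by simp, ?_, ?_⟩
    · intro k _
      dsimp only
      split_ifs with hk
      · exact hm k hk
      · exact hv
    · intro k hk
      dsimp only
      rcases Nat.lt_or_ge k N with hkN | hkN
      · rw [if_pos hkN.le, if_pos (by omega)]; exact ha k hkN
      · obtain rfl : k = N := by omega
        rw [if_pos le_rfl, if_neg (by omega), hN]; exact huv

end ReachIn

theorem connectedIn_iff {X : Set Site} {x y : Site} :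
    ConnectedIn adjZ2 X x y ↔ ReachIn X x y := by
  constructor
  · rintro ⟨l, ⟨-, -, hc⟩, hm, hx, hy⟩
    induction l generalizing x with
    | nil => simp at hx
    | cons a l ih =>
      obtain rfl : a = x := by simpa using hx
      cases l with
      | nil =>
        obtain rfl : a = y := by simpa using hy
        exact .refl (hm _ (by simp))
      | cons b l =>
        have hc' := List.isChain_cons_cons.1 hc
        refine (ReachIn.single (hm a (by simp)) hc'.1 (hm b (by simp))).trans ?_
        exact ih hc'.2 (fun z hz => hm z (List.mem_cons_of_mem _ hz)) rfl
          (by simpa using hy)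
  · intro h
    refine h.induct (P := fun y => ConnectedIn adjZ2 X x y)
      ⟨[x], ⟨by simp, by simp, List.isChain_singleton _⟩, by simpa using h.1, rfl, rfl⟩ ?_
    rintro u v - ⟨l, ⟨h0, hn, hc⟩, hm, hx, hy⟩ huv hv
    by_cases hvl : v ∈ l
    · obtain ⟨s, t, rfl⟩ := List.append_of_mem hvl
      have hpre : s ++ [v] <+: s ++ v :: t := ⟨t, by simp⟩
      refine ⟨s ++ [v], ⟨by simp, hn.sublist hpre.sublist, hc.prefix hpre⟩,
        fun z hz => hm z (hpre.subset hz), ?_, by simp⟩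
      cases s <;> simpa using hx
    · refine ⟨l ++ [v], ⟨by simp, ?_, ?_⟩, ?_, ?_, by simp⟩
      · rw [List.nodup_append]
        refine ⟨hn, by simp, ?_⟩
        rintro a ha b hb rfl
        exact hvl (by simpa [List.mem_singleton.1 hb] using ha)
      · refine List.isChain_append.2 ⟨hc, List.isChain_singleton _, ?_⟩
        intro a ha b hb
        rw [hy] at ha
        simp only [Option.mem_def, Option.some.injEq, List.head?_cons] at ha hb
        subst ha hb
        exact huv
      · intro z hz
        rcases List.mem_append.1 hz with hz | hz
        · exact hm z hz
        · rwa [List.mem_singleton.1 hz]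
      · cases l with
        | nil => exact absurd rfl h0
        | cons => simpa using hx

/-! ### Self-repelling paths -/

/-- A sequence of sites in which exactly the consecutive ones are adjacent. -/
def IsInducedRay (f : ℕ → Site) : Prop :=
  ∀ a b, adjZ2 (f a) (f b) ↔ (b = a + 1 ∨ a = b + 1)

theorem IsInducedRay.injective {f : ℕ → Site} (h : IsInducedRay f) : Function.Injective f := by
  intro a b hab
  have h1 := (h a (a + 1)).2 (Or.inl rfl)
  have h2 := (h b (b + 1)).2 (Or.inl rfl)
  rw [hab, h] at h1
  rw [← hab, h] at h2
  omega

theorem injective_of_adj_iff {γ : ℤ → Site}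
    (h : ∀ i j, adjZ2 (γ i) (γ j) ↔ (j = i + 1 ∨ i = j + 1)) : Function.Injective γ := by
  intro a b hab
  have h1 := (h a (a + 1)).2 (Or.inl rfl)
  have h2 := (h b (b + 1)).2 (Or.inl rfl)
  rw [hab, h] at h1
  rw [← hab, h] at h2
  omega

theorem finite_adj (v : Site) : {u | adjZ2 u v}.Finite := by
  refine (box_finite v 1).subset fun u hu => ?_
  rw [mem_ofPred_eq, adjZ2_iff] at hu
  rw [mem_box]; omega

theorem IsInducedRay.exists_last_adj {f : ℕ → Site} (h : IsInducedRay f) {v : Site} {i : ℕ}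
    (hi : adjZ2 (f i) v) : ∃ i, adjZ2 (f i) v ∧ ∀ j, adjZ2 (f j) v → j ≤ i := by
  have hfin : {i | adjZ2 (f i) v}.Finite := (finite_adj v).preimage h.injective.injOn
  obtain ⟨k, hk, hmax⟩ := hfin.exists_maximal ⟨i, hi⟩
  refine ⟨k, hk, fun j hj => ?_⟩
  by_contra hlt
  exact hlt (hmax hj (by omega))

/-- Two separated induced rays in `ω` which are joined in `ω` yield a doubly-infinite
self-repelling path. -/
theorem hasDISRPath_of_rays {ω : Set Site} {f g : ℕ → Site} (hf : IsInducedRay f)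
    (hg : IsInducedRay g) (hfω : ∀ n, f n ∈ ω) (hgω : ∀ n, g n ∈ ω)
    (hne : ∀ a b, f a ≠ g b) (hna : ∀ a b, ¬ adjZ2 (f a) (g b)) (h : ReachIn ω (f 0) (g 0)) :
    HasDISRPath adjZ2 ω := by
  classical
  have hex : ∃ m : ℕ, ∃ σ : ℕ → Site, (∀ k ≤ m, σ k ∈ ω) ∧
      (∀ k < m, adjZ2 (σ k) (σ (k + 1))) ∧ (∃ i, adjZ2 (f i) (σ 0)) ∧ ∃ j, adjZ2 (σ m) (g j) := by
    obtain ⟨N, w, h0, hN, hm, ha⟩ := h.exists_fun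
    have hN0 : N ≠ 0 := by
      rintro rfl; exact hne 0 0 (h0.symm.trans hN)
    have hN1 : N ≠ 1 := by
      rintro rfl
      have := ha 0 (by omega)
      rw [h0, hN] at this
      exact hna 0 0 this
    refine ⟨N - 2, fun k => w (k + 1), fun k hk => hm _ (by omega), fun k hk => ha _ (by omega),
      ⟨0, ?_⟩, ⟨0, ?_⟩⟩
    · have := ha 0 (by omega); rwa [h0] at this
    · have := ha (N - 1) (by omega)
      rw [show N - 1 + 1 = N by omega, hN] at this
      dsimp only; rwa [show N - 2 + 1 = N - 1 by omega]
  obtain ⟨σ, hσω, hσa, ⟨i₀, hi₀⟩, ⟨j₀, hj₀⟩⟩ := Nat.find_spec hex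
  have hmin := fun k (hk : k < Nat.find hex) => Nat.find_min hex hk
  generalize Nat.find hex = m at *
  have hA : ∀ k ≤ m, ∀ i, adjZ2 (f i) (σ k) → k = 0 := by
    intro k hk i hi
    by_contra hk0
    refine hmin (m - k) (by omega) ⟨fun t => σ (t + k), fun t ht => hσω _ (by omega),
      fun t ht => ?_, ⟨i, by simpa using hi⟩, ⟨j₀, ?_⟩⟩
    · have := hσa (t + k) (by omega)
      rwa [show t + k + 1 = t + 1 + k by omega] at this
    · dsimp only; rwa [show m - k + k = m by omega]
  have hB : ∀ k ≤ m, ∀ j, adjZ2 (σ k) (g j) → k = m := by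
    intro k hk j hj
    by_contra hk0
    exact hmin k (by omega) ⟨σ, fun t ht => hσω _ (by omega), fun t ht => hσa _ (by omega),
      ⟨i₀, hi₀⟩, ⟨j, hj⟩⟩
  have hD : ∀ k l, k < l → l ≤ m → adjZ2 (σ k) (σ l) → l = k + 1 := by
    intro k l hkl hl had
    by_contra hne
    refine hmin (m - (l - k - 1)) (by omega) ⟨fun t => if t ≤ k then σ t else σ (t + (l - k - 1)),
      fun t ht => ?_, fun t ht => ?_, ⟨i₀, by simpa using hi₀⟩, ⟨j₀, ?_⟩⟩
    · dsimp only
      split_ifs <;> exact hσω _ (by omega)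
    · dsimp only
      rcases lt_trichotomy t k with h | rfl | h
      · rw [if_pos h.le, if_pos (by omega)]; exact hσa _ (by omega)
      · rw [if_pos le_rfl, if_neg (by omega), show t + 1 + (l - t - 1) = l by omega]; exact had
      · rw [if_neg (by omega), if_neg (by omega),
          show t + 1 + (l - k - 1) = t + (l - k - 1) + 1 by omega]
        exact hσa _ (by omega)
    · dsimp only
      rw [if_neg (by omega), show m - (l - k - 1) + (l - k - 1) = m by omega]; exact hj₀
  obtain ⟨i, hi, himax⟩ := hf.exists_last_adj hi₀
  obtain ⟨j, hj, hjmax⟩ := hg.exists_last_adj hj₀.symm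
  have hff : ∀ a b, adjZ2 (f (i + a)) (f (i + b)) ↔ (b = a + 1 ∨ a = b + 1) := by
    intro a b; rw [hf]; omega
  have hgg : ∀ a b, adjZ2 (g (j + a)) (g (j + b)) ↔ (b = a + 1 ∨ a = b + 1) := by
    intro a b; rw [hg]; omega
  have hσσ : ∀ k l, k ≤ m → l ≤ m → (adjZ2 (σ k) (σ l) ↔ (l = k + 1 ∨ k = l + 1)) := by
    intro k l hk hl
    constructor
    · intro had
      rcases lt_trichotomy k l with h | rfl | h
      · exact Or.inl (hD k l h hl had)
      · exact absurd rfl had.ne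
      · exact Or.inr (hD l k h hk had.symm)
    · rintro (rfl | rfl)
      · exact hσa _ (by omega)
      · exact (hσa _ (by omega)).symm
  have hfσ : ∀ n k, k ≤ m → (adjZ2 (f (i + n)) (σ k) ↔ (n = 0 ∧ k = 0)) := by
    intro n k hk
    constructor
    · intro had
      obtain rfl := hA k hk _ had
      have := himax _ had
      omega
    · rintro ⟨rfl, rfl⟩; exact hi
  have hσg : ∀ n k, k ≤ m → (adjZ2 (σ k) (g (j + n)) ↔ (n = 0 ∧ k = m)) := by
    intro n k hk
    constructor
    · intro had
      obtain rfl := hB k hk _ had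
      have := hjmax _ had.symm
      omega
    · rintro ⟨rfl, rfl⟩; exact hj.symm
  obtain ⟨γ, hγ⟩ : ∃ γ : ℤ → Site, γ = fun t : ℤ => if t < 0 then f (i + (-t - 1).toNat) else
    if t ≤ m then σ t.toNat else g (j + (t - m - 1).toNat) := ⟨_, rfl⟩
  have hcase : ∀ t : ℤ, (∃ n : ℕ, t = -1 - n ∧ γ t = f (i + n)) ∨
      (∃ k : ℕ, k ≤ m ∧ t = k ∧ γ t = σ k) ∨ ∃ n : ℕ, t = m + 1 + n ∧ γ t = g (j + n) := by
    intro t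
    rw [hγ]
    rcases lt_or_ge t 0 with h | h
    · exact Or.inl ⟨(-t - 1).toNat, by omega, by simp [h]⟩
    rcases le_or_gt t m with h' | h'
    · exact Or.inr (Or.inl ⟨t.toNat, by omega, by omega, by simp [h', not_lt.2 h]⟩)
    · exact Or.inr (Or.inr ⟨(t - m - 1).toNat, by omega, by simp [not_le.2 h', not_lt.2 h]⟩)
  have hadj : ∀ a b : ℤ, adjZ2 (γ a) (γ b) ↔ (b = a + 1 ∨ a = b + 1) := by
    intro a b
    rcases hcase a with ⟨n, rfl, e⟩ | ⟨n, hn, rfl, e⟩ | ⟨n, rfl, e⟩ <;>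
    rcases hcase b with ⟨n', rfl, e'⟩ | ⟨n', hn', rfl, e'⟩ | ⟨n', rfl, e'⟩ <;> rw [e, e']
    · rw [hff]; omega
    · rw [hfσ _ _ hn']; omega
    · simp only [hna, false_iff]; omega
    · rw [adjZ2_comm, hfσ _ _ hn]; omega
    · rw [hσσ _ _ hn hn']; omega
    · rw [hσg _ _ hn]; omega
    · rw [adjZ2_comm]; simp only [hna, false_iff]; omega
    · rw [adjZ2_comm, hσg _ _ hn']; omega
    · rw [hgg]; omega
  refine ⟨γ, injective_of_adj_iff hadj, fun t => ?_, hadj⟩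
  rcases hcase t with ⟨n, -, e⟩ | ⟨n, hn, -, e⟩ | ⟨n, -, e⟩ <;> rw [e]
  exacts [hfω _, hσω _ hn, hgω _]

/-- An enhancement supported in, and depending only on, the box of radius `R`. -/
structure BoxRange (R : ℤ) (φ : Config → Config) : Prop where
  nonneg : 0 ≤ R
  subset : ∀ ω, φ ω ⊆ box 0 R
  congr : ∀ ω ω' : Config, ω ∩ box 0 R = ω' ∩ box 0 R → φ ω = φ ω'

theorem IsEnhancement.exists_boxRange {R₀ : ℝ} {φ : Config → Config} (h : IsEnhancement R₀ φ) :
    ∃ R, BoxRange R φ := by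
  obtain ⟨h0, h1, h2⟩ := h
  have hsub : siteBall R₀ ⊆ box 0 ⌈R₀⌉ := by
    intro v hv
    have hv' : Real.sqrt ((v.1 : ℝ) ^ 2 + (v.2 : ℝ) ^ 2) ≤ R₀ := hv
    rw [Real.sqrt_le_left h0] at hv'
    have ha : |(v.1 : ℝ)| ≤ R₀ := abs_le_of_sq_le_sq (by nlinarith [sq_nonneg (v.2 : ℝ)]) h0
    have hb : |(v.2 : ℝ)| ≤ R₀ := abs_le_of_sq_le_sq (by nlinarith [sq_nonneg (v.1 : ℝ)]) h0
    have hc := Int.le_ceil R₀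
    rw [abs_le] at ha hb
    have e1 : -⌈R₀⌉ ≤ v.1 := by exact_mod_cast (by push_cast; linarith : ((-⌈R₀⌉ : ℤ) : ℝ) ≤ v.1)
    have e2 : v.1 ≤ ⌈R₀⌉ := by exact_mod_cast (by linarith : (v.1 : ℝ) ≤ (⌈R₀⌉ : ℤ))
    have e3 : -⌈R₀⌉ ≤ v.2 := by exact_mod_cast (by push_cast; linarith : ((-⌈R₀⌉ : ℤ) : ℝ) ≤ v.2)
    have e4 : v.2 ≤ ⌈R₀⌉ := by exact_mod_cast (by linarith : (v.2 : ℝ) ≤ (⌈R₀⌉ : ℤ))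
    simp only [mem_box, Prod.fst_zero, Prod.snd_zero]
    omega
  refine ⟨⌈R₀⌉, Int.ceil_nonneg h0, fun ω => (h1 ω).trans hsub, fun ω ω' h => h2 ω ω' ?_⟩
  ext v
  have := congrArg (v ∈ ·) h
  simp only [mem_inter_iff, eq_iff_iff] at this ⊢
  constructor <;> rintro ⟨ha, hb⟩
  · exact ⟨(this.1 ⟨ha, hsub hb⟩).1, hb⟩
  · exact ⟨(this.2 ⟨ha, hsub hb⟩).1, hb⟩

theorem mem_box_zero {v : Site} {r : ℤ} :
    v ∈ box 0 r ↔ -r ≤ v.1 ∧ v.1 ≤ r ∧ -r ≤ v.2 ∧ v.2 ≤ r := by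
  simp only [mem_box, Prod.fst_zero, Prod.snd_zero]; omega

theorem exists_first_exit {g : ℕ → Site} (hg : Function.Injective g) {H : ℤ}
    (h0 : g 0 ∈ box 0 H) : ∃ n, (∀ k ≤ n, g k ∈ box 0 H) ∧ g (n + 1) ∉ box 0 H := by
  classical
  have hex : ∃ n, g n ∉ box 0 H := by
    by_contra hcon
    push Not at hcon
    exact infinite_univ (((box_finite 0 H).preimage hg.injOn).subset fun n _ => hcon n)
  have h1 : Nat.find hex ≠ 0 := fun h => by
    have := Nat.find_spec hex; rw [h] at this; exact this h0
  refine ⟨Nat.find hex - 1, fun k hk => ?_, ?_⟩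
  · have := Nat.find_min hex (m := k) (by omega)
    simpa using this
  · rw [show Nat.find hex - 1 + 1 = Nat.find hex by omega]
    exact Nat.find_spec hex

/-- The straight ray leaving the box of radius `M` perpendicularly at the boundary site `a`. -/
def outRay (M : ℤ) (a : Site) (n : ℕ) : Site :=
  if a.1 = M then (M + n, a.2) else if a.1 = -M then (-M - n, a.2) else
    if a.2 = M then (a.1, M + n) else (a.1, -M - n)

theorem outRay_cases {M : ℤ} {a : Site} (ha : a ∈ box 0 M) (ha' : a ∉ box 0 (M - 1)) (n : ℕ) :
    (a.1 = M ∧ (outRay M a n).1 = M + n ∧ (outRay M a n).2 = a.2) ∨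
    (a.1 = -M ∧ (outRay M a n).1 = -M - n ∧ (outRay M a n).2 = a.2) ∨
    (a.2 = M ∧ a.1 ≠ M ∧ a.1 ≠ -M ∧ (outRay M a n).1 = a.1 ∧ (outRay M a n).2 = M + n) ∨
    (a.2 = -M ∧ a.1 ≠ M ∧ a.1 ≠ -M ∧ (outRay M a n).1 = a.1 ∧ (outRay M a n).2 = -M - n) := by
  rw [mem_box_zero] at ha ha'
  unfold outRay
  split_ifs with h1 h2 h3 <;> simp only [true_and, and_true] <;> omega

theorem outRay_induced {M : ℤ} (hM : 1 ≤ M) {a : Site} (ha : a ∈ box 0 M)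
    (ha' : a ∉ box 0 (M - 1)) : IsInducedRay (outRay M a) := by
  intro n m
  have h1 := outRay_cases ha ha' n
  have h2 := outRay_cases ha ha' m
  rw [adjZ2_iff]; omega

theorem outRay_zero {M : ℤ} {a : Site} (ha : a ∈ box 0 M)
    (ha' : a ∉ box 0 (M - 1)) : outRay M a 0 = a := by
  have h1 := outRay_cases ha ha' 0
  ext <;> omega

/-- For an inessential enhancement, enhancing at the origin creates no new connection between
boundary sites of a box around the origin. -/
theorem reachIn_of_not_essential {R : ℤ} {φ : Config → Config} (hφ : BoxRange R φ)
    (hess : ¬ Essential adjZ2 φ) {M : ℤ} (hM : R + 1 ≤ M) {ζ : Config} {a b : Site}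
    (haζ : a ∈ ζ) (hbζ : b ∈ ζ) (ha : a ∈ box 0 M) (ha' : a ∉ box 0 (M - 1))
    (hb : b ∈ box 0 M) (hb' : b ∉ box 0 (M - 1))
    (h : ReachIn ((ζ ∪ φ ζ) ∩ box 0 M) a b) : ReachIn (ζ ∩ box 0 M) a b := by
  by_contra hcon
  have hR := hφ.nonneg
  have hab : a ≠ b := by
    rintro rfl; exact hcon (.refl ⟨haζ, ha⟩)
  have hnab : ¬ adjZ2 a b := fun h => hcon (.single ⟨haζ, ha⟩ h ⟨hbζ, hb⟩)
  have hca := outRay_cases ha ha'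
  have hcb := outRay_cases hb hb'
  have hsep : ∀ n m, outRay M a n ≠ outRay M b m ∧ ¬ adjZ2 (outRay M a n) (outRay M b m) := by
    intro n m
    have h1 := hca n
    have h2 := hcb m
    rw [adjZ2_iff] at hnab ⊢
    rw [ne_eq, Prod.ext_iff] at hab ⊢
    rw [mem_box_zero] at ha hb
    omega
  have hout : ∀ c : Site, c ∈ box 0 M → c ∉ box 0 (M - 1) → ∀ n, outRay M c n ∈ box 0 M →
      outRay M c n = c := by
    intro c hc hc' n hn
    have h1 := outRay_cases hc hc' n
    rw [mem_box_zero] at hn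
    ext <;> omega
  have hadj : ∀ c : Site, c ∈ box 0 M → c ∉ box 0 (M - 1) → ∀ n u, u ∈ box 0 M →
      outRay M c n ∉ box 0 M → adjZ2 u (outRay M c n) → u = c := by
    intro c hc hc' n u hu hn hun
    have h1 := outRay_cases hc hc' n
    rw [mem_box_zero] at hn hu hc
    rw [adjZ2_iff] at hun
    ext <;> omega
  obtain ⟨ω, hω⟩ : ∃ ω : Config, ω = (ζ ∩ box 0 M) ∪ (range (outRay M a) ∪ range (outRay M b)) :=
    ⟨_, rfl⟩
  refine hess ⟨ω, ?_, ?_⟩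
  · rintro ⟨γ, hγi, hγω, hγ⟩
    have hreach : ∀ v, ReachIn ω a v → (v ∈ box 0 M → ReachIn (ζ ∩ box 0 M) a v) ∧
        (v ∉ box 0 M → v ∈ range (outRay M a)) := by
      intro v hv
      refine hv.induct (P := fun v => (v ∈ box 0 M → ReachIn (ζ ∩ box 0 M) a v) ∧
        (v ∉ box 0 M → v ∈ range (outRay M a))) ⟨fun _ => .refl ⟨haζ, ha⟩, fun h => absurd ha h⟩ ?_
      rintro u v - ⟨hu1, hu2⟩ huv hvω
      constructor
      · intro hvb
        by_cases hub : u ∈ box 0 M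
        · refine (hu1 hub).tail huv ?_
          rw [hω] at hvω
          rcases hvω with h | ⟨n, rfl⟩ | ⟨n, rfl⟩
          · exact h
          · rw [hout a ha ha' n hvb]; exact ⟨haζ, ha⟩
          · rw [hout b hb hb' n hvb]; exact ⟨hbζ, hb⟩
        · obtain ⟨n, rfl⟩ := hu2 hub
          rw [hadj a ha ha' n v hvb hub huv.symm]
          exact .refl ⟨haζ, ha⟩
      · intro hvb
        rw [hω] at hvω
        rcases hvω with h | h | ⟨n, rfl⟩
        · exact absurd h.2 hvb
        · exact h
        · exfalso
          by_cases hub : u ∈ box 0 M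
          · rw [hadj b hb hb' n u hub hvb huv] at hu1
            exact hcon (hu1 hb)
          · obtain ⟨m, rfl⟩ := hu2 hub
            exact (hsep m n).2 huv
    have hpath : ∀ (i : ℤ) (n : ℕ), ReachIn ω (γ i) (γ (i + n)) := by
      intro i n
      induction n with
      | zero => simpa using ReachIn.refl (hγω i)
      | succ n ih =>
        refine ih.tail ((hγ _ _).2 (Or.inl ?_)) (hγω _)
        push_cast; ring
    have hpath' : ∀ i j : ℤ, ReachIn ω (γ i) (γ j) := by
      intro i j
      rcases le_total i j with h | h
      · have := hpath i (j - i).toNat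
        rwa [show i + ((j - i).toNat : ℤ) = j by omega] at this
      · have := hpath j (i - j).toNat
        rw [show j + ((i - j).toNat : ℤ) = i by omega] at this
        exact this.symm
    obtain ⟨H, hHM, hH0⟩ : ∃ H, M ≤ H ∧ γ 0 ∈ box 0 H := by
      refine ⟨max M (max |(γ 0).1| |(γ 0).2|), le_max_left _ _, ?_⟩
      have := le_abs_self (γ 0).1
      have := le_abs_self (γ 0).2
      have := neg_abs_le (γ 0).1
      have := neg_abs_le (γ 0).2
      rw [mem_box_zero]; omega
    obtain ⟨n, hn, hn'⟩ := exists_first_exit (g := fun n : ℕ => γ n)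
      (fun a b h => by simpa using hγi h) (by simpa using hH0)
    obtain ⟨m, hm, hm'⟩ := exists_first_exit (g := fun n : ℕ => γ (-n))
      (fun a b h => by simpa using hγi h) (by simpa using hH0)
    replace hn := hn n le_rfl
    replace hm := hm m le_rfl
    have hna : adjZ2 (γ n) (γ (n + 1 : ℕ)) := (hγ _ _).2 (Or.inl (by push_cast; ring))
    have hma : adjZ2 (γ (-m)) (γ (-(m + 1 : ℕ))) := (hγ _ _).2 (Or.inr (by push_cast; ring))
    have hne : γ (n + 1 : ℕ) ≠ γ (-(m + 1 : ℕ)) := fun h => by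
      have := hγi h; omega
    have hr := hpath' (n + 1 : ℕ) (-(m + 1 : ℕ))
    have hnω := hγω (n + 1 : ℕ)
    have hmω := hγω (-(m + 1 : ℕ))
    generalize γ (n + 1 : ℕ) = u at *
    generalize γ (-(m + 1 : ℕ)) = v at *
    generalize γ n = u' at *
    generalize γ (-m) = v' at *
    have hnb : ∀ w, w ∉ box 0 H → w ∉ box 0 M := fun w hw h => hw (box_mono hHM h)
    have key : ∀ u v, ReachIn ω u v → u ∉ box 0 H → v ∉ box 0 H → u ∈ range (outRay M a) →
        v ∈ range (outRay M b) → False := by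
      rintro u v hr hu hv ⟨k, rfl⟩ ⟨l, rfl⟩
      have h1 : ReachIn ω a (outRay M a k) := by
        clear hr hu
        induction k with
        | zero => rw [outRay_zero ha ha']; exact .refl (by rw [hω]; exact Or.inl ⟨haζ, ha⟩)
        | succ k ih =>
          exact ih.tail ((outRay_induced (by omega) ha ha' _ _).2 (Or.inl rfl))
            (by rw [hω]; exact Or.inr (Or.inl ⟨_, rfl⟩))
      obtain ⟨t, ht⟩ := (hreach _ (h1.trans hr)).2 (hnb _ hv)
      exact (hsep t l).1 ht
    have hray : ∀ w, w ∈ ω → w ∉ box 0 H → w ∈ range (outRay M a) ∨ w ∈ range (outRay M b) := by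
      intro w hw hwH
      rw [hω] at hw
      rcases hw with h | h
      · exact absurd h.2 (hnb _ hwH)
      · exact h
    have huniq : ∀ c : Site, c ∈ box 0 M → c ∉ box 0 (M - 1) → u ∈ range (outRay M c) →
        v ∈ range (outRay M c) → False := by
      rintro c hc hc' ⟨k, rfl⟩ ⟨l, rfl⟩
      have h1 := outRay_cases hc hc' k
      have h2 := outRay_cases hc hc' l
      rw [mem_box_zero] at hn hm hn' hm' hc
      rw [adjZ2_iff] at hna hma
      rw [ne_eq, Prod.ext_iff] at hne
      clear hω hreach hpath hpath' hγ hγi hγω hca hcb hsep hout hadj h hcon key hray hr hnb hnab hab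
      have : k = l := by omega
      subst this
      exact hne ⟨rfl, rfl⟩
    rcases hray u hnω hn' with hu | hu <;> rcases hray v hmω hm' with hv | hv
    · exact huniq a ha ha' hu hv
    · exact key u v hr hn' hm' hu hv
    · exact key v u hr.symm hm' hn' hv hu
    · exact huniq b hb hb' hu hv
  · have hφω : φ ω = φ ζ := by
      refine hφ.congr _ _ ?_
      have hray : ∀ c : Site, c ∈ box 0 M → c ∉ box 0 (M - 1) → ∀ n, outRay M c n ∉ box 0 R := by
        intro c hc hc' n
        have := outRay_cases hc hc' n
        rw [mem_box_zero]; omega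
      ext v
      rw [hω]
      constructor
      · rintro ⟨h | ⟨n, rfl⟩ | ⟨n, rfl⟩, hv⟩
        · exact ⟨h.1, hv⟩
        · exact absurd hv (hray a ha ha' n)
        · exact absurd hv (hray b hb hb' n)
      · rintro ⟨h, hv⟩
        exact ⟨Or.inl ⟨h, box_mono (by omega) hv⟩, hv⟩
    refine hasDISRPath_of_rays (f := outRay M a) (g := outRay M b)
      (outRay_induced (by omega) ha ha') (outRay_induced (by omega) hb hb')
      (fun n => ?_) (fun n => ?_) (fun n m => (hsep n m).1) (fun n m => (hsep n m).2) ?_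
    · rw [hω]; exact Or.inl (Or.inr (Or.inl ⟨_, rfl⟩))
    · rw [hω]; exact Or.inl (Or.inr (Or.inr ⟨_, rfl⟩))
    · rw [outRay_zero ha ha', outRay_zero hb hb', hφω, hω]
      refine h.mono ?_
      rintro v ⟨hv | hv, hv'⟩
      · exact Or.inl (Or.inl ⟨hv, hv'⟩)
      · exact Or.inr hv

/-- A local pattern in the box of radius `M` in which the enhancement at the origin joins two
boundary sites. -/
structure Pattern (φ : Config → Config) (M : ℤ) (ω₀ : Config) (c d : Site) : Prop where
  subset : ω₀ ⊆ box 0 M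
  ring : ∀ v ∈ ω₀, v ∉ box 0 (M - 1) → v = c ∨ v = d
  left_mem : c ∈ ω₀
  right_mem : d ∈ ω₀
  left_ring : c ∉ box 0 (M - 1)
  right_ring : d ∉ box 0 (M - 1)
  ne : c ≠ d
  not_adj : ¬ adjZ2 c d
  not_reachIn : ¬ ReachIn ω₀ c d
  reachIn : ReachIn (ω₀ ∪ φ ω₀) c d

theorem Essential.exists_pattern {R : ℤ} {φ : Config → Config} (hφ : BoxRange R φ)
    (hess : Essential adjZ2 φ) (M₀ : ℤ) :
    ∃ M ω₀ c d, M₀ ≤ M ∧ R + 1 ≤ M ∧ Pattern φ M ω₀ c d := by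
  obtain ⟨ω, hno, γ, hγi, hγω, hγ⟩ := hess
  have hIfin : {i | γ i ∈ box 0 R}.Finite := (box_finite 0 R).preimage hγi.injOn
  have hIne : {i | γ i ∈ box 0 R}.Nonempty := by
    by_contra hcon
    refine hno ⟨γ, hγi, fun i => ?_, hγ⟩
    rcases hγω i with h | h
    · exact h
    · exact absurd ⟨i, hφ.subset _ h⟩ hcon
  obtain ⟨l, hl⟩ := hIfin.bddBelow
  obtain ⟨u, hu⟩ := hIfin.bddAbove
  have hlu : l ≤ u := by
    obtain ⟨i, hi⟩ := hIne
    exact (hl hi).trans (hu hi)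
  have hω : ∀ i, i < l ∨ u < i → γ i ∈ ω ∧ γ i ∉ box 0 R := by
    intro i hi
    have : γ i ∉ box 0 R := fun h => by
      have := hl h
      have := hu h
      omega
    refine ⟨?_, this⟩
    rcases hγω i with h | h
    · exact h
    · exact absurd (hφ.subset _ h) this
  obtain ⟨M₁, hM₁⟩ : ∃ M₁ : ℤ, ∀ i, l ≤ i → i ≤ u → γ i ∈ box 0 M₁ := by
    have hf : (γ '' Icc l u).Finite := (finite_Icc l u).image γ
    obtain ⟨A, hA⟩ := (hf.image fun v : Site => max |v.1| |v.2|).bddAbove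
    refine ⟨A, fun i h1 h2 => ?_⟩
    have := hA ⟨γ i, ⟨i, ⟨h1, h2⟩, rfl⟩, rfl⟩
    dsimp only at this
    have := le_abs_self (γ i).1
    have := le_abs_self (γ i).2
    have := neg_abs_le (γ i).1
    have := neg_abs_le (γ i).2
    rw [mem_box_zero]; omega
  obtain ⟨M, hMM₀, hMR, hMM₁⟩ : ∃ M : ℤ, M₀ ≤ M ∧ R + 1 ≤ M ∧ M₁ + 1 ≤ M :=
    ⟨max M₀ (max (R + 1) (M₁ + 1)), by omega, by omega, by omega⟩
  have hmid : ∀ i, l ≤ i → i ≤ u → γ i ∈ box 0 (M - 1) := fun i h1 h2 =>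
    box_mono (by omega) (hM₁ i h1 h2)
  obtain ⟨n, hn, hn'⟩ := exists_first_exit (g := fun n : ℕ => γ (u + n)) (H := M - 1)
    (fun a b h => by simpa using hγi h) (by simpa using hmid u hlu le_rfl)
  obtain ⟨m, hm, hm'⟩ := exists_first_exit (g := fun n : ℕ => γ (l - n)) (H := M - 1)
    (fun a b h => by simpa using hγi h) (by simpa using hmid l le_rfl hlu)
  obtain ⟨i, hi⟩ : ∃ i, i = l - (m + 1 : ℕ) := ⟨_, rfl⟩
  obtain ⟨j, hj⟩ : ∃ j, j = u + (n + 1 : ℕ) := ⟨_, rfl⟩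
  rw [← hi] at hm'
  rw [← hj] at hn'
  have hin : ∀ k, i < k → k < j → γ k ∈ box 0 (M - 1) := by
    intro k h1 h2
    rcases lt_or_ge k l with h | h
    · have := hm (l - k).toNat (by omega)
      rwa [show l - ((l - k).toNat : ℤ) = k by omega] at this
    rcases le_or_gt k u with h' | h'
    · exact hmid k h h'
    · have := hn (k - u).toNat (by omega)
      rwa [show u + ((k - u).toNat : ℤ) = k by omega] at this
  have hib : γ i ∈ box 0 M := by
    have h1 := hin (i + 1) (by omega) (by omega)
    have h2 := (hγ i (i + 1)).2 (Or.inl rfl)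
    rw [mem_box_zero] at *; rw [adjZ2_iff] at h2; omega
  have hjb : γ j ∈ box 0 M := by
    have h1 := hin (j - 1) (by omega) (by omega)
    have h2 := (hγ j (j - 1)).2 (Or.inr (by ring))
    rw [mem_box_zero] at *; rw [adjZ2_iff] at h2; omega
  have hωi := hω i (by omega)
  have hωj := hω j (by omega)
  obtain ⟨ω₀, hω₀⟩ : ∃ ω₀ : Config, ω₀ = (ω ∩ box 0 (M - 1)) ∪ {γ i, γ j} := ⟨_, rfl⟩
  have hφω : φ ω₀ = φ ω := by
    refine hφ.congr _ _ ?_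
    rw [hω₀]
    ext v
    constructor
    · rintro ⟨h | rfl | rfl, hv⟩
      · exact ⟨h.1, hv⟩
      · exact absurd hv hωi.2
      · exact absurd hv hωj.2
    · rintro ⟨h, hv⟩
      exact ⟨Or.inl ⟨h, box_mono (by omega) hv⟩, hv⟩
  have hsubω : ω₀ ⊆ ω := by
    rw [hω₀]
    rintro v (h | rfl | rfl)
    exacts [h.1, hωi.1, hωj.1]
  have hcω : γ i ∈ ω₀ := by rw [hω₀]; exact Or.inr (Or.inl rfl)
  have hdω : γ j ∈ ω₀ := by rw [hω₀]; exact Or.inr (Or.inr rfl)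
  refine ⟨M, ω₀, γ i, γ j, hMM₀, hMR, ?_, ?_, hcω, hdω, hm', hn', ?_, ?_, ?_, ?_⟩
  · rw [hω₀]
    rintro v (h | rfl | rfl)
    exacts [box_mono (by omega) h.2, hib, hjb]
  · rw [hω₀]
    rintro v (h | rfl | rfl) hv
    exacts [absurd h.2 hv, Or.inl rfl, Or.inr rfl]
  · intro h
    have := hγi h; omega
  · rw [hγ]; omega
  · intro hr
    refine hno (hasDISRPath_of_rays (f := fun n => γ (i - n)) (g := fun n => γ (j + n))
      (fun a b => ?_) (fun a b => ?_) (fun a => (hω _ (by omega)).1) (fun a => (hω _ (by omega)).1)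
      (fun a b h => ?_) (fun a b => ?_) ?_)
    · rw [hγ]; omega
    · rw [hγ]; omega
    · have := hγi h; omega
    · rw [hγ]; omega
    · simpa using hr.mono hsubω
  · have : ∀ k : ℕ, i + k ≤ j → ReachIn (ω₀ ∪ φ ω₀) (γ i) (γ (i + k)) := by
      intro k
      induction k with
      | zero => intro _; simpa using ReachIn.refl (Or.inl hcω)
      | succ k ih =>
        intro hk
        refine (ih (by push_cast at hk; omega)).tail ((hγ _ _).2 (Or.inl (by push_cast; ring))) ?_
        rcases eq_or_ne (i + ((k + 1 : ℕ) : ℤ)) j with h | h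
        · rw [h]; exact Or.inl hdω
        · have h1 := hin (i + ((k + 1 : ℕ) : ℤ)) (by omega) (by omega)
          rcases hγω (i + ((k + 1 : ℕ) : ℤ)) with h2 | h2
          · rw [hω₀]; exact Or.inl (Or.inl ⟨h2, h1⟩)
          · rw [hφω]; exact Or.inr h2
    have h1 := this (j - i).toNat (by omega)
    rwa [show i + ((j - i).toNat : ℤ) = j by omega] at h1

/-! ### Reaching the boundary of a box -/

theorem ReachIn.map {X Y : Set Site} {x y : Site} (h : ReachIn X x y) (f : Site → Site)
    (hf : ∀ u v, adjZ2 u v → adjZ2 (f u) (f v)) (hXY : ∀ v ∈ X, f v ∈ Y) :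
    ReachIn Y (f x) (f y) :=
  h.induct (P := fun y => ReachIn Y (f x) (f y)) (.refl (hXY _ h.1))
    fun _ _ _ hu huv hv => hu.tail (hf _ _ huv) (hXY _ hv)

theorem reachIn_hline {X : Set Site} {y a b : ℤ} (hab : a ≤ b)
    (h : ∀ t, a ≤ t → t ≤ b → (t, y) ∈ X) : ReachIn X (a, y) (b, y) := by
  have : ∀ k : ℕ, a + k ≤ b → ReachIn X (a, y) (a + k, y) := by
    intro k
    induction k with
    | zero => intro _; simpa using ReachIn.refl (h a le_rfl hab)
    | succ k ih =>
      intro hk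
      push_cast at hk
      refine (ih (by omega)).tail ?_ (h _ (by omega) (by push_cast; omega))
      rw [adjZ2_iff]; push_cast; omega
  have h1 := this (b - a).toNat (by omega)
  rwa [show a + ((b - a).toNat : ℤ) = b by omega] at h1

theorem reachIn_vline {X : Set Site} {x a b : ℤ} (hab : a ≤ b)
    (h : ∀ t, a ≤ t → t ≤ b → (x, t) ∈ X) : ReachIn X (x, a) (x, b) := by
  have h1 := reachIn_hline (X := {v | (v.2, v.1) ∈ X}) (y := x) hab h
  refine h1.map (fun v => (v.2, v.1)) (fun u v huv => ?_) (fun v hv => hv)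
  rw [adjZ2_iff] at *; dsimp only; omega

/-- A site outside the box of radius `r` around the origin can be moved straight outwards,
out of any given finite box. -/
theorem exists_reachIn_outside {X : Set Site} {r : ℤ} (hX : ∀ v, v ∉ box 0 r → v ∈ X)
    {y : Site} (hy : y ∉ box 0 r) (x : Site) (k : ℤ) :
    ∃ y', y' ∉ box 0 r ∧ y' ∉ box x k ∧ ReachIn X y y' := by
  obtain ⟨y1, y2⟩ := y
  obtain ⟨x1, x2⟩ := x
  have h4 : r + 1 ≤ y1 ∨ y1 ≤ -r - 1 ∨ r + 1 ≤ y2 ∨ y2 ≤ -r - 1 := by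
    rw [mem_box_zero] at hy; dsimp only at hy; omega
  obtain ⟨A, hA1, hA2, hA3, hA4⟩ : ∃ A : ℤ, x1 + k < A ∧ -(x1 - k) < A ∧ x2 + k < A ∧
      -(x2 - k) < A := ⟨max (max (x1 + k) (-(x1 - k))) (max (x2 + k) (-(x2 - k))) + 1,
        by omega, by omega, by omega, by omega⟩
  rcases h4 with h | h | h | h
  · refine ⟨(max y1 A, y2), ?_, ?_, reachIn_hline (by omega) fun t h1 h2 => hX _ ?_⟩
    · rw [mem_box_zero]; dsimp only; omega
    · rw [mem_box]; dsimp only; omega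
    · rw [mem_box_zero]; dsimp only; omega
  · refine ⟨(min y1 (-A), y2), ?_, ?_, (reachIn_hline (by omega) fun t h1 h2 => hX _ ?_).symm⟩
    · rw [mem_box_zero]; dsimp only; omega
    · rw [mem_box]; dsimp only; omega
    · rw [mem_box_zero]; dsimp only; omega
  · refine ⟨(y1, max y2 A), ?_, ?_, reachIn_vline (by omega) fun t h1 h2 => hX _ ?_⟩
    · rw [mem_box_zero]; dsimp only; omega
    · rw [mem_box]; dsimp only; omega
    · rw [mem_box_zero]; dsimp only; omega
  · refine ⟨(y1, min y2 (-A)), ?_, ?_, (reachIn_vline (by omega) fun t h1 h2 => hX _ ?_).symm⟩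
    · rw [mem_box_zero]; dsimp only; omega
    · rw [mem_box]; dsimp only; omega
    · rw [mem_box_zero]; dsimp only; omega

/-- The origin is joined inside the box of radius `n` to its boundary. -/
def Esc (n : ℤ) (X : Set Site) : Prop :=
  ∃ y, ReachIn (X ∩ box 0 n) 0 y ∧ y ∉ box 0 (n - 1)

theorem Esc.of_reachIn {X : Set Site} {y : Site} {n : ℤ} (hn : 0 ≤ n) (h : ReachIn X 0 y)
    (hy : y ∉ box 0 (n - 1)) : Esc n X := by
  rcases hn.eq_or_lt with rfl | hn
  · refine ⟨0, .refl ⟨h.1, ?_⟩, ?_⟩ <;> simp only [mem_box_zero, Prod.fst_zero, Prod.snd_zero] <;>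
      omega
  obtain ⟨u, v, h1, h2, h3, h4⟩ := h.first_hit (box 0 (n - 1))ᶜ
    (by simp only [mem_compl_iff, mem_box_zero, Prod.fst_zero, Prod.snd_zero]; omega) hy
  refine ⟨v, (h1.mono ?_).tail h2 ⟨h3, ?_⟩, h4⟩
  · rintro w ⟨hw, hw'⟩
    exact ⟨hw, box_mono (by omega) (not_not.1 hw')⟩
  · have := h1.right_mem.2
    rw [mem_compl_iff, not_not] at this
    rw [adjZ2_iff] at h2
    rw [mem_box_zero] at *; omega

theorem Esc.mono {X Y : Set Site} {n : ℤ} (hXY : X ∩ box 0 n ⊆ Y) (h : Esc n X) : Esc n Y := by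
  obtain ⟨y, hy, hy'⟩ := h
  exact ⟨y, hy.mono fun v hv => ⟨hXY hv, hv.2⟩, hy'⟩

theorem Esc.anti {X : Set Site} {n m : ℤ} (hn : 0 ≤ n) (hnm : n ≤ m) (h : Esc m X) : Esc n X := by
  obtain ⟨y, hy, hy'⟩ := h
  exact .of_reachIn hn (hy.mono inter_subset_left) fun h => hy' (box_mono (by omega) h)

theorem inInfiniteCluster_iff {X : Set Site} :
    InInfiniteCluster adjZ2 X 0 ↔ ∀ n : ℕ, Esc n X := by
  simp only [InInfiniteCluster, connectedIn_iff]
  constructor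
  · intro h n
    obtain ⟨y, hy, hy'⟩ := h.exists_notMem_finite (box_finite 0 ((n : ℤ) - 1))
    exact .of_reachIn (by omega) hy hy'
  · intro h hfin
    obtain ⟨A, hA⟩ := (hfin.image fun v : Site => max |v.1| |v.2|).bddAbove
    obtain ⟨y, hy, hy'⟩ := h (A + 1).toNat
    have hy'' := hA ⟨y, hy.mono inter_subset_left, rfl⟩
    dsimp only at hy''
    have := le_abs_self y.1
    have := le_abs_self y.2
    have := neg_abs_le y.1
    have := neg_abs_le y.2
    rw [mem_box_zero] at hy'; omega

/-! ### Inessential enhancements -/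

section enhAt

variable {R : ℤ} {φ : Config → Config}

theorem enhAt_subset (hφ : BoxRange R φ) (x : Site) (ω : Config) : enhAt φ x ω ⊆ box x R := by
  rintro _ ⟨v, hv, rfl⟩
  have := hφ.subset _ hv
  rw [mem_box_zero] at this
  simp only [mem_box, Prod.fst_add, Prod.snd_add]; omega

theorem enhAt_mono (hmono : Monotonic φ) (x : Site) {ω ω' : Config} (h : ω ⊆ ω') :
    enhAt φ x ω ⊆ enhAt φ x ω' :=
  image_mono (hmono _ _ fun _ hv => h hv)

theorem mem_box_sub {x v : Site} {r : ℤ} : v - x ∈ box 0 r ↔ v ∈ box x r := by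
  simp only [mem_box, Prod.fst_sub, Prod.snd_sub, Prod.fst_zero, Prod.snd_zero]; omega

theorem adjZ2_sub {u v : Site} (x : Site) (h : adjZ2 u v) : adjZ2 (u - x) (v - x) := by
  simp only [adjZ2_iff, Prod.fst_sub, Prod.snd_sub] at *; omega

theorem reachIn_of_not_essential_at (hφ : BoxRange R φ) (hess : ¬ Essential adjZ2 φ) (x : Site)
    {ζ : Config} {a b : Site} (haζ : a ∈ ζ) (hbζ : b ∈ ζ) (ha : a ∈ box x (R + 1))
    (ha' : a ∉ box x R) (hb : b ∈ box x (R + 1)) (hb' : b ∉ box x R)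
    (h : ReachIn ((ζ ∪ enhAt φ x ζ) ∩ box x (R + 1)) a b) : ReachIn ζ a b := by
  have h1 := h.map (Y := (shiftConfig x ζ ∪ φ (shiftConfig x ζ)) ∩ box 0 (R + 1))
    (fun v => v - x) (fun u v => adjZ2_sub x) (by
      rintro v ⟨hv, hv'⟩
      refine ⟨?_, mem_box_sub.2 hv'⟩
      rcases hv with hv | ⟨w, hw, rfl⟩
      · left; simpa [shiftConfig] using hv
      · right; simpa using hw)
  have h2 := reachIn_of_not_essential hφ hess le_rfl (by simpa [shiftConfig] using haζ)
    (by simpa [shiftConfig] using hbζ) (mem_box_sub.2 ha) (by simpa [mem_box_sub] using ha')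
    (mem_box_sub.2 hb) (by simpa [mem_box_sub] using hb') h1
  have h3 := h2.map (Y := ζ) (fun v => v + x) (fun u v h => adjZ2_add_right.2 h) (by
    rintro v ⟨hv, -⟩; exact hv)
  simpa using h3

/-- For an inessential enhancement, a single enhancement does not create connections between
sites outside of a neighbourhood of the place of enhancement. -/
theorem reachIn_of_reachIn_enhAt (hφ : BoxRange R φ) (hess : ¬ Essential adjZ2 φ) (x : Site)
    {ζ : Config} {s t : Site} (hs : s ∉ box x R) (ht : t ∉ box x R)
    (h : ReachIn (ζ ∪ enhAt φ x ζ) s t) : ReachIn ζ s t := by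
  have hmem : ∀ v, v ∉ box x R → v ∈ ζ ∪ enhAt φ x ζ → v ∈ ζ := by
    rintro v hv (h | h)
    · exact h
    · exact absurd (enhAt_subset hφ x ζ h) hv
  refine (h.induct (P := fun v => (v ∉ box x R → ReachIn ζ s v) ∧ (v ∈ box x R →
    ∃ a, a ∈ box x (R + 1) ∧ a ∉ box x R ∧ ReachIn ζ s a ∧
      ReachIn ((ζ ∪ enhAt φ x ζ) ∩ box x (R + 1)) a v))
    ⟨fun _ => .refl (hmem _ hs h.1), fun h => absurd h hs⟩ ?_).1 ht
  rintro u v hsu ⟨hu1, hu2⟩ huv hv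
  have hstep : ∀ u v, adjZ2 u v → u ∈ box x R → v ∈ box x (R + 1) := by
    intro u v h h'
    rw [adjZ2_iff] at h; rw [mem_box] at *; omega
  constructor
  · intro hvb
    by_cases hub : u ∈ box x R
    · obtain ⟨a, ha, ha', hsa, hau⟩ := hu2 hub
      have hvb' := hstep u v huv hub
      exact hsa.trans (reachIn_of_not_essential_at hφ hess x hsa.right_mem (hmem _ hvb hv) ha ha'
        hvb' hvb (hau.tail huv ⟨hv, hvb'⟩))
    · exact (hu1 hub).tail huv (hmem _ hvb hv)
  · intro hvb
    have hvb' : v ∈ box x (R + 1) := box_mono (by omega) hvb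
    by_cases hub : u ∈ box x R
    · obtain ⟨a, ha, ha', hsa, hau⟩ := hu2 hub
      exact ⟨a, ha, ha', hsa, hau.tail huv ⟨hv, hvb'⟩⟩
    · have := hstep v u huv.symm hvb
      exact ⟨u, this, hub, hu1 hub, .single ⟨hsu.right_mem, this⟩ huv ⟨hv, hvb'⟩⟩

/-- For a monotonic inessential enhancement, provided an initial segment is open, the enhanced
configuration reaches far only if the original one does. -/
theorem esc_of_esc_enhanced (hφ : BoxRange R φ) (hess : ¬ Essential adjZ2 φ)
    (hmono : Monotonic φ) {ω : Config} {α : Site → Bool} {n : ℤ} (hn : 1 ≤ n)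
    (hS : ∀ t : ℤ, 0 ≤ t → t ≤ 2 * R + 2 → (t, 0) ∈ ω) (h : Esc n (enhanced φ ω α)) :
    Esc (n - 1) ω := by
  have hR := hφ.nonneg
  obtain ⟨T, hT⟩ : ∃ T : Set Site, T = (box 0 (n - 1))ᶜ := ⟨_, rfl⟩
  have key : ∀ (l : List Site) (ω' : Config), ω ∪ T ⊆ ω' →
      (∃ y, y ∉ box 0 (n - 1) ∧
        ReachIn (ω' ∪ {y | ∃ x ∈ l, y ∈ enhAt φ x ω'}) 0 y) →
      ∃ y, y ∉ box 0 (n - 1) ∧ ReachIn ω' 0 y := by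
    intro l
    induction l with
    | nil => rintro ω' _ ⟨y, hy, h⟩; exact ⟨y, hy, by simpa using h⟩
    | cons x l ih =>
      rintro ω' hω' ⟨y, hy, h⟩
      obtain ⟨y, hy, h⟩ := ih (ω' ∪ enhAt φ x ω') (hω'.trans subset_union_left)
        ⟨y, hy, h.mono (by
          rintro v (hv | ⟨x', hx', hv⟩)
          · exact Or.inl (Or.inl hv)
          · rcases List.mem_cons.1 hx' with rfl | hx'
            · exact Or.inl (Or.inr hv)
            · exact Or.inr ⟨x', hx', enhAt_mono hmono _ subset_union_left hv⟩)⟩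
      obtain ⟨y', hy', hy'x, hyy'⟩ := exists_reachIn_outside (X := ω') (r := n - 1)
        (fun v hv => hω' (Or.inr (by rw [hT]; exact hv))) hy x R
      refine ⟨y', hy', ?_⟩
      have h0 : ∃ s, s ∉ box x R ∧ ReachIn ω' 0 s := by
        have hω0 : ∀ t : ℤ, 0 ≤ t → t ≤ 2 * R + 2 → (t, 0) ∈ ω' := fun t h1 h2 =>
          hω' (Or.inl (hS t h1 h2))
        by_cases hx : (0 : Site) ∈ box x R
        · refine ⟨(2 * R + 2, 0), ?_, reachIn_hline (by omega) hω0⟩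
          rw [mem_box] at *; simp only [Prod.fst_zero, Prod.snd_zero] at *; omega
        · exact ⟨0, hx, .refl (hω0 0 le_rfl (by omega))⟩
      obtain ⟨s, hs, hs0⟩ := h0
      exact hs0.trans (reachIn_of_reachIn_enhAt hφ hess x hs hy'x
        (((hs0.mono subset_union_left).symm.trans h).trans (hyy'.mono subset_union_left)))
  obtain ⟨y, hy, hy'⟩ := h
  obtain ⟨y, hy, h⟩ := key (box_finite 0 (n + R)).toFinset.toList (ω ∪ T) Subset.rfl ⟨y, hy', hy.mono (by
    rintro v ⟨hv, -⟩
    rcases hv with hv | ⟨x, -, hv⟩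
    · exact Or.inl (Or.inl hv)
    · by_cases hvT : v ∈ T
      · exact Or.inl (Or.inr hvT)
      · refine Or.inr ⟨x, ?_, enhAt_mono hmono _ subset_union_left hv⟩
        have h1 := enhAt_subset hφ _ _ hv
        rw [hT, mem_compl_iff, not_not] at hvT
        rw [Finset.mem_toList, Finite.mem_toFinset]
        rw [mem_box_zero] at *; rw [mem_box] at h1; omega)⟩
  obtain ⟨u, v, h1, h2, h3, h4⟩ := h.first_hit T
    (by rw [hT]; simp only [mem_compl_iff, mem_box_zero, Prod.fst_zero, Prod.snd_zero]; omega)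
    (by rw [hT]; exact hy)
  refine .of_reachIn (by omega) (h1.mono fun w hw => hw.1.resolve_right hw.2) (y := u) ?_
  rw [hT] at h4
  rw [adjZ2_iff] at h2
  simp only [mem_compl_iff, mem_box_zero] at *; omega

end enhAt

/-! ### Local surgery: routing two strands through an annulus -/

/-- Two sets of sites which are disjoint and not adjacent to each other. -/
def Apart (U V : Set Site) : Prop := ∀ u ∈ U, ∀ v ∈ V, u ≠ v ∧ ¬ adjZ2 u v

theorem Apart.symm {U V : Set Site} (h : Apart U V) : Apart V U :=
  fun v hv u hu => ⟨(h u hu v hv).1.symm, fun ha => (h u hu v hv).2 ha.symm⟩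

/-- `U` contains a path leading from `p` to `p'`; it meets the boundary of the box of radius `r`
only in `p` and the box of radius `r'` only in `p'`. -/
structure IsStrand (U : Set Site) (r : ℤ) (p : Site) (r' : ℤ) (p' : Site) : Prop where
  subset : U ⊆ box 0 r
  outer : ∀ v ∈ U, v ∉ box 0 (r - 1) → v = p
  inner : ∀ v ∈ U, v ∈ box 0 r' → v = p'
  reach : ReachIn U p p'

/-- Two separated strands leading from `p`, `q` to `p'`, `q'`. -/
def Route (r : ℤ) (p q : Site) (r' : ℤ) (p' q' : Site) : Prop :=
  ∃ U V, IsStrand U r p r' p' ∧ IsStrand V r q r' q' ∧ Apart U V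

theorem Route.swap {r r' : ℤ} {p q p' q' : Site} (h : Route r p q r' p' q') :
    Route r q p r' q' p' := by
  obtain ⟨U, V, hU, hV, hUV⟩ := h
  exact ⟨V, U, hV, hU, hUV.symm⟩

/-- `Z` meets the box of radius `r` only in `p` and `q`; the former is joined to `o` and the
latter to `T`, but `o` is not joined to `T`. -/
structure Good (o : Site) (T Z : Set Site) (r : ℤ) (p q : Site) : Prop where
  hits : ∀ v ∈ Z, v ∈ box 0 r → v = p ∨ v = q
  left : ReachIn Z o p
  right : ∃ t ∈ T, ReachIn Z q t
  sep : ∀ t ∈ T, ¬ ReachIn Z o t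

/-- Some configuration agreeing with `X` off the box of radius `K` is in state `Good`. -/
def GoodAt (o : Site) (T X : Set Site) (K r : ℤ) (p q : Site) : Prop :=
  ∃ Z, (∀ v, v ∉ box 0 K → (v ∈ Z ↔ v ∈ X)) ∧ Good o T Z r p q

theorem mem_box_succ_of_adj {u v : Site} {r : ℤ} (hu : u ∈ box 0 (r - 1)) (h : adjZ2 u v) :
    v ∈ box 0 r := by
  rw [adjZ2_iff] at h; rw [mem_box_zero] at *; omega

theorem GoodAt.route {o : Site} {T X : Set Site} {K r r' : ℤ} {p q p' q' : Site}
    (h : GoodAt o T X K r p q) (hrK : r ≤ K) (hr' : r' ≤ r) (hT : ∀ t ∈ T, t ∉ box 0 K)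
    (hR : Route r p q r' p' q') : GoodAt o T X K r' p' q' := by
  obtain ⟨Z, hZX, hZ⟩ := h
  obtain ⟨U, V, hU, hV, hUV⟩ := hR
  obtain ⟨t₀, ht₀, hqt₀⟩ := hZ.right
  have hpU : p ∈ U := hU.reach.1
  have hqV : q ∈ V := hV.reach.1
  have hq : ¬ ReachIn Z o q := fun h => hZ.sep t₀ ht₀ (h.trans hqt₀)
  refine ⟨Z ∪ (U ∪ V), fun v hv => ?_, ?_, ?_, ?_, ?_⟩
  · rw [← hZX v hv]
    refine ⟨fun h => ?_, Or.inl⟩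
    rcases h with h | h | h
    · exact h
    · exact absurd (box_mono hrK (hU.subset h)) hv
    · exact absurd (box_mono hrK (hV.subset h)) hv
  · rintro v (hv | hv | hv) hvr
    · rcases hZ.hits v hv (box_mono hr' hvr) with rfl | rfl
      · exact Or.inl (hU.inner _ hpU hvr)
      · exact Or.inr (hV.inner _ hqV hvr)
    · exact Or.inl (hU.inner v hv hvr)
    · exact Or.inr (hV.inner v hv hvr)
  · exact (hZ.left.mono subset_union_left).trans
      (hU.reach.mono (subset_union_left.trans subset_union_right))
  · exact ⟨t₀, ht₀, (hV.reach.symm.mono (subset_union_right.trans subset_union_right)).trans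
      (hqt₀.mono subset_union_left)⟩
  · intro t ht hot
    have := hot.induct (P := fun v => ReachIn Z o v ∨ v ∈ U) (Or.inl (.refl hZ.left.1)) (by
      rintro u v - hu huv (hv | hv | hv)
      · rcases hu with hu | hu
        · exact Or.inl (hu.tail huv hv)
        · by_cases hub : u ∈ box 0 (r - 1)
          · rcases hZ.hits v hv (mem_box_succ_of_adj hub huv) with rfl | rfl
            · exact Or.inl hZ.left
            · exact absurd huv (hUV u hu v hqV).2
          · obtain rfl := hU.outer u hu hub
            exact Or.inl (hZ.left.tail huv hv)
      · exact Or.inr hv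
      · exfalso
        rcases hu with hu | hu
        · by_cases hvb : v ∈ box 0 (r - 1)
          · rcases hZ.hits u hu.right_mem (mem_box_succ_of_adj hvb huv.symm) with rfl | rfl
            · exact (hUV u hpU v hv).2 huv
            · exact hq hu
          · obtain rfl := hV.outer v hv hvb
            exact hq (hu.tail huv hqt₀.1)
        · exact (hUV u hu v hv).2 huv)
    rcases this with h | h
    · exact hZ.sep t ht h
    · exact hT t ht (box_mono hrK (hU.subset h))

/-- Inserting a pattern into a configuration with two separated strands leading to its two
boundary sites makes the enhancement at the origin decisive. -/
theorem GoodAt.insert_pattern {φ : Config → Config} {M : ℤ} {ω₀ : Config} {c d : Site}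
    (hpat : Pattern φ M ω₀ c d) {o : Site} {T X : Set Site} {K : ℤ} (hMK : M ≤ K)
    (hT : ∀ t ∈ T, t ∉ box 0 K) (h : GoodAt o T X K M c d ∨ GoodAt o T X K M d c) :
    ∃ X', (∀ v, v ∉ box 0 K → (v ∈ X' ↔ v ∈ X)) ∧ (∀ v ∈ box 0 M, v ∈ X' ↔ v ∈ ω₀) ∧
      (∀ t ∈ T, ¬ ReachIn X' o t) ∧ ∃ t ∈ T, ReachIn (X' ∪ φ ω₀) o t := by
  obtain ⟨p, q, hpω, hqω, hring, hnr, hr, Z, hZX, hZ⟩ : ∃ p q, p ∈ ω₀ ∧ q ∈ ω₀ ∧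
      (∀ v ∈ ω₀, v ∉ box 0 (M - 1) → v = p ∨ v = q) ∧ ¬ ReachIn ω₀ p q ∧
      ReachIn (ω₀ ∪ φ ω₀) p q ∧ GoodAt o T X K M p q := by
    rcases h with h | h
    · exact ⟨c, d, hpat.left_mem, hpat.right_mem, hpat.ring, hpat.not_reachIn, hpat.reachIn, h⟩
    · exact ⟨d, c, hpat.right_mem, hpat.left_mem, fun v hv hv' => (hpat.ring v hv hv').symm,
        fun h => hpat.not_reachIn h.symm, hpat.reachIn.symm, h⟩
  obtain ⟨t₀, ht₀, hqt₀⟩ := hZ.right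
  have hq : ¬ ReachIn Z o q := fun h => hZ.sep t₀ ht₀ (h.trans hqt₀)
  refine ⟨Z ∪ ω₀, fun v hv => ?_, fun v hv => ⟨fun h => ?_, Or.inr⟩, fun t ht hot => ?_,
    t₀, ht₀, ?_⟩
  · rw [← hZX v hv]
    refine ⟨fun h => h.resolve_right fun h => hv (box_mono hMK (hpat.subset h)), Or.inl⟩
  · rcases h with h | h
    · rcases hZ.hits v h hv with rfl | rfl
      exacts [hpω, hqω]
    · exact h
  · have := hot.induct (P := fun v => ReachIn Z o v ∨ ReachIn ω₀ p v)
      (Or.inl (.refl hZ.left.1)) (by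
      rintro u v - hu huv hv
      by_cases hvω : v ∈ ω₀
      · rcases hu with hu | hu
        · by_cases hvb : v ∈ box 0 (M - 1)
          · rcases hZ.hits u hu.right_mem (mem_box_succ_of_adj hvb huv.symm) with rfl | rfl
            · exact Or.inr (.single hpω huv hvω)
            · exact absurd hu hq
          · rcases hring v hvω hvb with rfl | rfl
            · exact Or.inl hZ.left
            · exact absurd (hu.tail huv hqt₀.1) hq
        · exact Or.inr (hu.tail huv hvω)
      · have hvZ : v ∈ Z := hv.resolve_right hvω
        rcases hu with hu | hu
        · exact Or.inl (hu.tail huv hvZ)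
        · by_cases hub : u ∈ box 0 (M - 1)
          · rcases hZ.hits v hvZ (mem_box_succ_of_adj hub huv) with rfl | rfl
            · exact absurd hpω hvω
            · exact absurd hqω hvω
          · rcases hring u hu.right_mem hub with rfl | rfl
            · exact Or.inl (hZ.left.tail huv hvZ)
            · exact absurd hu hnr)
    rcases this with h | h
    · exact hZ.sep t ht h
    · exact hT t ht (box_mono hMK (hpat.subset h.right_mem))
  · refine (hZ.left.mono fun v hv => Or.inl (Or.inl hv)).trans ((hr.mono ?_).trans
      (hqt₀.mono fun v hv => Or.inl (Or.inl hv)))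
    rintro v (hv | hv)
    exacts [Or.inl (Or.inr hv), Or.inr hv]

/-- A lattice symmetry `σ` fixing the origin, with inverse `τ`. -/
structure LatticeSym (σ τ : Site → Site) : Prop where
  left : ∀ v, τ (σ v) = v
  right : ∀ v, σ (τ v) = v
  adj : ∀ u v, adjZ2 (σ u) (σ v) ↔ adjZ2 u v
  box : ∀ v r, σ v ∈ box 0 r ↔ v ∈ box 0 r
  diag : ∀ v r, ((σ v).1 = r ∨ (σ v).1 = -r) ∧ ((σ v).2 = r ∨ (σ v).2 = -r) ↔
    (v.1 = r ∨ v.1 = -r) ∧ (v.2 = r ∨ v.2 = -r)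

theorem LatticeSym.symm {σ τ : Site → Site} (h : LatticeSym σ τ) : LatticeSym τ σ where
  left := h.right
  right := h.left
  adj u v := by rw [← h.adj, h.right, h.right]
  box v r := by rw [← h.box, h.right]
  diag v r := by rw [← h.diag, h.right]

/-- Rotation by a quarter turn. -/
def rot (v : Site) : Site := (-v.2, v.1)

/-- Inverse rotation by a quarter turn. -/
def rotInv (v : Site) : Site := (v.2, -v.1)

/-- Reflection in the first axis. -/
def refl (v : Site) : Site := (v.1, -v.2)

theorem latticeSym_rot : LatticeSym rot rotInv where
  left v := by simp [rot, rotInv]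
  right v := by simp [rot, rotInv]
  adj u v := by simp only [adjZ2_iff, rot]; omega
  box v r := by simp only [mem_box_zero, rot]; omega
  diag v r := by simp only [rot]; omega

theorem latticeSym_refl : LatticeSym refl refl where
  left v := by simp [refl]
  right v := by simp [refl]
  adj u v := by simp only [adjZ2_iff, refl]; omega
  box v r := by simp only [mem_box_zero, refl]; omega
  diag v r := by simp only [refl]; omega

theorem ReachIn.preimage {σ τ : Site → Site} (h : LatticeSym σ τ) {X : Set Site} {x y : Site}
    (hxy : ReachIn X x y) : ReachIn (σ ⁻¹' X) (τ x) (τ y) :=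
  hxy.map τ (fun _ _ => (h.symm.adj _ _).2) fun v hv => by
    rw [mem_preimage, h.right]; exact hv

theorem Apart.preimage {σ τ : Site → Site} (h : LatticeSym σ τ) {U V : Set Site}
    (hUV : Apart U V) : Apart (σ ⁻¹' U) (σ ⁻¹' V) := fun _ hu _ hv =>
  ⟨fun e => (hUV _ hu _ hv).1 (congrArg σ e), fun e => (hUV _ hu _ hv).2 ((h.adj _ _).2 e)⟩

theorem IsStrand.preimage {σ τ : Site → Site} (h : LatticeSym σ τ) {U : Set Site} {r r' : ℤ}
    {p p' : Site} (hU : IsStrand U r p r' p') : IsStrand (σ ⁻¹' U) r (τ p) r' (τ p') where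
  subset v hv := (h.box v r).1 (hU.subset hv)
  outer v hv hv' := by
    rw [← hU.outer _ hv (fun h' => hv' ((h.box _ _).1 h')), h.left]
  inner v hv hv' := by
    rw [← hU.inner _ hv ((h.box _ _).2 hv'), h.left]
  reach := hU.reach.preimage h

theorem Route.map {σ τ : Site → Site} (h : LatticeSym σ τ) {r r' : ℤ} {p q p' q' : Site}
    (hR : Route r p q r' p' q') : Route r (τ p) (τ q) r' (τ p') (τ q') := by
  obtain ⟨U, V, hU, hV, hUV⟩ := hR
  exact ⟨_, _, hU.preimage h, hV.preimage h, hUV.preimage h⟩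

theorem reachIn_hseg {X : Set Site} {y : ℤ} (a b : ℤ)
    (h : ∀ t, (a ≤ t ∧ t ≤ b) ∨ (b ≤ t ∧ t ≤ a) → (t, y) ∈ X) : ReachIn X (a, y) (b, y) := by
  rcases le_total a b with hab | hab
  · exact reachIn_hline hab fun t h1 h2 => h t (Or.inl ⟨h1, h2⟩)
  · exact (reachIn_hline hab fun t h1 h2 => h t (Or.inr ⟨h1, h2⟩)).symm

theorem reachIn_vseg {X : Set Site} {x : ℤ} (a b : ℤ)
    (h : ∀ t, (a ≤ t ∧ t ≤ b) ∨ (b ≤ t ∧ t ≤ a) → (x, t) ∈ X) : ReachIn X (x, a) (x, b) := by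
  rcases le_total a b with hab | hab
  · exact reachIn_vline hab fun t h1 h2 => h t (Or.inl ⟨h1, h2⟩)
  · exact (reachIn_vline hab fun t h1 h2 => h t (Or.inr ⟨h1, h2⟩)).symm

/-- The four points of the coordinate axes at distance `N` from the origin. -/
def port (N : ℤ) : Fin 4 → Site := ![(N, 0), (0, N), (-N, 0), (0, -N)]

theorem rot_port (N : ℤ) (i : Fin 4) : rot (port N i) = port N (i + 1) := by
  fin_cases i <;> simp [rot, port]

theorem refl_port (N : ℤ) (i : Fin 4) : refl (port N i) = port N (-i) := by
  fin_cases i <;> simp [refl, port]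

theorem isStrand_straight_left {N : ℤ} (hN : 5 ≤ N) :
    IsStrand {v | v.2 = 0 ∧ -N ≤ v.1 ∧ v.1 ≤ -(N - 4)} N (-N, 0) (N - 4) (-(N - 4), 0) where
  subset v := by rintro ⟨h1, h2, h3⟩; rw [mem_box_zero]; omega
  outer v := by rintro ⟨h1, h2, h3⟩ hv; rw [mem_box_zero] at hv; ext <;> dsimp only <;> omega
  inner v := by rintro ⟨h1, h2, h3⟩ hv; rw [mem_box_zero] at hv; ext <;> dsimp only <;> omega
  reach := reachIn_hseg _ _ fun t ht => by rw [mem_ofPred_eq]; omega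

theorem isStrand_straight_down {N : ℤ} (hN : 5 ≤ N) :
    IsStrand {v | v.1 = 0 ∧ -N ≤ v.2 ∧ v.2 ≤ -(N - 4)} N (0, -N) (N - 4) (0, -(N - 4)) where
  subset v := by rintro ⟨h1, h2, h3⟩; rw [mem_box_zero]; omega
  outer v := by rintro ⟨h1, h2, h3⟩ hv; rw [mem_box_zero] at hv; ext <;> dsimp only <;> omega
  inner v := by rintro ⟨h1, h2, h3⟩ hv; rw [mem_box_zero] at hv; ext <;> dsimp only <;> omega
  reach := reachIn_vseg _ _ fun t ht => by rw [mem_ofPred_eq]; omega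

/-- The strand turning from the right port to the upper port. -/
def quarterTurn (N : ℤ) : Set Site :=
  {v | (v.2 = 0 ∧ N - 2 ≤ v.1 ∧ v.1 ≤ N) ∨ (v.1 = N - 2 ∧ 0 ≤ v.2 ∧ v.2 ≤ N - 2) ∨
    (v.2 = N - 2 ∧ 0 ≤ v.1 ∧ v.1 ≤ N - 2) ∨ (v.1 = 0 ∧ N - 4 ≤ v.2 ∧ v.2 ≤ N - 2)}

theorem isStrand_quarterTurn {N : ℤ} (hN : 5 ≤ N) :
    IsStrand (quarterTurn N) N (N, 0) (N - 4) (0, N - 4) where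
  subset v hv := by
    simp only [quarterTurn, mem_ofPred_eq] at hv; rw [mem_box_zero]; omega
  outer v hv hv' := by
    simp only [quarterTurn, mem_ofPred_eq] at hv; rw [mem_box_zero] at hv'
    ext <;> dsimp only <;> omega
  inner v hv hv' := by
    simp only [quarterTurn, mem_ofPred_eq] at hv; rw [mem_box_zero] at hv'
    ext <;> dsimp only <;> omega
  reach := by
    refine (reachIn_hseg N (N - 2) fun t ht => ?_).trans
      ((reachIn_vseg 0 (N - 2) fun t ht => ?_).trans
      ((reachIn_hseg (N - 2) 0 fun t ht => ?_).trans
      (reachIn_vseg (N - 2) (N - 4) fun t ht => ?_))) <;>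
    rw [quarterTurn, mem_ofPred_eq] <;> omega

theorem route_straight_zero_two {N : ℤ} (hN : 5 ≤ N) :
    Route N (port N 0) (port N 2) (N - 4) (port (N - 4) 0) (port (N - 4) 2) := by
  have h := (isStrand_straight_left hN).preimage
    latticeSym_rot
  have h' := h.preimage latticeSym_rot
  refine ⟨_, _, by simpa [port, rotInv] using h', isStrand_straight_left hN, ?_⟩
  rintro u ⟨h1, h2, h3⟩ v ⟨h4, h5, h6⟩
  simp only [rot] at h1 h2 h3
  rw [adjZ2_iff, ne_eq, Prod.ext_iff]; omega

theorem route_quarterTurn_two {N : ℤ} (hN : 5 ≤ N) :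
    Route N (port N 0) (port N 2) (N - 4) (port (N - 4) 1) (port (N - 4) 2) := by
  refine ⟨_, _, isStrand_quarterTurn hN, isStrand_straight_left hN, ?_⟩
  rintro u hu v ⟨h4, h5, h6⟩
  simp only [quarterTurn, mem_ofPred_eq] at hu
  rw [adjZ2_iff, ne_eq, Prod.ext_iff]; omega

theorem route_quarterTurn_three {N : ℤ} (hN : 5 ≤ N) :
    Route N (port N 0) (port N 3) (N - 4) (port (N - 4) 1) (port (N - 4) 3) := by
  refine ⟨_, _, isStrand_quarterTurn hN, isStrand_straight_down hN, ?_⟩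
  rintro u hu v ⟨h4, h5, h6⟩
  simp only [quarterTurn, mem_ofPred_eq] at hu
  rw [adjZ2_iff, ne_eq, Prod.ext_iff]; omega

theorem Route.rot_port {N N' : ℤ} {i j i' j' : Fin 4}
    (h : Route N (port N i) (port N j) N' (port N' i') (port N' j')) :
    Route N (port N (i + 1)) (port N (j + 1)) N' (port N' (i' + 1)) (port N' (j' + 1)) := by
  simpa only [PercEnh.rot_port] using h.map latticeSym_rot.symm

theorem Route.refl_port {N N' : ℤ} {i j i' j' : Fin 4}
    (h : Route N (port N i) (port N j) N' (port N' i') (port N' j')) :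
    Route N (port N (-i)) (port N (-j)) N' (port N' (-i')) (port N' (-j')) := by
  simpa only [PercEnh.refl_port] using h.map latticeSym_refl

theorem Route.rot_port_add {N N' : ℤ} {i j i' j' : Fin 4}
    (h : Route N (port N i) (port N j) N' (port N' i') (port N' j')) (k : Fin 4) :
    Route N (port N (i + k)) (port N (j + k)) N' (port N' (i' + k)) (port N' (j' + k)) := by
  have h1 := h.rot_port
  have h2 := h1.rot_port
  have h3 := h2.rot_port
  simp only [add_assoc] at h2 h3
  fin_cases k
  exacts [by simpa using h, h1, h2, h3]

/-- One strand turns by a quarter turn, the other one goes straight ahead. -/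
theorem route_turn {N : ℤ} (hN : 5 ≤ N) (i j : Fin 4) (hij : i ≠ j) (hij' : i + 1 ≠ j) :
    Route N (port N i) (port N j) (N - 4) (port (N - 4) (i + 1)) (port (N - 4) j) := by
  have : j = 2 + i ∨ j = 3 + i := by revert i j; decide
  have h2 := (route_quarterTurn_two hN).rot_port_add i
  have h3 := (route_quarterTurn_three hN).rot_port_add i
  rcases this with rfl | rfl
  · simpa [add_comm] using h2
  · simpa [add_comm] using h3

theorem route_turn' {N : ℤ} (hN : 5 ≤ N) (i j : Fin 4) (hij : i ≠ j) (hij' : i - 1 ≠ j) :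
    Route N (port N i) (port N j) (N - 4) (port (N - 4) (i - 1)) (port (N - 4) j) := by
  have h := (route_turn hN (-i) (-j) (by simpa using hij)
    (by revert i j; decide)).refl_port
  rw [neg_neg, neg_neg, show -(-i + 1) = i - 1 from (by decide : ∀ i : Fin 4, -(-i + 1) = i - 1) i] at h
  exact h

section

variable {o : Site} {T X : Set Site} {K : ℤ}

/-- State `Good` at two ports, in some order. -/
def PortsAt (o : Site) (T X : Set Site) (K N : ℤ) (i j : Fin 4) : Prop :=
  GoodAt o T X K N (port N i) (port N j) ∨ GoodAt o T X K N (port N j) (port N i)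

theorem PortsAt.swap {N : ℤ} {i j : Fin 4} (h : PortsAt o T X K N i j) :
    PortsAt o T X K N j i := Or.symm h

theorem PortsAt.route {N N' : ℤ} {i j i' j' : Fin 4} (h : PortsAt o T X K N i j) (hNK : N ≤ K)
    (hT : ∀ t ∈ T, t ∉ box 0 K) (hN' : N' ≤ N)
    (hR : Route N (port N i) (port N j) N' (port N' i') (port N' j')) :
    PortsAt o T X K N' i' j' :=
  h.imp (fun h => h.route hNK hN' hT hR) (fun h => h.route hNK hN' hT hR.swap)

theorem PortsAt.turn {N : ℤ} (hN : 5 ≤ N) (hNK : N ≤ K) (hT : ∀ t ∈ T, t ∉ box 0 K)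
    {i j : Fin 4} (h : PortsAt o T X K N i j) (i' : Fin 4)
    (hij : i ≠ j ∧ i' ≠ j ∧ (i' = i + 1 ∨ i' = i - 1)) : PortsAt o T X K (N - 4) i' j := by
  obtain ⟨h1, h2, rfl | rfl⟩ := hij
  · exact h.route hNK hT (by omega) (route_turn hN i j h1 h2)
  · exact h.route hNK hT (by omega) (route_turn' hN i j h1 h2)

theorem PortsAt.to_opposite {N : ℤ} (hN : 9 ≤ N) (hNK : N ≤ K) (hT : ∀ t ∈ T, t ∉ box 0 K)
    {i j : Fin 4} (hij : i ≠ j) (h : PortsAt o T X K N i j) : PortsAt o T X K (N - 8) 0 2 := by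
  have turn := fun {i j : Fin 4} (h : PortsAt o T X K N i j) =>
    h.turn (by omega) hNK hT
  have turn2 := fun {i j : Fin 4} (h : PortsAt o T X K (N - 4) i j) =>
    h.turn (by omega) (by omega) hT
  have straight2 : PortsAt o T X K (N - 4) 0 2 → PortsAt o T X K (N - 4 - 4) 0 2 := fun h =>
    h.route (by omega) hT (by omega) (route_straight_zero_two (by omega))
  rw [show N - 8 = N - 4 - 4 by ring]
  have h02 : PortsAt o T X K N 0 2 → PortsAt o T X K (N - 4 - 4) 0 2 := fun h => by
    refine straight2 (h.route (by omega) hT (by omega) (route_straight_zero_two (by omega)))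
  have h01 : PortsAt o T X K N 0 1 → PortsAt o T X K (N - 4 - 4) 0 2 := fun h =>
    straight2 (turn h.swap 2 (by decide)).swap
  have h03 : PortsAt o T X K N 0 3 → PortsAt o T X K (N - 4 - 4) 0 2 := fun h =>
    straight2 (turn h.swap 2 (by decide)).swap
  have h12 : PortsAt o T X K N 1 2 → PortsAt o T X K (N - 4 - 4) 0 2 := fun h =>
    straight2 (turn h 0 (by decide))
  have h32 : PortsAt o T X K N 3 2 → PortsAt o T X K (N - 4 - 4) 0 2 := fun h =>
    straight2 (turn h 0 (by decide))
  have h13 : PortsAt o T X K N 1 3 → PortsAt o T X K (N - 4 - 4) 0 2 := fun h =>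
    (turn2 (turn h 0 (by decide)).swap 2 (by decide)).swap
  fin_cases i <;> fin_cases j <;> first
    | exact absurd rfl hij
    | exact h02 h | exact h01 h | exact h03 h | exact h12 h | exact h32 h | exact h13 h
    | exact h02 h.swap | exact h01 h.swap | exact h03 h.swap | exact h12 h.swap
    | exact h32 h.swap | exact h13 h.swap

theorem PortsAt.of_opposite {N : ℤ} (hN : 9 ≤ N) (hNK : N ≤ K) (hT : ∀ t ∈ T, t ∉ box 0 K)
    {i j : Fin 4} (hij : i ≠ j) (h : PortsAt o T X K N 0 2) : PortsAt o T X K (N - 8) i j := by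
  have turn := fun {i j : Fin 4} (h : PortsAt o T X K N i j) =>
    h.turn (by omega) hNK hT
  have turn2 := fun {i j : Fin 4} (h : PortsAt o T X K (N - 4) i j) =>
    h.turn (by omega) (by omega) hT
  have straight : PortsAt o T X K (N - 4) 0 2 :=
    h.route (by omega) hT (by omega) (route_straight_zero_two (by omega))
  rw [show N - 8 = N - 4 - 4 by ring]
  have h02 : PortsAt o T X K (N - 4 - 4) 0 2 :=
    straight.route (by omega) hT (by omega) (route_straight_zero_two (by omega))
  have h01 : PortsAt o T X K (N - 4 - 4) 0 1 := (turn2 straight.swap 1 (by decide)).swap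
  have h03 : PortsAt o T X K (N - 4 - 4) 0 3 := (turn2 straight.swap 3 (by decide)).swap
  have h12 : PortsAt o T X K (N - 4 - 4) 1 2 := turn2 straight 1 (by decide)
  have h32 : PortsAt o T X K (N - 4 - 4) 3 2 := turn2 straight 3 (by decide)
  have h13 : PortsAt o T X K (N - 4 - 4) 1 3 :=
    (turn2 (turn h 1 (by decide)).swap 3 (by decide)).swap
  fin_cases i <;> fin_cases j <;> first
    | exact absurd rfl hij
    | exact h02 | exact h01 | exact h03 | exact h12 | exact h32 | exact h13
    | exact h02.swap | exact h01.swap | exact h03.swap | exact h12.swap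
    | exact h32.swap | exact h13.swap

/-- The strands may be led to any two ports. -/
theorem PortsAt.change {N : ℤ} (hN : 17 ≤ N) (hNK : N ≤ K) (hT : ∀ t ∈ T, t ∉ box 0 K)
    {i j i' j' : Fin 4} (hij : i ≠ j) (hij' : i' ≠ j') (h : PortsAt o T X K N i j) :
    PortsAt o T X K (N - 16) i' j' := by
  have := (h.to_opposite (by omega) hNK hT hij).of_opposite (by omega) (by omega) hT hij'
  rwa [show N - 8 - 8 = N - 16 by ring] at this

end

/-! #### From the ports to the boundary sites of a pattern -/

theorem route_inner_right_right {M N u v : ℤ} (hM : 1 ≤ M) (hN : M + 2 ≤ N) (hu : u ≤ M)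
    (hv : -M ≤ v) (huv : v + 2 ≤ u) :
    Route N (port N 1) (port N 3) M (M, u) (M, v) := by
  refine ⟨{w : Site | (w.2 = u ∧ M ≤ w.1 ∧ w.1 ≤ M + 1) ∨ (w.1 = M + 1 ∧ u ≤ w.2 ∧ w.2 ≤ M + 1) ∨
      (w.2 = M + 1 ∧ 0 ≤ w.1 ∧ w.1 ≤ M + 1) ∨ (w.1 = 0 ∧ M + 1 ≤ w.2 ∧ w.2 ≤ N)},
    {w : Site | (w.2 = v ∧ M ≤ w.1 ∧ w.1 ≤ M + 1) ∨ (w.1 = M + 1 ∧ -(M + 1) ≤ w.2 ∧ w.2 ≤ v) ∨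
      (w.2 = -(M + 1) ∧ 0 ≤ w.1 ∧ w.1 ≤ M + 1) ∨ (w.1 = 0 ∧ -N ≤ w.2 ∧ w.2 ≤ -(M + 1))},
    ⟨?_, ?_, ?_, ?_⟩, ⟨?_, ?_, ?_, ?_⟩, ?_⟩
  · intro w hw; simp only [mem_ofPred_eq] at hw; rw [mem_box_zero]; omega
  · intro w hw hw'; simp only [mem_ofPred_eq] at hw; rw [mem_box_zero] at hw'
    ext <;> simp [port] <;> omega
  · intro w hw hw'; simp only [mem_ofPred_eq] at hw; rw [mem_box_zero] at hw'
    ext <;> dsimp only <;> omega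
  · refine (reachIn_vseg N (M + 1) fun t ht => ?_).trans
      ((reachIn_hseg 0 (M + 1) fun t ht => ?_).trans
      ((reachIn_vseg (M + 1) u fun t ht => ?_).trans
      (reachIn_hseg (M + 1) M fun t ht => ?_))) <;>
    rw [mem_ofPred_eq] <;> omega
  · intro w hw; simp only [mem_ofPred_eq] at hw; rw [mem_box_zero]; omega
  · intro w hw hw'; simp only [mem_ofPred_eq] at hw; rw [mem_box_zero] at hw'
    ext <;> simp [port] <;> omega
  · intro w hw hw'; simp only [mem_ofPred_eq] at hw; rw [mem_box_zero] at hw'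
    ext <;> dsimp only <;> omega
  · refine (reachIn_vseg (-N) (-(M + 1)) fun t ht => ?_).trans
      ((reachIn_hseg 0 (M + 1) fun t ht => ?_).trans
      ((reachIn_vseg (-(M + 1)) v fun t ht => ?_).trans
      (reachIn_hseg (M + 1) M fun t ht => ?_))) <;>
    rw [mem_ofPred_eq] <;> omega
  · intro x hx y hy
    simp only [mem_ofPred_eq] at hx hy
    rw [adjZ2_iff, ne_eq, Prod.ext_iff]; omega

/-- The strand leading from the right port to a site on the right side of a box. -/
def sideStrand (M N y : ℤ) : Set Site :=
  {w | (w.2 = y ∧ M ≤ w.1 ∧ w.1 ≤ M + 1) ∨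
    (w.1 = M + 1 ∧ ((y ≤ w.2 ∧ w.2 ≤ 0) ∨ (0 ≤ w.2 ∧ w.2 ≤ y))) ∨
    (w.2 = 0 ∧ M + 1 ≤ w.1 ∧ w.1 ≤ N)}

theorem isStrand_sideStrand {M N y : ℤ} (hN : M + 2 ≤ N) (hy : -M ≤ y ∧ y ≤ M) :
    IsStrand (sideStrand M N y) N (N, 0) M (M, y) where
  subset w hw := by simp only [sideStrand, mem_ofPred_eq] at hw; rw [mem_box_zero]; omega
  outer w hw hw' := by
    simp only [sideStrand, mem_ofPred_eq] at hw; rw [mem_box_zero] at hw'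
    ext <;> dsimp only <;> omega
  inner w hw hw' := by
    simp only [sideStrand, mem_ofPred_eq] at hw; rw [mem_box_zero] at hw'
    ext <;> dsimp only <;> omega
  reach := by
    refine (reachIn_hseg N (M + 1) fun t ht => ?_).trans
      ((reachIn_vseg 0 y fun t ht => ?_).trans (reachIn_hseg (M + 1) M fun t ht => ?_)) <;>
    rw [sideStrand, mem_ofPred_eq] <;> omega

theorem route_inner_right_top {M N x y : ℤ} (hM : 1 ≤ M) (hN : M + 2 ≤ N)
    (hx : -M ≤ x ∧ x < M) (hy : -M ≤ y ∧ y < M) :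
    Route N (port N 0) (port N 1) M (M, y) (x, M) := by
  have h := ((isStrand_sideStrand hN (show -M ≤ -x ∧ -x ≤ M by omega)).preimage
    latticeSym_rot.symm)
  refine ⟨_, _, isStrand_sideStrand hN ⟨hy.1, hy.2.le⟩, by simpa [port, rot] using h, ?_⟩
  intro u hu v hv
  simp only [sideStrand, rotInv, mem_preimage, mem_ofPred_eq] at hu hv
  rw [adjZ2_iff, ne_eq, Prod.ext_iff]; omega

theorem route_inner_right_left {M N y y' : ℤ} (hM : 1 ≤ M) (hN : M + 2 ≤ N)
    (hy : -M ≤ y ∧ y ≤ M) (hy' : -M ≤ y' ∧ y' ≤ M) :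
    Route N (port N 0) (port N 2) M (M, y) (-M, y') := by
  have h := ((isStrand_sideStrand hN (show -M ≤ -y' ∧ -y' ≤ M by omega)).preimage
    latticeSym_rot.symm).preimage latticeSym_rot.symm
  refine ⟨_, _, isStrand_sideStrand hN hy, by simpa [port, rot] using h, ?_⟩
  intro u hu v hv
  simp only [sideStrand, rotInv, mem_preimage, mem_ofPred_eq] at hu hv
  rw [adjZ2_iff, ne_eq, Prod.ext_iff]; omega

/-- Existence of a route from some two ports. -/
def PortRoute (M N : ℤ) (c d : Site) : Prop :=
  ∃ i j, i ≠ j ∧ Route N (port N i) (port N j) M c d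

theorem PortRoute.swap {M N : ℤ} {c d : Site} (h : PortRoute M N c d) : PortRoute M N d c := by
  obtain ⟨i, j, hij, h⟩ := h
  exact ⟨j, i, hij.symm, h.swap⟩

theorem PortRoute.of_rot {M N : ℤ} {c d : Site} (h : PortRoute M N (rot c) (rot d)) :
    PortRoute M N c d := by
  obtain ⟨i, j, hij, h⟩ := h
  have h1 := (h.map latticeSym_rot)
  have key : ∀ i : Fin 4, rotInv (port N i) = port N (i - 1) := by
    intro i; rw [← latticeSym_rot.left (port N (i - 1)), rot_port]; simp
  rw [key, key, latticeSym_rot.left, latticeSym_rot.left] at h1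
  exact ⟨_, _, by simpa using hij, h1⟩

theorem PortRoute.of_refl {M N : ℤ} {c d : Site} (h : PortRoute M N (refl c) (refl d)) :
    PortRoute M N c d := by
  obtain ⟨i, j, hij, h⟩ := h
  have h1 := (h.map latticeSym_refl)
  rw [refl_port, refl_port, latticeSym_refl.left, latticeSym_refl.left] at h1
  exact ⟨_, _, by simpa using hij, h1⟩

theorem ring_induction_right {M : ℤ} {P : Site → Site → Prop}
    (swap : ∀ c d, P c d → P d c) (of_rot : ∀ c d, P (rot c) (rot d) → P c d)
    (of_refl : ∀ c d, P (refl c) (refl d) → P c d)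
    (right_right : ∀ u v, -M ≤ v → v + 2 ≤ u → u ≤ M → P (M, u) (M, v))
    (right_top : ∀ x y, -M ≤ x → x < M → -M ≤ y → y < M → P (M, y) (x, M))
    (right_left : ∀ y y', -M ≤ y → y ≤ M → -M ≤ y' → y' ≤ M → P (M, y) (-M, y')) {c d : Site}
    (hc : c ∈ box 0 M) (hd : d ∈ box 0 M) (hd' : d ∉ box 0 (M - 1)) (hcd : c ≠ d)
    (hcd' : ¬ adjZ2 c d) (h : c.1 = M) : P c d := by
  have common : ∀ c d : Site, c ∈ box 0 M → d ∈ box 0 M → c ≠ d → ¬ adjZ2 c d → c.1 = M →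
      d.1 = M → P c d := by
    rintro ⟨c1, c2⟩ ⟨d1, d2⟩ hc hd hcd hcd' h h'
    simp only [mem_box_zero, adjZ2_iff, ne_eq, Prod.ext_iff] at *
    subst h h'
    rcases le_total c2 d2 with hle | hle
    · exact swap _ _ (right_right _ _ (by omega) (by omega) (by omega))
    · exact right_right _ _ (by omega) (by omega) (by omega)
  have top : ∀ c d : Site, c ∈ box 0 M → d ∈ box 0 M → c ≠ d → ¬ adjZ2 c d → c.1 = M →
      d.1 ≠ M → d.2 = M → P c d := by
    intro c d hc hd hcd hcd' h h' h''
    by_cases hct : c.2 = M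
    · refine of_rot _ _ (of_rot _ _ (of_rot _ _ (common _ _ ?_ ?_ ?_ ?_ ?_ ?_)))
      · simpa only [latticeSym_rot.box] using hc
      · simpa only [latticeSym_rot.box] using hd
      · intro e
        have := congrArg rotInv (congrArg rotInv (congrArg rotInv e))
        simp only [latticeSym_rot.left] at this
        exact hcd this
      · simpa only [latticeSym_rot.adj] using hcd'
      · simp only [rot]; omega
      · simp only [rot]; omega
    · obtain ⟨c1, c2⟩ := c
      obtain ⟨d1, d2⟩ := d
      simp only [mem_box_zero] at *
      subst h h''
      exact right_top _ _ (by omega) (by omega) (by omega) (by omega)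
  have h4 : d.1 = M ∨ (d.1 ≠ M ∧ d.2 = M) ∨ (d.1 ≠ M ∧ d.2 = -M) ∨ d.1 = -M := by
    rw [mem_box_zero] at hd hd'; omega
  rcases h4 with h4 | ⟨h4, h5⟩ | ⟨h4, h5⟩ | h4
  · exact common c d hc hd hcd hcd' h h4
  · exact top c d hc hd hcd hcd' h h4 h5
  · refine of_refl _ _ (top _ _ ((latticeSym_refl.box _ _).2 hc)
      ((latticeSym_refl.box _ _).2 hd) (fun e => hcd ?_)
      (fun e => hcd' ((latticeSym_refl.adj _ _).1 e)) h h4 ?_)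
    · rw [← latticeSym_refl.left c, e, latticeSym_refl.left]
    · simp only [refl]; omega
  · obtain ⟨c1, c2⟩ := c
    obtain ⟨d1, d2⟩ := d
    simp only [mem_box_zero] at *
    subst h h4
    exact right_left _ _ (by omega) (by omega) (by omega) (by omega)

/-- To prove a symmetric statement about two distinct, nonadjacent sites on the boundary of a box,
it suffices to consider three relative positions. -/
theorem ring_induction {M : ℤ} {P : Site → Site → Prop}
    (swap : ∀ c d, P c d → P d c) (of_rot : ∀ c d, P (rot c) (rot d) → P c d)
    (of_refl : ∀ c d, P (refl c) (refl d) → P c d)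
    (right_right : ∀ u v, -M ≤ v → v + 2 ≤ u → u ≤ M → P (M, u) (M, v))
    (right_top : ∀ x y, -M ≤ x → x < M → -M ≤ y → y < M → P (M, y) (x, M))
    (right_left : ∀ y y', -M ≤ y → y ≤ M → -M ≤ y' → y' ≤ M → P (M, y) (-M, y')) {c d : Site}
    (hc : c ∈ box 0 M) (hc' : c ∉ box 0 (M - 1)) (hd : d ∈ box 0 M) (hd' : d ∉ box 0 (M - 1))
    (hcd : c ≠ d) (hcd' : ¬ adjZ2 c d) : P c d := by
  have rotate : ∀ {k : Site → Prop}, (∀ c d : Site, c ∈ box 0 M → d ∈ box 0 M →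
      d ∉ box 0 (M - 1) → c ≠ d → ¬ adjZ2 c d → k c → P c d) →
      ∀ c d : Site, c ∈ box 0 M → d ∈ box 0 M →
      d ∉ box 0 (M - 1) → c ≠ d → ¬ adjZ2 c d → k (rot c) → P c d := by
    intro k hk c d hc hd hd' hcd hcd' h
    refine of_rot _ _ (hk _ _ ((latticeSym_rot.box _ _).2 hc)
      ((latticeSym_rot.box _ _).2 hd) (fun e => hd' ((latticeSym_rot.box _ _).1 e)) (fun e => hcd ?_)
      (fun e => hcd' ((latticeSym_rot.adj _ _).1 e)) h)
    rw [← latticeSym_rot.left c, e, latticeSym_rot.left]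
  have h0 : ∀ c d : Site, c ∈ box 0 M → d ∈ box 0 M →
      d ∉ box 0 (M - 1) → c ≠ d → ¬ adjZ2 c d → c.1 = M → P c d :=
    fun c d => ring_induction_right swap of_rot of_refl right_right right_top right_left
  have h1 := rotate h0
  have h2 := rotate h1
  have h3 := rotate h2
  have h4 : c.1 = M ∨ -c.2 = M ∨ -c.1 = M ∨ c.2 = M := by
    rw [mem_box_zero] at hc hc'; omega
  rcases h4 with h | h | h | h
  · exact h0 c d hc hd hd' hcd hcd' h
  · exact h1 c d hc hd hd' hcd hcd' h
  · exact h2 c d hc hd hd' hcd hcd' h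
  · exact h3 c d hc hd hd' hcd hcd' (by simpa [rot] using h)

theorem exists_portRoute {M N : ℤ} (hM : 1 ≤ M) (hN : M + 2 ≤ N) {c d : Site}
    (hc : c ∈ box 0 M) (hc' : c ∉ box 0 (M - 1)) (hd : d ∈ box 0 M) (hd' : d ∉ box 0 (M - 1))
    (hcd : c ≠ d) (hcd' : ¬ adjZ2 c d) : PortRoute M N c d :=
  ring_induction (P := PortRoute M N) (fun _ _ => .swap) (fun _ _ => .of_rot) (fun _ _ => .of_refl)
    (fun _ _ h1 h2 h3 => ⟨1, 3, by decide, route_inner_right_right hM hN h3 h1 h2⟩)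
    (fun _ _ h1 h2 h3 h4 => ⟨0, 1, by decide, route_inner_right_top hM hN ⟨h1, h2⟩ ⟨h3, h4⟩⟩)
    (fun _ _ h1 h2 h3 h4 => ⟨0, 2, by decide, route_inner_right_left hM hN ⟨h1, h2⟩ ⟨h3, h4⟩⟩)
    hc hc' hd hd' hcd hcd'

/-! #### From the boundary of a box with rounded corners to the ports -/

/-- `U` contains a path leading from `p` to `p'` and meets the box of radius `r'` only in `p'`. -/
structure IsLead (U : Set Site) (r : ℤ) (p : Site) (r' : ℤ) (p' : Site) : Prop where
  subset : U ⊆ box 0 r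
  inner : ∀ v ∈ U, v ∈ box 0 r' → v = p'
  reach : ReachIn U p p'

theorem IsLead.preimage {σ τ : Site → Site} (h : LatticeSym σ τ) {U : Set Site} {r r' : ℤ}
    {p p' : Site} (hU : IsLead U r p r' p') : IsLead (σ ⁻¹' U) r (τ p) r' (τ p') where
  subset v hv := (h.box v r).1 (hU.subset hv)
  inner v hv hv' := by
    rw [← hU.inner _ hv ((h.box _ _).2 hv'), h.left]
  reach := hU.reach.preimage h

/-- Existence of two separated leads from `c` and `d` to two ports. -/
def LeadPair (r N : ℤ) (c d : Site) : Prop :=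
  ∃ U V i j, i ≠ j ∧ IsLead U r c N (port N i) ∧ IsLead V r d N (port N j) ∧ Apart U V

theorem LeadPair.swap {r N : ℤ} {c d : Site} (h : LeadPair r N c d) : LeadPair r N d c := by
  obtain ⟨U, V, i, j, hij, hU, hV, hUV⟩ := h
  exact ⟨V, U, j, i, hij.symm, hV, hU, hUV.symm⟩

theorem LeadPair.of_rot {r N : ℤ} {c d : Site} (h : LeadPair r N (rot c) (rot d)) :
    LeadPair r N c d := by
  obtain ⟨U, V, i, j, hij, hU, hV, hUV⟩ := h
  have hU' := hU.preimage latticeSym_rot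
  have hV' := hV.preimage latticeSym_rot
  have key : ∀ i : Fin 4, rotInv (port N i) = port N (i - 1) := by
    intro i; rw [← latticeSym_rot.left (port N (i - 1)), rot_port]; simp
  rw [key, latticeSym_rot.left] at hU' hV'
  exact ⟨_, _, _, _, by simpa using hij, hU', hV', hUV.preimage latticeSym_rot⟩

theorem LeadPair.of_refl {r N : ℤ} {c d : Site} (h : LeadPair r N (refl c) (refl d)) :
    LeadPair r N c d := by
  obtain ⟨U, V, i, j, hij, hU, hV, hUV⟩ := h
  have hU' := hU.preimage latticeSym_refl
  have hV' := hV.preimage latticeSym_refl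
  rw [refl_port, latticeSym_refl.left] at hU' hV'
  exact ⟨_, _, _, _, by simpa using hij, hU', hV', hUV.preimage latticeSym_refl⟩

theorem leadPair_right_right {r N u v : ℤ} (hN : 1 ≤ N) (hr : N + 2 ≤ r) (hv : -r ≤ v)
    (huv : v + 2 ≤ u) (hu : u ≤ r) : LeadPair r N (r, u) (r, v) := by
  refine ⟨{w : Site | (w.1 = r ∧ u ≤ w.2 ∧ w.2 ≤ r) ∨ (w.2 = r ∧ 0 ≤ w.1 ∧ w.1 ≤ r) ∨
    (w.1 = 0 ∧ N ≤ w.2 ∧ w.2 ≤ r)}, {w : Site | (w.1 = r ∧ -r ≤ w.2 ∧ w.2 ≤ v) ∨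
    (w.2 = -r ∧ 0 ≤ w.1 ∧ w.1 ≤ r) ∨ (w.1 = 0 ∧ -r ≤ w.2 ∧ w.2 ≤ -N)}, 1, 3, by decide,
    ⟨?_, ?_, ?_⟩, ⟨?_, ?_, ?_⟩, ?_⟩
  · intro w hw; simp only [mem_ofPred_eq] at hw; rw [mem_box_zero]; omega
  · intro w hw hw'; simp only [mem_ofPred_eq] at hw; rw [mem_box_zero] at hw'
    ext <;> simp [port] <;> omega
  · refine (reachIn_vseg u r fun t ht => ?_).trans ((reachIn_hseg r 0 fun t ht => ?_).trans
      (reachIn_vseg r N fun t ht => ?_)) <;>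
    rw [mem_ofPred_eq] <;> omega
  · intro w hw; simp only [mem_ofPred_eq] at hw; rw [mem_box_zero]; omega
  · intro w hw hw'; simp only [mem_ofPred_eq] at hw; rw [mem_box_zero] at hw'
    ext <;> simp [port] <;> omega
  · refine (reachIn_vseg v (-r) fun t ht => ?_).trans ((reachIn_hseg r 0 fun t ht => ?_).trans
      (reachIn_vseg (-r) (-N) fun t ht => ?_)) <;>
    rw [mem_ofPred_eq] <;> omega
  · intro x hx y hy
    simp only [mem_ofPred_eq] at hx hy
    rw [adjZ2_iff, ne_eq, Prod.ext_iff]; omega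

/-- The lead from a site on the right side of a box to the right port. -/
def sideLead (r N y : ℤ) : Set Site :=
  {w | (w.1 = r ∧ ((y ≤ w.2 ∧ w.2 ≤ 0) ∨ (0 ≤ w.2 ∧ w.2 ≤ y))) ∨
    (w.2 = 0 ∧ N ≤ w.1 ∧ w.1 ≤ r)}

theorem isLead_sideLead {r N y : ℤ} (hN : 1 ≤ N) (hr : N + 2 ≤ r) (hy : -r ≤ y) (hy' : y ≤ r) :
    IsLead (sideLead r N y) r (r, y) N (N, 0) where
  subset w hw := by simp only [sideLead, mem_ofPred_eq] at hw; rw [mem_box_zero]; omega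
  inner w hw hw' := by
    simp only [sideLead, mem_ofPred_eq] at hw; rw [mem_box_zero] at hw'
    ext <;> dsimp only <;> omega
  reach := by
    refine (reachIn_vseg y 0 fun t ht => ?_).trans (reachIn_hseg r N fun t ht => ?_) <;>
    rw [sideLead, mem_ofPred_eq] <;> omega

theorem leadPair_right_top {r N x y : ℤ} (hN : 1 ≤ N) (hr : N + 2 ≤ r) (hx : -r ≤ x) (hx' : x < r)
    (hy : -r ≤ y) (hy' : y < r) : LeadPair r N (r, y) (x, r) := by
  have h := ((isLead_sideLead hN hr (show -r ≤ -x by omega) (by omega)).preimage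
    latticeSym_rot.symm)
  refine ⟨_, _, 0, 1, by decide, isLead_sideLead hN hr hy hy'.le, by simpa [port, rot] using h, ?_⟩
  intro u hu v hv
  simp only [sideLead, rotInv, mem_preimage, mem_ofPred_eq] at hu hv
  rw [adjZ2_iff, ne_eq, Prod.ext_iff]; omega

theorem leadPair_right_left {r N y y' : ℤ} (hN : 1 ≤ N) (hr : N + 2 ≤ r) (hy : -r ≤ y)
    (hy₁ : y ≤ r) (hy' : -r ≤ y') (hy'₁ : y' ≤ r) : LeadPair r N (r, y) (-r, y') := by
  have h := ((isLead_sideLead hN hr (show -r ≤ -y' by omega) (by omega)).preimage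
    latticeSym_rot.symm).preimage latticeSym_rot.symm
  refine ⟨_, _, 0, 2, by decide, isLead_sideLead hN hr hy hy₁, by simpa [port, rot] using h, ?_⟩
  intro u hu v hv
  simp only [sideLead, rotInv, mem_preimage, mem_ofPred_eq] at hu hv
  rw [adjZ2_iff, ne_eq, Prod.ext_iff]; omega

theorem exists_leadPair {r N : ℤ} (hN : 1 ≤ N) (hr : N + 2 ≤ r) {c d : Site}
    (hc : c ∈ box 0 r) (hc' : c ∉ box 0 (r - 1)) (hd : d ∈ box 0 r) (hd' : d ∉ box 0 (r - 1))
    (hcd : c ≠ d) (hcd' : ¬ adjZ2 c d) : LeadPair r N c d :=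
  ring_induction (P := LeadPair r N) (fun _ _ => .swap) (fun _ _ => .of_rot) (fun _ _ => .of_refl)
    (fun _ _ => leadPair_right_right hN hr) (fun _ _ => leadPair_right_top hN hr)
    (fun _ _ => leadPair_right_left hN hr) hc hc' hd hd' hcd hcd'

/-- The box of radius `r` without its corners. -/
def roundBox (r : ℤ) : Set Site :=
  {v | v ∈ box 0 r ∧ ¬ ((v.1 = r ∨ v.1 = -r) ∧ (v.2 = r ∨ v.2 = -r))}

theorem LatticeSym.roundBox {σ τ : Site → Site} (h : LatticeSym σ τ) (v : Site) (r : ℤ) :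
    σ v ∈ roundBox r ↔ v ∈ roundBox r := by
  simp only [PercEnh.roundBox, mem_ofPred_eq, h.box, h.diag]

theorem mem_roundBox {v : Site} {r : ℤ} : v ∈ roundBox r ↔
    (-r ≤ v.1 ∧ v.1 ≤ r ∧ -r ≤ v.2 ∧ v.2 ≤ r) ∧
      ¬ ((v.1 = r ∨ v.1 = -r) ∧ (v.2 = r ∨ v.2 = -r)) := by
  rw [roundBox, mem_ofPred_eq, mem_box_zero]

/-- `U` leads from a boundary site `p` of the rounded box of radius `r` to the boundary site `p'`
of the box of radius `r - 1`, avoiding the neighbourhood of `B`. -/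
structure IsEntry (r : ℤ) (B U : Set Site) (p p' : Site) : Prop where
  subset : U ⊆ roundBox r
  mem : p' ∈ box 0 (r - 1)
  not_mem : p' ∉ box 0 (r - 1 - 1)
  inner : ∀ v ∈ U, v ∈ box 0 (r - 1) → v = p'
  thin : ∀ u ∈ U, u ∉ box 0 (r - 1) → ∀ w ∈ box 0 (r - 1), adjZ2 u w → w = p' ∨ adjZ2 w p'
  reach : ReachIn U p p'
  apart : Apart U B

theorem IsEntry.preimage {σ τ : Site → Site} (h : LatticeSym σ τ) {r : ℤ} {B U : Set Site}
    {p p' : Site} (hU : IsEntry r B U p p') :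
    IsEntry r (σ ⁻¹' B) (σ ⁻¹' U) (τ p) (τ p') where
  subset v hv := (h.roundBox v r).1 (hU.subset hv)
  mem := (h.symm.box _ _).2 hU.mem
  not_mem := fun h' => hU.not_mem ((h.symm.box _ _).1 h')
  inner v hv hv' := by rw [← hU.inner _ hv ((h.box _ _).2 hv'), h.left]
  thin u hu hu' w hw huw := by
    rcases hU.thin _ hu (fun h' => hu' ((h.box _ _).1 h')) _ ((h.box _ _).2 hw)
      ((h.adj _ _).2 huw) with h1 | h1
    · left; rw [← h1, h.left]
    · right; rwa [← h.adj, h.right]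
  reach := hU.reach.preimage h
  apart := hU.apart.preimage h

/-- `A` and `B` are separated sets outside of the rounded box, reaching its sites `a` and `b`. -/
structure EntrySites (r : ℤ) (A B : Set Site) (a b : Site) : Prop where
  left_out : ∀ v ∈ A, v ∉ roundBox r
  right_out : ∀ v ∈ B, v ∉ roundBox r
  apart : Apart A B
  left_mem : a ∈ roundBox r
  right_mem : b ∈ roundBox r
  left_adj : ∃ v ∈ A, adjZ2 a v
  right_adj : ∃ v ∈ B, adjZ2 b v
  left_not_adj : ∀ v ∈ B, ¬ adjZ2 a v
  right_not_adj : ∀ v ∈ A, ¬ adjZ2 b v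

theorem EntrySites.swap {r : ℤ} {A B : Set Site} {a b : Site} (h : EntrySites r A B a b) :
    EntrySites r B A b a :=
  ⟨h.2, h.1, h.3.symm, h.5, h.4, h.7, h.6, h.9, h.8⟩

theorem EntrySites.preimage {σ τ : Site → Site} (h : LatticeSym σ τ) {r : ℤ} {A B : Set Site}
    {a b : Site} (hab : EntrySites r A B a b) :
    EntrySites r (σ ⁻¹' A) (σ ⁻¹' B) (τ a) (τ b) where
  left_out v hv hv' := hab.left_out _ hv ((h.roundBox _ _).2 hv')
  right_out v hv hv' := hab.right_out _ hv ((h.roundBox _ _).2 hv')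
  apart := hab.apart.preimage h
  left_mem := (h.symm.roundBox _ _).2 hab.left_mem
  right_mem := (h.symm.roundBox _ _).2 hab.right_mem
  left_adj := by
    obtain ⟨v, hv, hv'⟩ := hab.left_adj
    exact ⟨τ v, by rwa [mem_preimage, h.right], (h.symm.adj _ _).2 hv'⟩
  right_adj := by
    obtain ⟨v, hv, hv'⟩ := hab.right_adj
    exact ⟨τ v, by rwa [mem_preimage, h.right], (h.symm.adj _ _).2 hv'⟩
  left_not_adj v hv hv' := hab.left_not_adj _ hv (by rwa [← h.symm.adj, h.left])
  right_not_adj v hv hv' := hab.right_not_adj _ hv (by rwa [← h.symm.adj, h.left])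

/-- Existence of two separated entries. -/
def EntryPair (r : ℤ) (A B : Set Site) (a b : Site) : Prop :=
  ∃ U V a' b', IsEntry r B U a a' ∧ IsEntry r A V b b' ∧ Apart U V

theorem EntryPair.swap {r : ℤ} {A B : Set Site} {a b : Site} (h : EntryPair r A B a b) :
    EntryPair r B A b a := by
  obtain ⟨U, V, a', b', hU, hV, hUV⟩ := h
  exact ⟨V, U, b', a', hV, hU, hUV.symm⟩

theorem EntryPair.preimage {σ τ : Site → Site} (h : LatticeSym σ τ) {r : ℤ} {A B : Set Site}
    {a b : Site} (hab : EntryPair r A B a b) :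
    EntryPair r (σ ⁻¹' A) (σ ⁻¹' B) (τ a) (τ b) := by
  obtain ⟨U, V, a', b', hU, hV, hUV⟩ := hab
  exact ⟨_, _, _, _, hU.preimage h, hV.preimage h, hUV.preimage h⟩

theorem isEntry_straight {r y : ℤ} (hr : 5 ≤ r) (hy : -r < y) (hy' : y < r) {B : Set Site}
    (hB : ∀ v ∈ B, v ∉ roundBox r) (hB' : ∀ v ∈ B, ¬ adjZ2 (r, y) v) :
    IsEntry r B {w : Site | w.2 = y ∧ r - 1 ≤ w.1 ∧ w.1 ≤ r} (r, y) (r - 1, y) where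
  subset w := by rintro ⟨h1, h2, h3⟩; rw [mem_roundBox]; omega
  mem := by rw [mem_box_zero]; dsimp only; omega
  not_mem := by rw [mem_box_zero]; dsimp only; omega
  inner w := by rintro ⟨h1, h2, h3⟩ hw; rw [mem_box_zero] at hw; ext <;> dsimp only <;> omega
  thin u := by
    rintro ⟨h1, h2, h3⟩ hu w hw; rw [mem_box_zero] at hu hw
    simp only [adjZ2_iff, Prod.ext_iff]; omega
  reach := reachIn_hseg _ _ fun t ht => by rw [mem_ofPred_eq]; omega
  apart u hu v hv := by
    obtain ⟨h1, h2, h3⟩ := hu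
    have h4 := hB v hv
    have h5 := hB' v hv
    rw [mem_roundBox] at h4; rw [adjZ2_iff] at h5 ⊢; rw [ne_eq, Prod.ext_iff]
    dsimp only at h5; omega

/-- Near a corner, an entry may be shifted by one unit unless it comes from the corner site. -/
theorem exists_isEntry_corner {r y : ℤ} (hr : 5 ≤ r) (hy : r - 2 ≤ y) {A B : Set Site} {b : Site}
    (h : EntrySites r A B (r, y) b) :
    ∃ U a', IsEntry r B U (r, y) a' ∧ ((y = r - 1 ∧ (r, r) ∈ A ∧
      U ⊆ {w : Site | w.2 = y ∧ r - 1 ≤ w.1 ∧ w.1 ≤ r}) ∨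
      U ⊆ {w : Site | (w.1 = r ∧ w.2 = y) ∨ (w.1 = r ∧ w.2 = y - 1) ∨
        (w.1 = r - 1 ∧ w.2 = y - 1)}) := by
  have hy' := h.left_mem
  rw [mem_roundBox] at hy'; dsimp only at hy'
  by_cases hc : y = r - 1 ∧ (r, r) ∈ A
  · exact ⟨_, _, isEntry_straight hr (by omega) (by omega) h.right_out h.left_not_adj,
      Or.inl ⟨hc.1, hc.2, Subset.rfl⟩⟩
  · obtain ⟨v, hv, hav⟩ := h.left_adj
    have hv' := h.left_out v hv
    have hvr : v = (r + 1, y) := by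
      by_cases hvc : v = (r, r)
      · rw [hvc] at hv hav
        rw [adjZ2_iff] at hav; dsimp only at hav
        exact absurd ⟨by omega, hv⟩ hc
      rw [adjZ2_iff] at hav; rw [mem_roundBox] at hv'; rw [Prod.ext_iff] at hvc ⊢
      dsimp only at *; omega
    rw [hvr] at hv
    refine ⟨_, (r - 1, y - 1), ⟨?_, ?_, ?_, ?_, ?_, ?_, ?_⟩, Or.inr Subset.rfl⟩
    · intro w hw; simp only [mem_ofPred_eq] at hw; rw [mem_roundBox]; omega
    · rw [mem_box_zero]; dsimp only; omega
    · rw [mem_box_zero]; dsimp only; omega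
    · intro w hw hw'; simp only [mem_ofPred_eq] at hw; rw [mem_box_zero] at hw'
      ext <;> dsimp only <;> omega
    · intro u hu hu' w hw; simp only [mem_ofPred_eq] at hu; rw [mem_box_zero] at hu' hw
      simp only [adjZ2_iff, Prod.ext_iff]; omega
    · refine (reachIn_vseg y (y - 1) fun t ht => ?_).trans
        (reachIn_hseg r (r - 1) fun t ht => ?_) <;> rw [mem_ofPred_eq] <;> omega
    · intro u hu w hw
      simp only [mem_ofPred_eq] at hu
      have h4 := h.right_out w hw
      have h5 := h.left_not_adj w hw
      have h6 := (h.apart _ hv w hw).2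
      rw [mem_roundBox] at h4; rw [adjZ2_iff] at h5 h6 ⊢; rw [ne_eq, Prod.ext_iff]
      dsimp only at h5 h6; omega

/-- Reflection in the diagonal. -/
theorem latticeSym_swap : LatticeSym Prod.swap Prod.swap where
  left v := by simp
  right v := by simp
  adj u v := by simp only [adjZ2_iff, Prod.fst_swap, Prod.snd_swap]; omega
  box v r := by simp only [mem_box_zero, Prod.fst_swap, Prod.snd_swap]; omega
  diag v r := by simp only [Prod.fst_swap, Prod.snd_swap]; omega

theorem entryPair_right_top {r x y : ℤ} (hr : 5 ≤ r) {A B : Set Site}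
    (h : EntrySites r A B (r, y) (x, r)) : EntryPair r A B (r, y) (x, r) := by
  have hx := h.right_mem
  have hy := h.left_mem
  rw [mem_roundBox] at hx hy; dsimp only at hx hy
  have h' : EntrySites r (Prod.swap ⁻¹' B) (Prod.swap ⁻¹' A) (r, x) (y, r) :=
    h.swap.preimage latticeSym_swap
  have hpre : ∀ X : Set Site, Prod.swap ⁻¹' (Prod.swap ⁻¹' X) = X := fun X => by
    ext v; simp
  by_cases hxy : x + y < 2 * r - 3
  · have hU := isEntry_straight hr (by omega) (by omega) h.right_out h.left_not_adj
    have hV := (isEntry_straight hr (by omega) (by omega) h'.right_out h'.left_not_adj).preimage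
      latticeSym_swap
    rw [hpre] at hV
    refine ⟨_, _, _, _, hU, hV, ?_⟩
    rintro u ⟨h1, h2, h3⟩ v ⟨h4, h5, h6⟩
    simp only [Prod.fst_swap, Prod.snd_swap] at h4 h5 h6
    rw [adjZ2_iff, ne_eq, Prod.ext_iff]; omega
  · obtain ⟨U, a', hU, hUs⟩ := exists_isEntry_corner hr (by omega) h
    obtain ⟨V, b', hV, hVs⟩ := exists_isEntry_corner hr (by omega) h'
    have hV' := hV.preimage latticeSym_swap
    rw [hpre] at hV'
    refine ⟨_, _, _, _, hU, hV', ?_⟩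
    intro u hu v hv
    rw [mem_preimage] at hv
    rw [adjZ2_iff, ne_eq, Prod.ext_iff]
    rcases hUs with ⟨h1, h2, h3⟩ | h3 <;> rcases hVs with ⟨h4, h5, h6⟩ | h6 <;>
      replace h3 := h3 hu <;> replace h6 := h6 hv <;>
      simp only [mem_ofPred_eq, Prod.fst_swap, Prod.snd_swap] at h3 h6
    · exact absurd rfl (h.apart _ h2 _ h5).1
    · have h7 := h.right_not_adj _ h2
      rw [adjZ2_iff] at h7; dsimp only at h7
      omega
    · have h7 := h.left_not_adj (r, r) h5
      rw [adjZ2_iff] at h7; dsimp only at h7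
      omega
    · omega

theorem exists_entryPair {r : ℤ} (hr : 5 ≤ r) {A B : Set Site} {a b : Site}
    (h : EntrySites r A B a b) (ha : a ∉ box 0 (r - 1)) (hb : b ∉ box 0 (r - 1)) (hab : a ≠ b)
    (hab' : ¬ adjZ2 a b) : EntryPair r A B a b := by
  have hpre : ∀ {σ τ : Site → Site}, LatticeSym σ τ → ∀ X, σ ⁻¹' (τ ⁻¹' X) = X := by
    intro σ τ hs X; ext v; simp [hs.left]
  have hsym : ∀ {σ τ : Site → Site}, LatticeSym σ τ → ∀ c d,
      (∀ A B, EntrySites r A B (σ c) (σ d) → EntryPair r A B (σ c) (σ d)) →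
      ∀ A B, EntrySites r A B c d → EntryPair r A B c d := by
    intro σ τ hs c d hP A B h
    have := (hP _ _ (h.preimage hs.symm)).preimage hs
    simpa only [hpre hs, hs.left] using this
  refine ring_induction (P := fun a b => ∀ A B, EntrySites r A B a b → EntryPair r A B a b)
    (fun c d h A B h' => (h B A h'.swap).swap) (hsym latticeSym_rot) (hsym latticeSym_refl)
    ?_ ?_ ?_ h.left_mem.1 ha h.right_mem.1 hb hab hab' A B h
  · intro u v hv huv hu A B h
    have hx := h.right_mem
    have hy := h.left_mem
    rw [mem_roundBox] at hx hy; dsimp only at hx hy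
    refine ⟨_, _, _, _, isEntry_straight hr (by omega) (by omega) h.right_out h.left_not_adj,
      isEntry_straight hr (by omega) (by omega) h.left_out h.right_not_adj, ?_⟩
    rintro u ⟨h1, h2, h3⟩ v ⟨h4, h5, h6⟩
    rw [adjZ2_iff, ne_eq, Prod.ext_iff]; omega
  · intro x y _ _ _ _ A B h
    exact entryPair_right_top hr h
  · intro y y' _ _ _ _ A B h
    have hx := h.right_mem
    have hy := h.left_mem
    rw [mem_roundBox] at hx hy; dsimp only at hx hy
    have hs := latticeSym_rot
    have h' := ((h.preimage hs).preimage hs).swap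
    have hV := ((isEntry_straight (y := -y') hr (by omega) (by omega) h'.right_out (by
      simpa [rotInv] using h'.left_not_adj)).preimage hs.symm).preimage hs.symm
    simp only [hpre hs.symm] at hV
    refine ⟨_, _, _, _, isEntry_straight hr (by omega) (by omega) h.right_out h.left_not_adj,
      by simpa [rot] using hV, ?_⟩
    rintro u ⟨h1, h2, h3⟩ v ⟨h4, h5, h6⟩
    simp only [rotInv] at h4 h5 h6
    rw [adjZ2_iff, ne_eq, Prod.ext_iff]; omega

/-! #### Surgery at the origin -/

theorem ReachIn.or_adj_of_insert {X : Set Site} {x y z : Site} (h : ReachIn (X ∪ {z}) x y)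
    (hx : x ≠ z) : ReachIn X x y ∨ ∃ u, ReachIn X x u ∧ adjZ2 u z := by
  have hxX : x ∈ X := h.1.resolve_right hx
  refine h.induct (P := fun y => ReachIn X x y ∨ ∃ u, ReachIn X x u ∧ adjZ2 u z)
    (Or.inl (.refl hxX)) ?_
  rintro u v - (hu | hu) huv hv
  · rcases hv with hv | rfl
    · exact Or.inl (hu.tail huv hv)
    · exact Or.inr ⟨u, hu, huv⟩
  · exact Or.inr hu

theorem not_mem_box_of_adj_roundBox {r : ℤ} {u v : Site} (hu : u ∉ roundBox r)
    (huv : adjZ2 u v) : v ∉ box 0 (r - 1) := by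
  rw [mem_roundBox] at hu; rw [adjZ2_iff] at huv; rw [mem_box_zero]; omega

/-- The full leads from the boundary of the rounded box to the ports. -/
theorem EntryPair.exists_leads {r N : ℤ} (hN : 1 ≤ N) (hr : N + 3 ≤ r) {A B : Set Site}
    {a b : Site} (hA : ∀ v ∈ A, v ∉ roundBox r) (hB : ∀ v ∈ B, v ∉ roundBox r)
    (h : EntryPair r A B a b) :
    ∃ U V i j, i ≠ j ∧ U ⊆ roundBox r ∧ V ⊆ roundBox r ∧ Apart U V ∧ Apart U B ∧ Apart V A ∧
      ReachIn U a (port N i) ∧ ReachIn V b (port N j) ∧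
      (∀ v ∈ U, v ∈ box 0 N → v = port N i) ∧ (∀ v ∈ V, v ∈ box 0 N → v = port N j) := by
  obtain ⟨U₀, V₀, a', b', hU₀, hV₀, hUV₀⟩ := h
  have hab' := hUV₀ a' hU₀.reach.right_mem b' hV₀.reach.right_mem
  obtain ⟨U₁, V₁, i, j, hij, hU₁, hV₁, hUV₁⟩ := exists_leadPair hN (by omega) hU₀.mem hU₀.not_mem
    hV₀.mem hV₀.not_mem hab'.1 hab'.2
  have hsub : box 0 (r - 1) ⊆ roundBox r := fun v hv => by
    rw [mem_box_zero] at hv; rw [mem_roundBox]; omega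
  have cross : ∀ {B U₀ U₁ V₁ a b a' p q}, IsEntry r B U₀ a a' → IsLead U₁ (r - 1) a' N p →
      IsLead V₁ (r - 1) b N q → Apart U₁ V₁ → Apart U₀ V₁ := by
    intro B U₀ U₁ V₁ a b a' p q hU₀ hU₁ hV₁ h u hu v hv
    by_cases hub : u ∈ box 0 (r - 1)
    · rw [hU₀.inner u hu hub]
      exact h _ hU₁.reach.1 v hv
    · refine ⟨fun e => hub (e ▸ hV₁.subset hv), fun huv => ?_⟩
      have h1 := h _ hU₁.reach.1 v hv
      rcases hU₀.thin u hu hub v (hV₁.subset hv) huv with h2 | h2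
      · exact h1.1 h2.symm
      · exact h1.2 h2.symm
  have far : ∀ {U₁ B}, U₁ ⊆ box 0 (r - 1) → (∀ v ∈ B, v ∉ roundBox r) → Apart U₁ B :=
    fun hU hB u hu v hv => ⟨fun e => hB v hv (e ▸ hsub (hU hu)),
      fun huv => not_mem_box_of_adj_roundBox (hB v hv) huv.symm (hU hu)⟩
  refine ⟨U₀ ∪ U₁, V₀ ∪ V₁, i, j, hij, union_subset hU₀.subset (hU₁.subset.trans hsub),
    union_subset hV₀.subset (hV₁.subset.trans hsub), ?_, ?_, ?_,
    (hU₀.reach.mono subset_union_left).trans (hU₁.reach.mono subset_union_right),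
    (hV₀.reach.mono subset_union_left).trans (hV₁.reach.mono subset_union_right), ?_, ?_⟩
  · rintro u (hu | hu) v (hv | hv)
    · exact hUV₀ u hu v hv
    · exact cross hU₀ hU₁ hV₁ hUV₁ u hu v hv
    · exact (cross hV₀ hV₁ hU₁ hUV₁.symm).symm u hu v hv
    · exact hUV₁ u hu v hv
  · rintro u (hu | hu)
    exacts [hU₀.apart u hu, far hU₁.subset hB u hu]
  · rintro u (hu | hu)
    exacts [hV₀.apart u hu, far hV₁.subset hA u hu]
  · rintro v (hv | hv) hvN
    · have e := hU₀.inner v hv (box_mono (by omega) hvN)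
      rw [e] at hvN ⊢
      exact hU₁.inner _ hU₁.reach.1 hvN
    · exact hU₁.inner v hv hvN
  · rintro v (hv | hv) hvN
    · have e := hV₀.inner v hv (box_mono (by omega) hvN)
      rw [e] at hvN ⊢
      exact hV₁.inner _ hV₁.reach.1 hvN
    · exact hV₁.inner v hv hvN

theorem exists_goodAt {o : Site} {T X : Set Site} {r N : ℤ} (hN : 2 ≤ N) (hr : N + 3 ≤ r)
    (ho : o ∉ box 0 (r + 1)) (hT : ∀ t ∈ T, t ∉ box 0 (r + 1)) (h : ∀ t ∈ T, ¬ ReachIn X o t)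
    (h' : ∃ t ∈ T, ReachIn (X ∪ {0}) o t) :
    ∃ i j, i ≠ j ∧ GoodAt o T X (r + 1) N (port N i) (port N j) := by
  obtain ⟨t, ht, hot⟩ := h'
  have hz : (0 : Site) ∈ box 0 (r + 1) := by
    rw [mem_box_zero, Prod.fst_zero, Prod.snd_zero]; omega
  have hQ : roundBox r ⊆ box 0 (r + 1) := fun v hv => box_mono (by omega) hv.1
  have enter : ∀ {x u}, x ∉ box 0 (r + 1) → ReachIn X x u → adjZ2 u 0 →
      ∃ a₀ a, ReachIn (X \ roundBox r) x a₀ ∧ adjZ2 a₀ a ∧ ReachIn X x a ∧ a ∈ roundBox r := by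
    intro x u hx hu hu0
    have huQ : u ∈ roundBox r := by
      rw [adjZ2_iff, Prod.fst_zero, Prod.snd_zero] at hu0
      rw [mem_roundBox]; omega
    obtain ⟨a₀, a, h1, h2, h3, h4⟩ := hu.first_hit (roundBox r) (fun h => hx (hQ h)) huQ
    exact ⟨a₀, a, h1, h2, (h1.mono sdiff_subset).tail h2 h3, h4⟩
  obtain ⟨u, hu, hu0⟩ := (hot.or_adj_of_insert (fun e => ho (e ▸ hz))).resolve_left (h t ht)
  obtain ⟨w, hw, hw0⟩ := (hot.symm.or_adj_of_insert (fun e => hT t ht (e ▸ hz))).resolve_left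
    (fun e => h t ht e.symm)
  obtain ⟨a₀, a, ha₀, haa, ha, haQ⟩ := enter ho hu hu0
  obtain ⟨b₀, b, hb₀, hbb, hb, hbQ⟩ := enter (hT t ht) hw hw0
  set A : Set Site := {v | ReachIn X o v} with hA
  set B : Set Site := {v | ∃ t ∈ T, ReachIn X t v} with hB
  have hAB : Apart A B := by
    rintro x hx y ⟨t', ht', hy⟩
    refine ⟨?_, fun hxy => h t' ht' ((hx.tail hxy hy.right_mem).trans hy.symm)⟩
    rintro rfl
    exact h t' ht' (hx.trans hy.symm)
  have haA : a ∈ A := ha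
  have hbB : b ∈ B := ⟨t, ht, hb⟩
  have hes : EntrySites r (A \ roundBox r) (B \ roundBox r) a b :=
    { left_out := fun v hv => hv.2
      right_out := fun v hv => hv.2
      apart := fun x hx y hy => hAB x hx.1 y hy.1
      left_mem := haQ
      right_mem := hbQ
      left_adj := ⟨a₀, ⟨ha₀.mono sdiff_subset, ha₀.right_mem.2⟩, haa.symm⟩
      right_adj := ⟨b₀, ⟨⟨t, ht, hb₀.mono sdiff_subset⟩, hb₀.right_mem.2⟩, hbb.symm⟩
      left_not_adj := fun v hv => (hAB a haA v hv.1).2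
      right_not_adj := fun v hv => (hAB.symm b hbB v hv.1).2 }
  obtain ⟨U, V, i, j, hij, hUQ, hVQ, hUV, hUB, hVA, hUr, hVr, hUN, hVN⟩ :=
    (exists_entryPair (by omega) hes (not_mem_box_of_adj_roundBox ha₀.right_mem.2 haa)
      (not_mem_box_of_adj_roundBox hb₀.right_mem.2 hbb) (hAB a haA b hbB).1
      (hAB a haA b hbB).2).exists_leads (by omega) hr (fun v hv => hv.2) (fun v hv => hv.2)
  set Z : Set Site := {v | v ∈ U ∨ v ∈ V ∨
    (v ∉ roundBox r ∧ v ∈ X ∧ (v ∈ box 0 (r + 1) → v ∈ A ∪ B))} with hZ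
  have hUZ : U ⊆ Z := fun v hv => Or.inl hv
  have hVZ : V ⊆ Z := fun v hv => Or.inr (Or.inl hv)
  have lift : ∀ {x y}, (∀ v, ReachIn X x v → v ∈ A ∪ B) → ReachIn (X \ roundBox r) x y →
      ReachIn Z x y := by
    intro x y hx hxy
    have hmem : ∀ v, ReachIn (X \ roundBox r) x v → v ∈ Z := fun v hv =>
      Or.inr (Or.inr ⟨hv.right_mem.2, hv.right_mem.1, fun _ => hx v (hv.mono sdiff_subset)⟩)
    exact hxy.induct (P := fun y => ReachIn Z x y) (.refl (hmem x (.refl hxy.1)))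
      fun u v hu hPu huv hv => hPu.tail huv (hmem v (hu.tail huv hv))
  refine ⟨i, j, hij, Z, fun v hv => ?_, ⟨?_, ?_, ⟨t, ht, ?_⟩, fun t' ht' hot' => ?_⟩⟩
  · constructor
    · rintro (h1 | h1 | h1)
      exacts [absurd (hQ (hUQ h1)) hv, absurd (hQ (hVQ h1)) hv, h1.2.1]
    · exact fun h1 => Or.inr (Or.inr ⟨fun h2 => hv (hQ h2), h1, fun h2 => absurd h2 hv⟩)
  · rintro v (h1 | h1 | h1) hvN
    · exact Or.inl (hUN v h1 hvN)
    · exact Or.inr (hVN v h1 hvN)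
    · refine absurd ?_ h1.1
      rw [mem_box_zero] at hvN; rw [mem_roundBox]; omega
  · exact ((lift (fun v hv => Or.inl hv) ha₀).tail haa (hUZ hUr.1)).trans (hUr.mono hUZ)
  · exact (((lift (fun v hv => Or.inr ⟨t, ht, hv⟩) hb₀).tail hbb (hVZ hVr.1)).trans
      (hVr.mono hVZ)).symm
  · have hoQ : o ∉ roundBox r := fun h => ho (hQ h)
    have := hot'.induct (P := fun v => v ∈ U ∨ v ∈ A \ roundBox r)
      (Or.inr ⟨.refl ha.1, hoQ⟩) (by
      rintro x y - hx hxy (hy | hy | ⟨hy1, hy2, hy3⟩)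
      · exact Or.inl hy
      · rcases hx with hx | hx
        · exact absurd hxy (hUV x hx y hy).2
        · exact absurd hxy.symm (hVA y hy x hx).2
      · right
        rcases hx with hx | hx
        · have hyb : y ∈ box 0 (r + 1) := by
            have := (hUQ hx).1
            rw [mem_box_zero] at this ⊢; rw [adjZ2_iff] at hxy; omega
          rcases hy3 hyb with h1 | h1
          · exact ⟨h1, hy1⟩
          · exact absurd hxy (hUB x hx y ⟨h1, hy1⟩).2
        · exact ⟨hx.1.tail hxy hy2, hy1⟩)
    rcases this with h1 | h1
    · exact hT t' ht' (hQ (hUQ h1))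
    · exact h t' ht' h1.1

/-- If opening the origin joins `o` to `T`, then the configuration can be modified near the origin
so that the enhancement at the origin has this effect instead. -/
theorem Essential.exists_surgery_zero {R : ℤ} {φ : Config → Config} (hφ : BoxRange R φ)
    (hess : Essential adjZ2 φ) : ∃ K, R ≤ K ∧ ∀ (o : Site) (T X : Set Site), o ∉ box 0 K →
      (∀ t ∈ T, t ∉ box 0 K) → (∀ t ∈ T, ¬ ReachIn X o t) →
      (∃ t ∈ T, ReachIn (X ∪ {0}) o t) →
      ∃ X', (∀ v, v ∉ box 0 K → (v ∈ X' ↔ v ∈ X)) ∧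
        (∀ t ∈ T, ¬ ReachIn X' o t) ∧ ∃ t ∈ T, ReachIn (X' ∪ φ X') o t := by
  obtain ⟨M, ω₀, c, d, hM, hRM, hpat⟩ := hess.exists_pattern hφ 1
  refine ⟨M + 22, by omega, fun o T X ho hT h h' => ?_⟩
  obtain ⟨i, j, hij, hg⟩ := exists_goodAt (N := M + 18) (r := M + 21) (by omega) (by omega)
    (by rwa [show M + 21 + 1 = M + 22 by ring]) (by rwa [show M + 21 + 1 = M + 22 by ring]) h h'
  rw [show M + 21 + 1 = M + 22 by ring] at hg
  obtain ⟨i', j', hij', hR⟩ := exists_portRoute hM (le_refl (M + 2)) (hpat.subset hpat.left_mem)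
    hpat.left_ring (hpat.subset hpat.right_mem) hpat.right_ring hpat.ne hpat.not_adj
  have hp : PortsAt o T X (M + 22) (M + 18 - 16) i' j' :=
    PortsAt.change (by omega) (by omega) hT hij hij' (Or.inl hg)
  rw [show M + 18 - 16 = M + 2 by ring] at hp
  obtain ⟨X', h1, h2, h3, h4⟩ := GoodAt.insert_pattern hpat (by omega) hT
    (hp.imp (fun h => h.route (by omega) (by omega) hT hR)
      (fun h => h.route (by omega) (by omega) hT hR.swap))
  have hφX : φ X' = φ ω₀ := hφ.congr _ _ (by
    ext v
    refine and_congr_left fun hv => h2 v (box_mono (by omega) hv))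
  exact ⟨X', h1, h3, hφX ▸ h4⟩

/-- Local surgery around an arbitrary site. -/
theorem Essential.exists_surgery {R : ℤ} {φ : Config → Config} (hφ : BoxRange R φ)
    (hess : Essential adjZ2 φ) : ∃ K, R ≤ K ∧ ∀ (z o : Site) (T X : Set Site), o ∉ box z K →
      (∀ t ∈ T, t ∉ box z K) → (∀ t ∈ T, ¬ ReachIn X o t) →
      (∃ t ∈ T, ReachIn (X ∪ {z}) o t) →
      ∃ X', (∀ v, v ∉ box z K → (v ∈ X' ↔ v ∈ X)) ∧
        (∀ t ∈ T, ¬ ReachIn X' o t) ∧ ∃ t ∈ T, ReachIn (X' ∪ enhAt φ z X') o t := by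
  obtain ⟨K, hRK, hK⟩ := hess.exists_surgery_zero hφ
  refine ⟨K, hRK, fun z o T X ho hT h h' => ?_⟩
  have to0 : ∀ {Y Y' : Set Site} {x y : Site}, (∀ v ∈ Y, v - z ∈ Y') → ReachIn Y x y →
      ReachIn Y' (x - z) (y - z) := fun hY hxy => hxy.map (· - z) (fun _ _ => adjZ2_sub z) hY
  have of0 : ∀ {Y Y' : Set Site} {x y : Site}, (∀ v ∈ Y, v + z ∈ Y') → ReachIn Y (x - z) (y - z) →
      ReachIn Y' x y := fun hY hxy => by
    simpa using hxy.map (· + z) (fun _ _ => adjZ2_add_right.2) hY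
  obtain ⟨t, ht, hot⟩ := h'
  obtain ⟨X', h1, h2, t', ht', h3⟩ := hK (o - z) {v | v + z ∈ T} (shiftConfig z X)
    (by rwa [mem_box_sub])
    (fun t ht => by
      have := hT _ ht
      rwa [← mem_box_sub, add_sub_cancel_right] at this)
    (fun t ht hot => h _ ht (of0 (fun v hv => hv) (by rwa [add_sub_cancel_right])))
    ⟨t - z, by simpa using ht, to0 (by
      rintro v (hv | hv)
      · left; simpa [shiftConfig] using hv
      · right; simpa [sub_eq_zero] using hv) hot⟩
  have hX' : shiftConfig z {v | v - z ∈ X'} = X' := by ext v; simp [shiftConfig]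
  refine ⟨{v | v - z ∈ X'}, fun v hv => ?_, fun t ht hot => ?_, t' + z, ht', ?_⟩
  · rw [mem_ofPred_eq, h1 _ (by rwa [mem_box_sub])]; simp [shiftConfig]
  · exact h2 (t - z) (by simpa using ht) (to0 (fun v hv => hv) hot)
  · refine of0 ?_ (by rwa [add_sub_cancel_right])
    rintro v (hv | hv)
    · left; simpa using hv
    · right; rw [enhAt, hX']; exact ⟨v, hv, rfl⟩

/-! ### Finite product measures -/

section finiteProduct

variable {ι : Type*} [Fintype ι]

theorem weight_nonneg {w : ι → ℝ} (hw : ∀ i, w i ∈ Icc (0:ℝ) 1) (b : ι → Bool) :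
    0 ≤ ∏ i, if b i then w i else 1 - w i := by
  refine Finset.prod_nonneg fun i _ => ?_
  split_ifs
  · exact (hw i).1
  · linarith [(hw i).2]

variable [DecidableEq ι]

/-- The expectation of `f` under the product of the Bernoulli measures with parameters `w i`. -/
noncomputable def bernExp (w : ι → ℝ) (f : (ι → Bool) → ℝ) : ℝ :=
  ∑ b, (∏ i, if b i then w i else 1 - w i) * f b

/-- The probability of `E` under the product of the Bernoulli measures with parameters `w i`. -/
noncomputable def bernPr (w : ι → ℝ) (E : Set (ι → Bool)) : ℝ := bernExp w (E.indicator 1)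

theorem sum_bool_fun (i : ι) (f : (ι → Bool) → ℝ) :
    ∑ b, f b = ∑ b with b i = true, (f b + f (Function.update b i false)) := by
  rw [← Finset.sum_filter_add_sum_filter_not Finset.univ (fun b => b i = true) f,
    Finset.sum_add_distrib]
  congr 1
  refine (Finset.sum_bij' (fun b _ => Function.update b i false)
    (fun b _ => Function.update b i true) ?_ ?_ ?_ ?_ ?_).symm
  · intro b _; simp
  · intro b _; simp
  · intro b hb
    simp only [Finset.mem_filter] at hb
    simp [← hb.2]
  · intro b hb
    simp only [Finset.mem_filter, Bool.not_eq_true] at hb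
    simp [← hb.2]
  · intro b _; rfl

theorem prod_weight_eq (w : ι → ℝ) (b : ι → Bool) (i : ι) :
    (∏ j, if b j then w j else 1 - w j) =
      (if b i then w i else 1 - w i) * ∏ j ∈ Finset.univ.erase i, if b j then w j else 1 - w j :=
  (Finset.mul_prod_erase _ _ (Finset.mem_univ i)).symm

theorem prod_erase_update (w : ι → ℝ) (b : ι → Bool) (i : ι) (v : Bool) :
    (∏ j ∈ Finset.univ.erase i, if Function.update b i v j then w j else 1 - w j) =
      ∏ j ∈ Finset.univ.erase i, if b j then w j else 1 - w j := by
  refine Finset.prod_congr rfl fun j hj => ?_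
  rw [Function.update_of_ne (Finset.ne_of_mem_erase hj)]

/-- The expectation after integrating out a coordinate. -/
theorem bernExp_update (w : ι → ℝ) (f : (ι → Bool) → ℝ) (i : ι) (v : Bool) :
    bernExp w (fun b => f (Function.update b i v)) =
      ∑ b with b i = true, (∏ j ∈ Finset.univ.erase i, if b j then w j else 1 - w j) *
        f (Function.update b i v) := by
  rw [bernExp, sum_bool_fun i]
  refine Finset.sum_congr rfl fun b hb => ?_
  simp only [Finset.mem_filter] at hb
  rw [prod_weight_eq w b i, prod_weight_eq w _ i, prod_erase_update, hb.2, Function.update_idem]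
  simp; ring

theorem bernExp_eq (w : ι → ℝ) (f : (ι → Bool) → ℝ) (i : ι) :
    bernExp w f = w i * bernExp w (fun b => f (Function.update b i true)) +
      (1 - w i) * bernExp w (fun b => f (Function.update b i false)) := by
  rw [bernExp_update, bernExp_update, bernExp, sum_bool_fun i, Finset.mul_sum, Finset.mul_sum,
    ← Finset.sum_add_distrib]
  refine Finset.sum_congr rfl fun b hb => ?_
  simp only [Finset.mem_filter] at hb
  rw [prod_weight_eq w b i, prod_weight_eq w _ i, prod_erase_update, hb.2]
  have : Function.update b i true = b := by rw [← hb.2]; exact Function.update_eq_self i b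
  rw [this]
  simp; ring

theorem bernExp_update_congr (w : ι → ℝ) (f : (ι → Bool) → ℝ) (i : ι) (v : Bool) (x : ℝ) :
    bernExp (Function.update w i x) (fun b => f (Function.update b i v)) =
      bernExp w (fun b => f (Function.update b i v)) := by
  rw [bernExp_update, bernExp_update]
  refine Finset.sum_congr rfl fun b _ => ?_
  congr 1
  refine Finset.prod_congr rfl fun j hj => ?_
  rw [Function.update_of_ne (Finset.ne_of_mem_erase hj)]

theorem bernExp_mono {w : ι → ℝ} (hw : ∀ i, w i ∈ Icc (0:ℝ) 1) {f g : (ι → Bool) → ℝ}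
    (h : ∀ b, f b ≤ g b) : bernExp w f ≤ bernExp w g :=
  Finset.sum_le_sum fun b _ => mul_le_mul_of_nonneg_left (h b) (weight_nonneg hw b)

theorem bernExp_nonneg {w : ι → ℝ} (hw : ∀ i, w i ∈ Icc (0:ℝ) 1) {f : (ι → Bool) → ℝ}
    (h : ∀ b, 0 ≤ f b) : 0 ≤ bernExp w f :=
  Finset.sum_nonneg fun b _ => mul_nonneg (weight_nonneg hw b) (h b)

theorem bernExp_sub (w : ι → ℝ) (f g : (ι → Bool) → ℝ) :
    bernExp w (fun b => f b - g b) = bernExp w f - bernExp w g := by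
  simp only [bernExp, mul_sub, Finset.sum_sub_distrib]

theorem bernExp_sum (w : ι → ℝ) {κ : Type*} (S : Finset κ) (f : κ → (ι → Bool) → ℝ) :
    bernExp w (fun b => ∑ k ∈ S, f k b) = ∑ k ∈ S, bernExp w (f k) := by
  simp only [bernExp, Finset.mul_sum]
  exact Finset.sum_comm

/-- Changing the parameters in the direction of monotonicity of `f` increases the expectation. -/
theorem bernExp_le_bernExp {w w' : ι → ℝ} (hw : ∀ i, w i ∈ Icc (0:ℝ) 1)
    (hw' : ∀ i, w' i ∈ Icc (0:ℝ) 1) {f : (ι → Bool) → ℝ}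
    (h : ∀ i b, 0 ≤ (w' i - w i) * (f (Function.update b i true) - f (Function.update b i false))) :
    bernExp w f ≤ bernExp w' f := by
  have key : ∀ S : Finset ι, bernExp w f ≤ bernExp (S.piecewise w' w) f := by
    intro S
    induction S using Finset.induction_on with
    | empty => simp
    | insert i S hi ih =>
      refine ih.trans ?_
      have hp : ∀ j, S.piecewise w' w j ∈ Icc (0:ℝ) 1 := by
        intro j
        by_cases hj : j ∈ S
        · simpa [hj] using hw' j
        · simpa [hj] using hw j
      rw [Finset.piecewise_insert, bernExp_eq _ f i, bernExp_eq (Function.update _ _ _) f i,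
        bernExp_update_congr, bernExp_update_congr, Function.update_self,
        Finset.piecewise_eq_of_notMem _ _ _ hi]
      have h1 : 0 ≤ (w' i - w i) * (bernExp (S.piecewise w' w) (fun b => f (Function.update b i true))
          - bernExp (S.piecewise w' w) (fun b => f (Function.update b i false))) := by
        rw [← bernExp_sub, bernExp, Finset.mul_sum]
        refine Finset.sum_nonneg fun b _ => ?_
        rw [mul_left_comm]
        exact mul_nonneg (weight_nonneg hp b) (h i b)
      linarith
  simpa using key Finset.univ

/-- Forcing the coordinates in `S` to be open costs at most the product of their weights. -/
theorem prod_mul_bernExp_le {w : ι → ℝ} (hw : ∀ i, w i ∈ Icc (0:ℝ) 1) {f : (ι → Bool) → ℝ}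
    (hf : ∀ b, 0 ≤ f b) (S : Finset ι) :
    (∏ i ∈ S, w i) * bernExp (S.piecewise 1 w) f ≤ bernExp w f := by
  induction S using Finset.induction_on with
  | empty => simp
  | insert i S hi ih =>
    refine le_trans ?_ ih
    have hp : ∀ j, S.piecewise (1 : ι → ℝ) w j ∈ Icc (0:ℝ) 1 := by
      intro j
      by_cases hj : j ∈ S
      · simp [hj]
      · simpa [hj] using hw j
    rw [Finset.prod_insert hi, mul_comm (w i), mul_assoc]
    refine mul_le_mul_of_nonneg_left ?_ (Finset.prod_nonneg fun j _ => (hw j).1)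
    rw [Finset.piecewise_insert, bernExp_eq (Function.update _ _ _) f i, bernExp_eq _ f i,
        bernExp_update_congr, bernExp_update_congr, Function.update_self,
        Finset.piecewise_eq_of_notMem _ _ _ hi]
    have := mul_nonneg (sub_nonneg.2 (hw i).2)
      (bernExp_nonneg hp (f := fun b => f (Function.update b i false)) fun b => hf _)
    simp only [Pi.one_apply, sub_self, zero_mul, add_zero, one_mul]
    linarith

theorem bernPr_mono {w : ι → ℝ} (hw : ∀ i, w i ∈ Icc (0:ℝ) 1) {E E' : Set (ι → Bool)}
    (h : E ⊆ E') : bernPr w E ≤ bernPr w E' :=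
  bernExp_mono hw fun b => indicator_le_indicator_of_subset h (fun _ => zero_le_one) b

theorem bernPr_nonneg {w : ι → ℝ} (hw : ∀ i, w i ∈ Icc (0:ℝ) 1) (E : Set (ι → Bool)) :
    0 ≤ bernPr w E :=
  bernExp_nonneg hw fun b => indicator_nonneg (fun _ _ => zero_le_one) b

theorem bernPr_biUnion_le {w : ι → ℝ} (hw : ∀ i, w i ∈ Icc (0:ℝ) 1) {κ : Type*} (S : Finset κ)
    (E : κ → Set (ι → Bool)) : bernPr w (⋃ k ∈ S, E k) ≤ ∑ k ∈ S, bernPr w (E k) := by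
  simp only [bernPr]
  rw [← bernExp_sum]
  refine bernExp_mono hw fun b => ?_
  by_cases hb : b ∈ ⋃ k ∈ S, E k
  · rw [indicator_of_mem hb]
    simp only [mem_iUnion] at hb
    obtain ⟨k, hk, hb⟩ := hb
    have := Finset.single_le_sum (f := fun k => (E k).indicator (1 : (ι → Bool) → ℝ) b)
      (fun k _ => indicator_nonneg (fun _ _ => zero_le_one) b) hk
    rwa [indicator_of_mem hb] at this
  · rw [indicator_of_notMem hb]
    exact Finset.sum_nonneg fun k _ => indicator_nonneg (fun _ _ => zero_le_one) b

/-- Resampling the coordinates in `D`. -/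
theorem pow_mul_bernPr_le {w : ι → ℝ} {δ : ℝ} (hδ : 0 ≤ δ) (hw : ∀ i, w i ∈ Icc (0:ℝ) 1)
    (D : Finset ι) (hD : ∀ i ∈ D, w i ∈ Icc δ (1 - δ)) (E : Set (ι → Bool)) :
    δ ^ D.card * bernPr w {b | ∃ b' ∈ E, ∀ i ∉ D, b i = b' i} ≤ bernPr w E := by
  induction D using Finset.induction_on with
  | empty =>
    have : {b | ∃ b' ∈ E, ∀ i ∉ (∅ : Finset ι), b i = b' i} = E := by
      ext b
      constructor
      · rintro ⟨b', hb', h⟩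
        rwa [show b = b' from funext fun i => h i (by simp)]
      · intro hb; exact ⟨b, hb, fun _ _ => rfl⟩
    rw [this]; simp
  | insert i D hi ih =>
    refine le_trans ?_ (ih fun j hj => hD j (Finset.mem_insert_of_mem hj))
    rw [Finset.card_insert_of_notMem hi, pow_succ, mul_assoc]
    refine mul_le_mul_of_nonneg_left ?_ (pow_nonneg hδ _)
    obtain ⟨G, hG⟩ : ∃ G : Set (ι → Bool), G = {b | ∃ b' ∈ E, ∀ i ∉ D, b i = b' i} := ⟨_, rfl⟩
    have hnn : ∀ v : Bool, 0 ≤ bernExp w fun b =>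
        G.indicator (1 : (ι → Bool) → ℝ) (Function.update b i v) :=
      fun v => bernExp_nonneg hw fun b => indicator_nonneg (fun _ _ => zero_le_one) _
    have h1 : bernPr w {b | ∃ b' ∈ E, ∀ j ∉ insert i D, b j = b' j} ≤
        bernExp w (fun b => G.indicator 1 (Function.update b i true)) +
          bernExp w (fun b => G.indicator 1 (Function.update b i false)) := by
      have h2 : bernPr w {b | ∃ b' ∈ E, ∀ j ∉ insert i D, b j = b' j} ≤
          bernExp w (fun b => ∑ v : Bool, G.indicator 1 (Function.update b i v)) := by
        refine bernExp_mono hw fun b => ?_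
        by_cases hb : b ∈ {b | ∃ b' ∈ E, ∀ j ∉ insert i D, b j = b' j}
        · rw [indicator_of_mem hb]
          obtain ⟨b', hb', h⟩ := hb
          have hmem : Function.update b i (b' i) ∈ G := by
            rw [hG]
            refine ⟨b', hb', fun j hj => ?_⟩
            rcases eq_or_ne j i with rfl | hji
            · simp
            · rw [Function.update_of_ne hji]; exact h j (by simp [hji, hj])
          have := Finset.single_le_sum
            (f := fun v => G.indicator (1 : (ι → Bool) → ℝ) (Function.update b i v))
            (fun v _ => indicator_nonneg (fun _ _ => zero_le_one) _) (Finset.mem_univ (b' i))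
          rwa [indicator_of_mem hmem] at this
        · rw [indicator_of_notMem hb]
          exact Finset.sum_nonneg fun v _ => indicator_nonneg (fun _ _ => zero_le_one) _
      rw [bernExp_sum] at h2
      simpa using h2
    rw [← hG, bernPr, bernPr, bernExp_eq w (G.indicator 1) i]
    have h3 := hD i (Finset.mem_insert_self i D)
    have h4 := mul_le_mul_of_nonneg_right h3.1 (hnn true)
    have h5 := mul_le_mul_of_nonneg_right (show δ ≤ 1 - w i by linarith [h3.2]) (hnn false)
    have h6 := mul_le_mul_of_nonneg_left h1 hδ
    rw [bernPr] at h6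
    linarith

/-- Russo's formula. -/
theorem hasDerivAt_bernExp (a d : ι → ℝ) (f : (ι → Bool) → ℝ) (t : ℝ) :
    HasDerivAt (fun t => bernExp (fun i => a i + t * d i) f)
      (∑ i, d i * bernExp (fun i => a i + t * d i) (fun b =>
        f (Function.update b i true) - f (Function.update b i false))) t := by
  have h1 : ∀ b : ι → Bool, HasDerivAt
      (fun t : ℝ => ∏ i, if b i then a i + t * d i else 1 - (a i + t * d i))
      (∑ i, (∏ j ∈ Finset.univ.erase i, if b j then a j + t * d j else 1 - (a j + t * d j)) *
        (if b i then d i else - d i)) t := by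
    intro b
    have := HasDerivAt.fun_finsetProd (u := Finset.univ) (x := t)
      (f := fun i t => if b i then a i + t * d i else 1 - (a i + t * d i))
      (f' := fun i => if b i then d i else - d i) (fun i _ => by
        have h : HasDerivAt (fun t : ℝ => a i + t * d i) (d i) t := by
          simpa using ((hasDerivAt_id t).mul_const (d i)).const_add (a i)
        split_ifs
        · exact h
        · exact h.const_sub 1)
    simpa [smul_eq_mul] using this
  have h2 := HasDerivAt.fun_sum (u := Finset.univ) fun b _ => (h1 b).mul_const (f b)
  refine h2.congr_deriv ?_
  simp only [Finset.sum_mul]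
  rw [Finset.sum_comm]
  refine Finset.sum_congr rfl fun i _ => ?_
  rw [bernExp_sub, bernExp_update, bernExp_update, ← Finset.sum_sub_distrib, Finset.mul_sum,
    sum_bool_fun i]
  refine Finset.sum_congr rfl fun b hb => ?_
  simp only [Finset.mem_filter] at hb
  have : Function.update b i true = b := by rw [← hb.2]; exact Function.update_eq_self i b
  rw [this, prod_erase_update (fun j => a j + t * d j), hb.2]
  simp; ring

end finiteProduct

/-! ### Events depending on finitely many sites -/

/-- Extension of finitely many variables by `false`. -/
def extendPair (F : Finset Site) (b : F ⊕ F → Bool) : (Site → Bool) × (Site → Bool) :=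
  (fun x => if h : x ∈ F then b (.inl ⟨x, h⟩) else false,
    fun x => if h : x ∈ F then b (.inr ⟨x, h⟩) else false)

/-- The parameters for open sites of density `p` and activations of density `s`. -/
def pairWeight (F : Finset Site) (p s : ℝ) : F ⊕ F → ℝ := Sum.elim (fun _ => p) (fun _ => s)

/-- The event `A` depends only on the variables in `F`. -/
def DependsOn (F : Finset Site) (A : Set ((Site → Bool) × (Site → Bool))) : Prop :=
  ∀ u v : (Site → Bool) × (Site → Bool), (∀ x ∈ F, u.1 x = v.1 x ∧ u.2 x = v.2 x) →
    u ∈ A → v ∈ A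

theorem measurableSet_cylinder (F : Finset Site) (b : Site → Bool) :
    MeasurableSet (cylinder F b) := by
  have : cylinder F b = ⋂ x ∈ F, {η | η x = b x} := by
    ext η; simp [cylinder]
  rw [this]
  exact F.measurableSet_biInter fun x _ => measurable_pi_apply x (measurableSet_singleton _)

theorem pairWeight_mem {F : Finset Site} {p s : ℝ} (hp : p ∈ Icc (0:ℝ) 1)
    (hs : s ∈ Icc (0:ℝ) 1) (i : F ⊕ F) : pairWeight F p s i ∈ Icc (0:ℝ) 1 := by
  rcases i with i | i
  · exact hp
  · exact hs

theorem DependsOn.eq_biUnion {F : Finset Site} {A : Set ((Site → Bool) × (Site → Bool))}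
    (hA : DependsOn F A) [DecidablePred fun b => extendPair F b ∈ A] :
    A = ⋃ b ∈ Finset.univ.filter fun b => extendPair F b ∈ A,
      cylinder F (extendPair F b).1 ×ˢ cylinder F (extendPair F b).2 := by
  ext u
  simp only [Finset.mem_filter, Finset.mem_univ, true_and, mem_iUnion, exists_prop]
  constructor
  · intro hu
    have h : ∀ x ∈ F, u.1 x = (extendPair F (Sum.elim (fun x => u.1 x) (fun x => u.2 x))).1 x ∧
        u.2 x = (extendPair F (Sum.elim (fun x => u.1 x) (fun x => u.2 x))).2 x := by
      intro x hx; simp [extendPair, hx]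
    exact ⟨_, hA _ _ h hu, fun x hx => (h x hx).1, fun x hx => (h x hx).2⟩
  · rintro ⟨b, hb, h1, h2⟩
    exact hA _ _ (fun x hx => ⟨(h1 x hx).symm, (h2 x hx).symm⟩) hb

theorem DependsOn.measurableSet {F : Finset Site} {A : Set ((Site → Bool) × (Site → Bool))}
    (hA : DependsOn F A) : MeasurableSet A := by
  classical
  rw [hA.eq_biUnion]
  exact Finset.measurableSet_biUnion _ fun b _ =>
    (measurableSet_cylinder F _).prod (measurableSet_cylinder F _)

/-- The probability of an event depending on finitely many sites. -/
theorem DependsOn.measureReal_eq {F : Finset Site} {A : Set ((Site → Bool) × (Site → Bool))}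
    (hA : DependsOn F A) {p s : ℝ} (hp : p ∈ Icc (0:ℝ) 1) (hs : s ∈ Icc (0:ℝ) 1)
    {μ ν : Measure (Site → Bool)} (hμ : IsBernoulli p μ) (hν : IsBernoulli s ν) :
    (μ.prod ν).real A = bernPr (pairWeight F p s) {b | extendPair F b ∈ A} := by
  classical
  have := hμ.1
  have := hν.1
  have hcyl : ∀ b : F ⊕ F → Bool,
      (μ.prod ν).real (cylinder F (extendPair F b).1 ×ˢ cylinder F (extendPair F b).2) =
        ∏ i, if b i then pairWeight F p s i else 1 - pairWeight F p s i := by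
    intro b
    rw [Fintype.prod_sum_type, Measure.real, Measure.prod_prod, hμ.2, hν.2, ENNReal.toReal_mul,
      ENNReal.toReal_prod, ENNReal.toReal_prod]
    congr 1
    · rw [← Finset.prod_coe_sort]
      refine Finset.prod_congr rfl fun x _ => ?_
      rw [ENNReal.toReal_ofReal]
      · simp [extendPair, pairWeight]
      · split_ifs
        · exact hp.1
        · linarith [hp.2]
    · rw [← Finset.prod_coe_sort]
      refine Finset.prod_congr rfl fun x _ => ?_
      rw [ENNReal.toReal_ofReal]
      · simp [extendPair, pairWeight]
      · split_ifs
        · exact hs.1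
        · linarith [hs.2]
  conv_lhs => rw [hA.eq_biUnion]
  rw [measureReal_biUnion_finset]
  · rw [bernPr, bernExp, Finset.sum_filter]
    refine Finset.sum_congr rfl fun b _ => ?_
    rw [hcyl, indicator_apply]
    simp
  · intro b _ b' _ hbb'
    rw [Function.onFun, Set.disjoint_left]
    rintro u ⟨h1, h2⟩ ⟨h3, h4⟩
    refine hbb' (funext fun i => ?_)
    rcases i with ⟨x, hx⟩ | ⟨x, hx⟩
    · have := (h1 x hx).symm.trans (h3 x hx)
      simpa [extendPair, hx] using this
    · have := (h2 x hx).symm.trans (h4 x hx)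
      simpa [extendPair, hx] using this
  · intro b _
    exact (measurableSet_cylinder F _).prod (measurableSet_cylinder F _)

/-! ### The finite-volume events -/

/-- The sites of a box. -/
noncomputable def boxFinset (z : Site) (r : ℤ) : Finset Site := (box_finite z r).toFinset

theorem mem_boxFinset {z x : Site} {r : ℤ} : x ∈ boxFinset z r ↔ x ∈ box z r :=
  Finite.mem_toFinset _

section enhancedEvents

variable {R : ℤ} {φ : Config → Config}

theorem enhAt_congr (hφ : BoxRange R φ) {x : Site} {ω ω' : Config}
    (h : ∀ v ∈ box x R, v ∈ ω ↔ v ∈ ω') : enhAt φ x ω = enhAt φ x ω' := by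
  rw [enhAt, enhAt, hφ.congr (shiftConfig x ω) (shiftConfig x ω')]
  ext v
  simp only [shiftConfig, mem_inter_iff, mem_ofPred_eq, and_congr_left_iff]
  intro hv
  refine h _ ?_
  rw [mem_box_zero] at hv
  simp only [mem_box, Prod.fst_add, Prod.snd_add]; omega

theorem enhanced_inter_box_subset (hφ : BoxRange R φ) {ω ω' : Config} {α α' : Site → Bool} {n : ℤ}
    (hω : ∀ v ∈ box 0 (n + 2 * R), v ∈ ω ↔ v ∈ ω')
    (hα : ∀ v ∈ box 0 (n + 2 * R), α v = α' v) :
    enhanced φ ω α ∩ box 0 n ⊆ enhanced φ ω' α' := by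
  have hR := hφ.nonneg
  rintro v ⟨hv | ⟨x, hx, hv⟩, hvn⟩
  · exact Or.inl ((hω v (box_mono (by omega) hvn)).1 hv)
  · have hvx := enhAt_subset hφ x ω hv
    refine Or.inr ⟨x, ?_, ?_⟩
    · rw [← hα x, hx]
      rw [mem_box_zero] at *; rw [mem_box] at hvx; omega
    · rwa [← enhAt_congr hφ fun w hw => hω w ?_]
      rw [mem_box_zero] at *; rw [mem_box] at hvx hw; omega

/-- The event that the origin is joined to the boundary of a box in the enhanced configuration. -/
def escEvent (φ : Config → Config) (n : ℤ) : Set ((Site → Bool) × (Site → Bool)) :=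
  {u | Esc n (enhanced φ (toConfig u.1) u.2)}

theorem dependsOn_escEvent (hφ : BoxRange R φ) {n : ℤ} {F : Finset Site}
    (hF : box 0 (n + 2 * R) ⊆ F) : DependsOn F (escEvent φ n) := by
  intro u v h hu
  refine Esc.mono (enhanced_inter_box_subset hφ (fun w hw => ?_) fun w hw => (h w (hF hw)).2) hu
  simp only [toConfig, mem_ofPred_eq, (h w (hF hw)).1]

theorem enhanced_mono (hmono : Monotonic φ) {ω ω' : Config} {α α' : Site → Bool} (hω : ω ⊆ ω')
    (hα : ∀ x, α x = true → α' x = true) : enhanced φ ω α ⊆ enhanced φ ω' α' := by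
  rintro v (hv | ⟨x, hx, hv⟩)
  · exact Or.inl (hω hv)
  · exact Or.inr ⟨x, hα x hx, enhAt_mono hmono x hω hv⟩

theorem escEvent_mono (hmono : Monotonic φ) {n : ℤ} {u v : (Site → Bool) × (Site → Bool)}
    (h1 : ∀ x, u.1 x = true → v.1 x = true) (h2 : ∀ x, u.2 x = true → v.2 x = true)
    (hu : u ∈ escEvent φ n) : v ∈ escEvent φ n :=
  Esc.mono (inter_subset_left.trans (enhanced_mono hmono h1 h2)) hu

theorem escEvent_anti {n m : ℤ} (hn : 0 ≤ n) (hnm : n ≤ m) : escEvent φ m ⊆ escEvent φ n :=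
  fun _ hu => Esc.anti hn hnm hu

section measure

variable {p s : ℝ} {μ ν : Measure (Site → Bool)}

theorem setOf_inInfiniteCluster_enhanced :
    {ηα : (Site → Bool) × (Site → Bool) |
      InInfiniteCluster adjZ2 (enhanced φ (toConfig ηα.1) ηα.2) 0} =
        ⋂ n : ℕ, escEvent φ n := by
  ext u; simp [inInfiniteCluster_iff, escEvent]

theorem tendsto_escEvent (hφ : BoxRange R φ) [IsFiniteMeasure μ] [IsFiniteMeasure ν] :
    Tendsto (fun n : ℕ => (μ.prod ν).real (escEvent φ n)) atTop (𝓝 (thetaEnh adjZ2 φ μ ν)) := by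
  rw [thetaEnh, setOf_inInfiniteCluster_enhanced]
  refine (ENNReal.tendsto_toReal (measure_ne_top _ _)).comp
    (tendsto_measure_iInter_atTop (fun n => ?_) ?_ ⟨0, measure_ne_top _ _⟩)
  · exact (dependsOn_escEvent hφ (F := boxFinset 0 (n + 2 * R))
      fun v hv => mem_boxFinset.2 hv).measurableSet.nullMeasurableSet
  · intro n m hnm
    exact escEvent_anti (by omega) (by omega)

theorem thetaEnh_le (n : ℕ) [IsFiniteMeasure μ] [IsFiniteMeasure ν] :
    thetaEnh adjZ2 φ μ ν ≤ (μ.prod ν).real (escEvent φ n) := by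
  rw [thetaEnh, setOf_inInfiniteCluster_enhanced]
  exact measureReal_mono (iInter_subset _ n)

/-- Percolation without enhancement, as an instance of the enhanced process. -/
theorem thetaEnh_empty [IsProbabilityMeasure ν] [IsProbabilityMeasure μ] :
    thetaEnh adjZ2 (fun _ => ∅) μ ν = theta adjZ2 μ := by
  have : {ηα : (Site → Bool) × (Site → Bool) |
      InInfiniteCluster adjZ2 (enhanced (fun _ => ∅) (toConfig ηα.1) ηα.2) 0} =
        {η | InInfiniteCluster adjZ2 (toConfig η) 0} ×ˢ univ := by
    ext u; simp [enhanced, enhAt]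
  rw [thetaEnh, theta, this, Measure.prod_prod, measure_univ, mul_one]

theorem boxRange_empty (R : ℤ) (hR : 0 ≤ R) : BoxRange R fun _ => ∅ :=
  ⟨hR, fun _ => empty_subset _, fun _ _ _ => rfl⟩

end measure

section comparison

variable {p s : ℝ} {μ ν : Measure (Site → Bool)}

theorem measureReal_escEvent (hφ : BoxRange R φ) (hp : p ∈ Icc (0:ℝ) 1) (hs : s ∈ Icc (0:ℝ) 1)
    (hμ : IsBernoulli p μ) (hν : IsBernoulli s ν) {n m : ℤ} (h : n + 2 * R ≤ m) :
    (μ.prod ν).real (escEvent φ n) = bernPr (pairWeight (boxFinset 0 m) p s)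
      {b | extendPair (boxFinset 0 m) b ∈ escEvent φ n} :=
  (dependsOn_escEvent hφ fun _ hv =>
    mem_boxFinset.2 (box_mono (by omega) hv)).measureReal_eq hp hs hμ hν

theorem extendPair_mono {F : Finset Site} {b b' : F ⊕ F → Bool}
    (h : ∀ i, b i = true → b' i = true) :
    (∀ x, (extendPair F b).1 x = true → (extendPair F b').1 x = true) ∧
      ∀ x, (extendPair F b).2 x = true → (extendPair F b').2 x = true := by
  constructor <;>
  · intro x
    simp only [extendPair]
    split_ifs with hx
    · exact h _
    · exact id

theorem update_false_le_update_true {ι : Type*} [DecidableEq ι] (b : ι → Bool) (i j : ι)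
    (h : Function.update b i false j = true) : Function.update b i true j = true := by
  rcases eq_or_ne j i with rfl | hj
  · simp
  · simpa [hj] using h

theorem indicator_escEvent_update_le (hmono : Monotonic φ) (n : ℤ) (F : Finset Site)
    (i : F ⊕ F) (b : F ⊕ F → Bool) :
    ({b | extendPair F b ∈ escEvent φ n} : Set (F ⊕ F → Bool)).indicator (1 : (F ⊕ F → Bool) → ℝ)
        (Function.update b i false) ≤
      ({b | extendPair F b ∈ escEvent φ n} : Set (F ⊕ F → Bool)).indicator 1
        (Function.update b i true) := by
  by_cases h : extendPair F (Function.update b i false) ∈ escEvent φ n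
  · have h1 := extendPair_mono (F := F) (update_false_le_update_true b i)
    rw [indicator_of_mem (show _ ∈ {b | extendPair F b ∈ escEvent φ n} from h),
      indicator_of_mem (show _ ∈ {b | extendPair F b ∈ escEvent φ n} from
        escEvent_mono hmono h1.1 h1.2 h)]
    rfl
  · rw [indicator_of_notMem (show _ ∉ {b | extendPair F b ∈ escEvent φ n} from h)]
    exact indicator_nonneg (fun _ _ => zero_le_one) _

theorem thetaEnh_mono (hφ : BoxRange R φ) (hmono : Monotonic φ) {p' s' : ℝ}
    {μ' ν' : Measure (Site → Bool)} (hp : 0 ≤ p) (hs : 0 ≤ s) (hpp : p ≤ p') (hss : s ≤ s')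
    (hp' : p' ≤ 1) (hs' : s' ≤ 1) (hμ : IsBernoulli p μ) (hν : IsBernoulli s ν)
    (hμ' : IsBernoulli p' μ') (hν' : IsBernoulli s' ν') :
    thetaEnh adjZ2 φ μ ν ≤ thetaEnh adjZ2 φ μ' ν' := by
  have := hμ.1
  have := hν.1
  have := hμ'.1
  have := hν'.1
  have hpI : p ∈ Icc (0:ℝ) 1 := ⟨hp, hpp.trans hp'⟩
  have hsI : s ∈ Icc (0:ℝ) 1 := ⟨hs, hss.trans hs'⟩
  have hpI' : p' ∈ Icc (0:ℝ) 1 := ⟨hp.trans hpp, hp'⟩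
  have hsI' : s' ∈ Icc (0:ℝ) 1 := ⟨hs.trans hss, hs'⟩
  refine le_of_tendsto_of_tendsto' (tendsto_escEvent hφ) (tendsto_escEvent hφ) fun n => ?_
  rw [measureReal_escEvent hφ hpI hsI hμ hν le_rfl, measureReal_escEvent hφ hpI' hsI' hμ' hν' le_rfl]
  refine bernExp_le_bernExp (pairWeight_mem hpI hsI) (pairWeight_mem hpI' hsI') fun i b => ?_
  refine mul_nonneg ?_ (sub_nonneg.2 (indicator_escEvent_update_le hmono n _ i b))
  rcases i with i | i
  · exact sub_nonneg.2 hpp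
  · exact sub_nonneg.2 hss

/-- An inessential monotonic enhancement does not create percolation. -/
theorem exists_mul_thetaEnh_le (hφ : BoxRange R φ) (hmono : Monotonic φ)
    (hess : ¬ Essential adjZ2 φ) (hp : 0 < p) (hp1 : p < 1) (hs : s ∈ Icc (0:ℝ) 1)
    (hμ : IsBernoulli p μ) (hν : IsBernoulli s ν) :
    ∃ c, 0 < c ∧ c * thetaEnh adjZ2 φ μ ν ≤ theta adjZ2 μ := by
  classical
  have := hμ.1
  have := hν.1
  have hR := hφ.nonneg
  have hpI : p ∈ Icc (0:ℝ) 1 := ⟨hp.le, hp1.le⟩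
  obtain ⟨δ, hδ0, hδ1, hδ2⟩ : ∃ δ : ℝ, 0 < δ ∧ δ ≤ p ∧ δ ≤ 1 - p :=
    ⟨min p (1 - p), lt_min hp (by linarith), min_le_left _ _, min_le_right _ _⟩
  obtain ⟨S, hS⟩ : ∃ S : Finset Site, S = (Finset.Icc 0 (2 * R + 2)).image fun t => (t, 0) :=
    ⟨_, rfl⟩
  refine ⟨δ ^ S.card, pow_pos hδ0 _, ?_⟩
  rw [← thetaEnh_empty (ν := ν)]
  refine le_of_tendsto_of_tendsto ((tendsto_escEvent hφ).const_mul _)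
    ((tendsto_escEvent (boxRange_empty R hR)).comp (tendsto_sub_atTop_nat 1)) ?_
  filter_upwards [eventually_ge_atTop 2] with n hn
  rw [Function.comp_apply, measureReal_escEvent hφ hpI hs hμ hν le_rfl,
    measureReal_escEvent (boxRange_empty R hR) hpI hs hμ hν (m := n + 2 * R) (by omega)]
  obtain ⟨F, hF⟩ : ∃ F, F = boxFinset 0 ((n : ℤ) + 2 * R) := ⟨_, rfl⟩
  rw [← hF]
  obtain ⟨D, hD⟩ : ∃ D : Finset (F ⊕ F), D = (Finset.univ.filter fun x : F => (x : Site) ∈ S).map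
    Function.Embedding.inl := ⟨_, rfl⟩
  have hDcard : D.card ≤ S.card := by
    rw [hD, Finset.card_map]
    refine Finset.card_le_card_of_injOn (fun x => (x : Site)) (fun x hx => ?_) fun x _ y _ h =>
      Subtype.ext h
    simpa using hx
  have hDmem : ∀ x : F, (x : Site) ∈ S → Sum.inl x ∈ D := by
    intro x hx; simp [hD, hx]
  have h1 := pow_mul_bernPr_le hδ0.le (pairWeight_mem hpI hs) D (by
    intro i hi
    rw [hD, Finset.mem_map] at hi
    obtain ⟨x, -, rfl⟩ := hi
    exact ⟨hδ1, by change p ≤ _; linarith⟩)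
    {b | extendPair F b ∈ escEvent φ n ∧ ∀ x : F, (x : Site) ∈ S → b (.inl x) = true}
  have h2 : bernPr (pairWeight F p s) {b | extendPair F b ∈ escEvent φ n} ≤ _ :=
    bernPr_mono (pairWeight_mem hpI hs) (E' := {b | ∃ b' ∈ {b | extendPair F b ∈ escEvent φ n ∧
      ∀ x : F, (x : Site) ∈ S → b (.inl x) = true}, ∀ i ∉ D, b i = b' i}) (by
    intro b hb
    refine ⟨fun i => if i ∈ D then true else b i, ⟨?_, fun x hx => ?_⟩, fun i hi => ?_⟩
    · have := extendPair_mono (F := F) (b := b) (b' := fun i => if i ∈ D then true else b i)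
        fun i hi => by simp [hi]
      exact escEvent_mono hmono this.1 this.2 hb
    · simp [hDmem x hx]
    · simp [hi])
  have h3 : bernPr (pairWeight F p s) {b | extendPair F b ∈ escEvent φ n ∧
      ∀ x : F, (x : Site) ∈ S → b (.inl x) = true} ≤ bernPr (pairWeight F p s)
        {b | extendPair F b ∈ escEvent (fun _ => ∅) ((n - 1 : ℕ) : ℤ)} := by
    refine bernPr_mono (pairWeight_mem hpI hs) ?_
    rintro b ⟨hb, hb'⟩
    have h4 := esc_of_esc_enhanced hφ hess hmono (by omega) (fun t ht ht' => ?_) hb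
    · refine Esc.mono (inter_subset_left.trans subset_union_left) (X := toConfig (extendPair F b).1) ?_
      rwa [Nat.cast_sub (by omega)]
    · have hmem : ((t, 0) : Site) ∈ F := by
        rw [hF, mem_boxFinset, mem_box_zero]; dsimp only; omega
      have := hb' ⟨_, hmem⟩ (by rw [hS]; simp; omega)
      simp [toConfig, extendPair, hmem, this]
  calc δ ^ S.card * bernPr (pairWeight F p s) {b | extendPair F b ∈ escEvent φ n}
      ≤ δ ^ D.card * bernPr (pairWeight F p s) {b | extendPair F b ∈ escEvent φ n} :=
        mul_le_mul_of_nonneg_right (pow_le_pow_of_le_one hδ0.le (by linarith) hDcard)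
          (bernPr_nonneg (pairWeight_mem hpI hs) _)
    _ ≤ _ := (mul_le_mul_of_nonneg_left h2 (pow_nonneg hδ0.le _)).trans (h1.trans h3)

end comparison

/-! ### From pivotal sites to pivotal activations -/

/-- Interpolating between two families of activations which differ in a finite set. -/
theorem exists_pivotal_interpolation {ι : Type*} [DecidableEq ι] (f : (ι → Bool) → Prop)
    (S : Finset ι) (α β : ι → Bool) (hS : ∀ v, v ∉ S → α v = β v) (hβ : ∀ v ∈ S, β v = false)
    (hα : f α) (hfβ : ¬ f β) :
    ∃ γ : ι → Bool, ∃ x ∈ S, (∀ v, v ∉ S → γ v = α v) ∧ f (Function.update γ x true) ∧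
      ¬ f (Function.update γ x false) := by
  induction S using Finset.induction_on generalizing α with
  | empty => exact absurd (by rwa [← funext fun v => hS v (by simp)]) hfβ
  | insert i S hi ih =>
    by_cases h : f (Function.update α i false)
    · obtain ⟨γ, x, hx, h1, h2, h3⟩ := ih (Function.update α i false) (fun v hv => by
        rcases eq_or_ne v i with rfl | hvi
        · simp [hβ v (Finset.mem_insert_self v S)]
        · rw [Function.update_of_ne hvi]; exact hS v (by simp [hvi, hv]))
        (fun v hv => hβ v (Finset.mem_insert_of_mem hv)) h
      refine ⟨γ, x, Finset.mem_insert_of_mem hx, fun v hv => ?_, h2, h3⟩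
      rw [Finset.mem_insert, not_or] at hv
      rw [h1 v hv.2, Function.update_of_ne hv.1]
    · refine ⟨α, i, Finset.mem_insert_self i S, fun _ _ => rfl, ?_, h⟩
      have h1 : α i = true := by
        by_contra hne
        rw [Bool.not_eq_true] at hne
        refine h ?_
        rw [← hne, Function.update_eq_self]; exact hα
      rw [← h1, Function.update_eq_self]; exact hα

theorem enhanced_eq_union {ω ω' : Config} {α : Site → Bool} (hφ : BoxRange R φ) {z : Site} {K : ℤ}
    (hα : ∀ x ∈ box z (K + R), α x = false) (h : ∀ v, v ∉ box z K → (v ∈ ω' ↔ v ∈ ω)) :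
    enhanced φ ω' α = ω' ∪ {y | ∃ x, α x = true ∧ y ∈ enhAt φ x ω} := by
  have : ∀ x, α x = true → enhAt φ x ω' = enhAt φ x ω := by
    intro x hx
    refine enhAt_congr hφ fun v hv => h v fun hvK => ?_
    rw [hα x (by rw [mem_box] at *; omega)] at hx
    exact absurd hx (by simp)
  rw [enhanced]
  congr 1
  ext y
  exact exists_congr fun x => and_congr_right fun hx => by rw [this x hx]

/-- If a site is pivotal, then a local modification produces a pivotal activation nearby. -/
theorem Essential.exists_pivotal (hess : Essential adjZ2 φ) (hφ : BoxRange R φ)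
    (hmono : Monotonic φ) : ∃ L : ℤ, 0 ≤ L ∧ ∀ (n : ℤ) (z : Site), box z L ⊆ box 0 (n - 1) →
      0 ∉ box z L → ∀ η α : Site → Bool, (Function.update η z true, α) ∈ escEvent φ n →
      (Function.update η z false, α) ∉ escEvent φ n → ∃ η' α' : Site → Bool, ∃ x ∈ box z L,
        (∀ v, v ∉ box z L → η' v = η v ∧ α' v = α v) ∧
        (η', Function.update α' x true) ∈ escEvent φ n ∧
        (η', Function.update α' x false) ∉ escEvent φ n := by
  classical
  obtain ⟨K, hRK, hK⟩ := hess.exists_surgery hφ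
  have hR := hφ.nonneg
  refine ⟨K + R, by omega, ?_⟩
  intro n z hzn h0 η α hT hF
  have hzz : z ∈ box z (K + R) := by rw [mem_box]; omega
  have hKL : box z K ⊆ box z (K + R) := box_mono (by omega)
  have hn : 1 ≤ n := by
    have := hzn hzz
    rw [mem_box_zero] at this; omega
  obtain ⟨α₀, hα₀⟩ : ∃ α₀ : Site → Bool, α₀ = fun v => if v ∈ box z (K + R) then false else α v :=
    ⟨_, rfl⟩
  have hα₀z : ∀ x ∈ box z (K + R), α₀ x = false := fun x hx => by simp [hα₀, hx]
  have hα₀o : ∀ x, x ∉ box z (K + R) → α₀ x = α x := fun x hx => by simp [hα₀, hx]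
  have hmain : ∀ b : Bool, (Function.update η z b, α) ∈ escEvent φ n →
      (Function.update η z b, α₀) ∉ escEvent φ n → ∃ η' α' : Site → Bool, ∃ x ∈ box z (K + R),
        (∀ v, v ∉ box z (K + R) → η' v = η v ∧ α' v = α v) ∧
        (η', Function.update α' x true) ∈ escEvent φ n ∧
        (η', Function.update α' x false) ∉ escEvent φ n := by
    intro b h1 h2
    obtain ⟨γ, x, hx, h3, h4, h5⟩ := exists_pivotal_interpolation
      (fun α => (Function.update η z b, α) ∈ escEvent φ n) (boxFinset z (K + R)) α α₀
      (fun v hv => by rw [hα₀o v fun h => hv (mem_boxFinset.2 h)])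
      (fun v hv => hα₀z v (mem_boxFinset.1 hv)) h1 h2
    refine ⟨_, γ, x, mem_boxFinset.1 hx, fun v hv => ⟨?_, h3 v fun h => hv (mem_boxFinset.1 h)⟩,
      h4, h5⟩
    rw [Function.update_of_ne]
    rintro rfl; exact hv hzz
  by_cases hT0 : (Function.update η z true, α₀) ∈ escEvent φ n
  swap
  · exact hmain true hT hT0
  have hF0 : (Function.update η z false, α₀) ∉ escEvent φ n := by
    refine fun h => hF (escEvent_mono hmono (u := (Function.update η z false, α₀))
      (fun _ hx => hx) (fun x hx => ?_) h)
    dsimp only at hx ⊢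
    by_cases hxz : x ∈ box z (K + R)
    · rw [hα₀z x hxz] at hx; exact absurd hx (by simp)
    · rwa [← hα₀o x hxz]
  obtain ⟨ω, hω⟩ : ∃ ω, ω = toConfig (Function.update η z false) := ⟨_, rfl⟩
  have hω1 : toConfig (Function.update η z true) = ω ∪ {z} := by
    ext v
    rw [hω]
    rcases eq_or_ne v z with rfl | hv
    · simp [toConfig]
    · simp [toConfig, hv]
  obtain ⟨E, hE⟩ : ∃ E, E = {y | ∃ x, α₀ x = true ∧ y ∈ enhAt φ x ω} := ⟨_, rfl⟩
  have hEz : ∀ v ∈ E, v ∉ box z K := by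
    rw [hE]
    rintro v ⟨x, hx, hv⟩ hvz
    have := enhAt_subset hφ x ω hv
    rw [hα₀z x (by rw [mem_box] at *; omega)] at hx
    exact absurd hx (by simp)
  have hEnh : ∀ ω', (∀ v, v ∉ box z K → (v ∈ ω' ↔ v ∈ ω)) → enhanced φ ω' α₀ = ω' ∪ E := by
    intro ω' h; rw [hE]; exact enhanced_eq_union hφ hα₀z h
  have hzK : z ∈ box z K := by rw [mem_box]; omega
  simp only [escEvent, mem_ofPred_eq] at hT0 hF0
  rw [hω1, hEnh _ (fun v hv => by
    simp only [union_singleton, mem_insert_iff, or_iff_right_iff_imp]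
    rintro rfl; exact absurd hzK hv)] at hT0
  rw [← hω, hEnh _ fun _ _ => Iff.rfl] at hF0
  obtain ⟨X', hX'1, hX'2, hX'3⟩ := hK z 0 (box 0 (n - 1))ᶜ ((ω ∪ E) ∩ box 0 n)
    (fun h => h0 (hKL h)) (fun t ht h => ht (hzn (hKL h)))
    (fun t ht h => hF0 ⟨t, h, ht⟩) (by
      obtain ⟨y, hy, hy'⟩ := hT0
      refine ⟨y, hy', hy.mono ?_⟩
      rintro v ⟨(hv | hv) | hv, hvn⟩
      · exact Or.inl ⟨Or.inl hv, hvn⟩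
      · exact Or.inr hv
      · exact Or.inl ⟨Or.inr hv, hvn⟩)
  obtain ⟨ω', hω'⟩ : ∃ ω', ω' = (ω \ box z K) ∪ (X' ∩ box z K) := ⟨_, rfl⟩
  have hω'o : ∀ v, v ∉ box z K → (v ∈ ω' ↔ v ∈ ω) := by
    intro v hv; rw [hω']; simp [hv]
  have hω'i : ∀ v, v ∈ box z K → (v ∈ ω' ↔ v ∈ X') := by
    intro v hv; rw [hω']; simp [hv]
  have hX'eq : X' = (ω' ∪ E) ∩ box 0 n := by
    ext v
    by_cases hv : v ∈ box z K
    · have h1 : v ∉ E := fun h => hEz v h hv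
      have h2 : v ∈ box 0 n := box_mono (by omega) (hzn (hKL hv))
      simp [hω'i v hv, h1, h2]
    · rw [hX'1 v hv, mem_inter_iff, mem_inter_iff, mem_union, mem_union, hω'o v hv]
  refine ⟨fun v => decide (v ∈ ω'), α₀, z, hzz, fun v hv => ⟨?_, hα₀o v hv⟩, ?_, ?_⟩
  · have h1 : v ≠ z := by rintro rfl; exact hv hzz
    have h2 := hω'o v fun h => hv (hKL h)
    rw [hω] at h2
    simp [h2, toConfig, h1]
  · obtain ⟨t, ht, ht'⟩ := hX'3
    refine Esc.of_reachIn (by omega) (ht'.mono ?_) ht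
    have h3 : toConfig (fun v => decide (v ∈ ω')) = ω' := by ext; simp [toConfig]
    dsimp only
    rw [h3]
    have h4 : enhanced φ ω' α₀ ⊆ enhanced φ ω' (Function.update α₀ z true) :=
      enhanced_mono hmono Subset.rfl fun x hx => by
        rcases eq_or_ne x z with rfl | hxz
        · simp
        · simpa [hxz] using hx
    rw [hEnh ω' hω'o] at h4
    refine union_subset ((hX'eq.subset.trans inter_subset_left).trans h4) ?_
    rw [enhAt_congr hφ (ω := X') (ω' := ω') fun v hv => (hω'i v (box_mono hRK hv)).symm]
    exact fun v hv => Or.inr ⟨z, by simp, hv⟩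
  · have h3 : toConfig (fun v => decide (v ∈ ω')) = ω' := by ext; simp [toConfig]
    have h5 : Function.update α₀ z false = α₀ := by
      rw [← hα₀z z hzz, Function.update_eq_self]
    simp only [escEvent, mem_ofPred_eq]
    rw [h3, h5, hEnh ω' hω'o]
    rintro ⟨y, hy, hy'⟩
    exact hX'2 y hy' (by rwa [hX'eq])

/-! ### The differential inequality -/

/-- The coordinate `i` is pivotal for the event `E`. -/
def pivotal {ι : Type*} [DecidableEq ι] (E : Set (ι → Bool)) (i : ι) : Set (ι → Bool) :=
  {b | Function.update b i true ∈ E ∧ Function.update b i false ∉ E}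

/-- The event `escEvent` in terms of the variables in `F`. -/
def escBool (φ : Config → Config) (F : Finset Site) (n : ℤ) : Set (F ⊕ F → Bool) :=
  {b | extendPair F b ∈ escEvent φ n}

theorem bernExp_indicator_escBool_sub (hmono : Monotonic φ) (F : Finset Site) (n : ℤ)
    (w : F ⊕ F → ℝ) (i : F ⊕ F) :
    bernExp w (fun b => (escBool φ F n).indicator 1 (Function.update b i true) -
      (escBool φ F n).indicator 1 (Function.update b i false)) =
        bernPr w (pivotal (escBool φ F n) i) := by
  rw [bernPr]
  congr 1
  ext b
  have h := indicator_escEvent_update_le hmono n F i b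
  change (escBool φ F n).indicator _ _ ≤ (escBool φ F n).indicator _ _ at h
  by_cases h1 : Function.update b i true ∈ escBool φ F n <;>
    by_cases h2 : Function.update b i false ∈ escBool φ F n
  · rw [indicator_of_mem h1, indicator_of_mem h2, indicator_of_notMem fun h => h.2 h2]; simp
  · rw [indicator_of_mem h1, indicator_of_notMem h2,
      indicator_of_mem (show b ∈ pivotal _ i from ⟨h1, h2⟩)]; simp
  · rw [indicator_of_notMem h1, indicator_of_mem h2] at h; norm_num at h
  · rw [indicator_of_notMem h1, indicator_of_notMem h2, indicator_of_notMem fun h => h1 h.1]; simp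

theorem card_boxFinset_le (z : Site) (r : ℤ) :
    (boxFinset z r).card ≤ (boxFinset 0 r).card := by
  refine Finset.card_le_card_of_injOn (fun x => x - z) (fun x hx => ?_)
    fun x _ y _ h => sub_left_injective h
  rw [Finset.mem_coe, mem_boxFinset] at *
  exact mem_box_sub.2 hx

theorem card_filter_box_le (F : Finset Site) (z : Site) (r : ℤ) [DecidablePred (· ∈ box z r)] :
    (Finset.univ.filter fun x : F => (x : Site) ∈ box z r).card ≤ (boxFinset 0 r).card := by
  refine le_trans ?_ (card_boxFinset_le z r)
  refine Finset.card_le_card_of_injOn (fun x => (x : Site)) (fun x hx => ?_) fun x _ y _ h =>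
    Subtype.ext h
  simpa [mem_boxFinset] using hx

theorem extendPair_update_inl (F : Finset Site) (b : F ⊕ F → Bool) (z : F) (v : Bool) :
    extendPair F (Function.update b (.inl z) v) =
      (Function.update (extendPair F b).1 z v, (extendPair F b).2) := by
  refine Prod.ext (funext fun x => ?_) (funext fun x => ?_)
  · by_cases hx : x = z
    · subst hx; simp [extendPair]
    · have : ∀ h : x ∈ F, (Sum.inl ⟨x, h⟩ : F ⊕ F) ≠ Sum.inl z := fun h h' =>
        hx (congrArg Subtype.val (Sum.inl_injective h'))
      simp only [extendPair, Function.update_of_ne hx, Function.update_of_ne (this _)]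
  · simp [extendPair]

theorem extendPair_elim (F : Finset Site) (η α : Site → Bool) (x : Site) (hx : x ∈ F) :
    (extendPair F (Sum.elim (fun x => η x) fun x => α x)).1 x = η x ∧
      (extendPair F (Sum.elim (fun x => η x) fun x => α x)).2 x = α x := by
  simp [extendPair, hx]

theorem update_elim_inr (F : Finset Site) (η α : Site → Bool) (x : F) (v : Bool) :
    Function.update (Sum.elim (fun x : F => η x) fun x : F => α x) (.inr x) v =
      Sum.elim (fun x : F => η x) fun y : F => Function.update α x v y := by
  ext i
  rcases i with i | i
  · simp
  · by_cases hi : i = x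
    · subst hi; simp
    · have : (i : Site) ≠ x := fun h => hi (Subtype.ext h)
      simp [hi, this]

theorem mem_escBool_elim (hφ : BoxRange R φ) {F : Finset Site} {n : ℤ}
    (hF : box 0 (n + 2 * R) ⊆ F) (η α : Site → Bool) :
    (Sum.elim (fun x : F => η x) fun x : F => α x) ∈ escBool φ F n ↔ (η, α) ∈ escEvent φ n := by
  have h := extendPair_elim F η α
  exact ⟨dependsOn_escEvent hφ hF _ _ h,
    dependsOn_escEvent hφ hF _ _ fun x hx => ⟨(h x hx).1.symm, (h x hx).2.symm⟩⟩

/-- The local modification property with radius `L`. -/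
def LocalModification (φ : Config → Config) (L : ℤ) : Prop :=
  ∀ (n : ℤ) (z : Site), box z L ⊆ box 0 (n - 1) → 0 ∉ box z L → ∀ η α : Site → Bool,
    (Function.update η z true, α) ∈ escEvent φ n →
    (Function.update η z false, α) ∉ escEvent φ n → ∃ η' α' : Site → Bool, ∃ x ∈ box z L,
      (∀ v, v ∉ box z L → η' v = η v ∧ α' v = α v) ∧
      (η', Function.update α' x true) ∈ escEvent φ n ∧
      (η', Function.update α' x false) ∉ escEvent φ n

theorem bernPr_pivotal_inl_le (hφ : BoxRange R φ) {L : ℤ} (hL : LocalModification φ L) {n : ℤ}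
    {F : Finset Site} (hF : box 0 (n + 2 * R) ⊆ F) {w : F ⊕ F → ℝ} {δ : ℝ} (hδ : 0 < δ)
    (hw : ∀ i, w i ∈ Icc δ (1 - δ)) {z : F} (hzn : box (z : Site) L ⊆ box 0 (n - 1))
    (h0 : 0 ∉ box (z : Site) L) [DecidablePred (· ∈ box (z : Site) L)] :
    δ ^ (2 * (boxFinset 0 L).card) * bernPr w (pivotal (escBool φ F n) (.inl z)) ≤
      ∑ x ∈ Finset.univ.filter fun x : F => (x : Site) ∈ box (z : Site) L, bernPr w (pivotal (escBool φ F n) (.inr x)) := by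
  have hR := hφ.nonneg
  have hw' : ∀ i, w i ∈ Icc (0:ℝ) 1 := fun i =>
    ⟨hδ.le.trans (hw i).1, (hw i).2.trans (by linarith)⟩
  have hδ1 : δ ≤ 1 := (hw (.inl z)).1.trans (hw' _).2
  obtain ⟨B, hB⟩ : ∃ B : Finset F, B = Finset.univ.filter fun x : F => (x : Site) ∈ box (z : Site) L :=
    ⟨_, rfl⟩
  have hBcard : B.card ≤ (boxFinset 0 L).card := by rw [hB]; exact card_filter_box_le F z L
  have hDcard : (B.disjSum B).card ≤ 2 * (boxFinset 0 L).card := by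
    rw [Finset.card_disjSum]; omega
  rw [← hB]
  refine le_trans ?_ (bernPr_biUnion_le hw' B _)
  refine le_trans ?_ (pow_mul_bernPr_le hδ.le hw' (B.disjSum B) (fun i _ => hw i) _)
  refine mul_le_mul (pow_le_pow_of_le_one hδ.le hδ1 hDcard) (bernPr_mono hw' ?_)
    (bernPr_nonneg hw' _) (pow_nonneg hδ.le _)
  rintro b ⟨hb1, hb2⟩
  change extendPair F _ ∈ escEvent φ n at hb1
  change extendPair F _ ∉ escEvent φ n at hb2
  rw [extendPair_update_inl] at hb1 hb2
  obtain ⟨η', α', x, hx, h1, h2, h3⟩ := hL n z hzn h0 _ _ hb1 hb2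
  have hxF : x ∈ F := hF (box_mono (by omega) (hzn hx))
  refine ⟨Sum.elim (fun x => η' x) fun x => α' x, ?_, ?_⟩
  · simp only [mem_iUnion]
    refine ⟨⟨x, hxF⟩, by simpa [hB] using hx, ?_, ?_⟩
    · rw [update_elim_inr, mem_escBool_elim hφ hF]; exact h2
    · rw [update_elim_inr, mem_escBool_elim hφ hF]; exact h3
  · rintro (i | i) hi
    · have hi' : (i : Site) ∉ box (z : Site) L := by simpa [hB] using hi
      have := (h1 i hi').1
      simp [extendPair] at this
      simp [this]
    · have hi' : (i : Site) ∉ box (z : Site) L := by simpa [hB] using hi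
      have := (h1 i hi').2
      simp [extendPair] at this
      simp [this]

open Classical in
/-- The parameters at the beginning of the interpolation, and their rate of change: the density
of open sites decreases, while the density of activations increases. -/
noncomputable def slope (F : Finset Site) (n L : ℤ) (κ σ : ℝ) : F ⊕ F → ℝ :=
  Sum.elim (fun z => if box (z : Site) L ⊆ box 0 (n - 1) ∧ 0 ∉ box (z : Site) L then -κ else 0)
    (fun _ => σ)

theorem bernPr_le_bernPr_add_slope (hφ : BoxRange R φ) (hmono : Monotonic φ) {L : ℤ}
    (hL : LocalModification φ L) {n : ℤ} {F : Finset Site} (hF : box 0 (n + 2 * R) ⊆ F)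
    {p s κ σ δ : ℝ} (hδ : 0 < δ) (hκ : 0 ≤ κ) (hσ : 0 ≤ σ) (hp1 : δ ≤ p - κ) (hp2 : p ≤ 1 - δ)
    (hs1 : δ ≤ s) (hs2 : s + σ ≤ 1 - δ)
    (hκσ : κ * (boxFinset 0 L).card ≤ σ * δ ^ (2 * (boxFinset 0 L).card)) :
    bernPr (pairWeight F p s) (escBool φ F n) ≤
      bernPr (fun i => pairWeight F p s i + slope F n L κ σ i) (escBool φ F n) := by
  classical
  obtain ⟨M, hM⟩ : ∃ M, M = (boxFinset 0 L).card := ⟨_, rfl⟩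
  have hderiv := hasDerivAt_bernExp (pairWeight F p s) (slope F n L κ σ)
    ((escBool φ F n).indicator 1)
  have hmon : MonotoneOn (fun t : ℝ => bernExp (fun i => pairWeight F p s i + t * slope F n L κ σ i)
      ((escBool φ F n).indicator 1)) (Icc 0 1) := by
    refine monotoneOn_of_deriv_nonneg (convex_Icc 0 1)
      (fun t _ => (hderiv t).continuousAt.continuousWithinAt)
      (fun t _ => (hderiv t).differentiableAt.differentiableWithinAt) fun t ht => ?_
    rw [interior_Icc] at ht
    rw [(hderiv t).deriv]
    simp only [bernExp_indicator_escBool_sub hmono]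
    obtain ⟨w, hw⟩ : ∃ w, w = fun i => pairWeight F p s i + t * slope F n L κ σ i := ⟨_, rfl⟩
    rw [← hw]
    have htκ := mul_nonneg ht.1.le hκ
    have htσ := mul_nonneg ht.1.le hσ
    have htκ' := mul_le_of_le_one_left hκ ht.2.le
    have htσ' := mul_le_of_le_one_left hσ ht.2.le
    have hwδ : ∀ i, w i ∈ Icc δ (1 - δ) := by
      rintro (i | i)
      · simp only [hw, pairWeight, slope, Sum.elim_inl, mem_Icc]
        split_ifs
        · constructor <;> linarith
        · constructor <;> linarith
      · simp only [hw, pairWeight, slope, Sum.elim_inr, mem_Icc]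
        constructor <;> linarith
    have hw' : ∀ i, w i ∈ Icc (0:ℝ) 1 := fun i =>
      ⟨hδ.le.trans (hwδ i).1, (hwδ i).2.trans (by linarith)⟩
    obtain ⟨G, hG⟩ : ∃ G : Finset F, G = Finset.univ.filter fun z : F =>
      box (z : Site) L ⊆ box 0 (n - 1) ∧ 0 ∉ box (z : Site) L := ⟨_, rfl⟩
    obtain ⟨q, hq⟩ : ∃ q, q = fun i => bernPr w (pivotal (escBool φ F n) i) := ⟨_, rfl⟩
    have hq0 : ∀ i, 0 ≤ q i := fun i => by rw [hq]; exact bernPr_nonneg hw' _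
    have h1 : ∑ i, slope F n L κ σ i * bernPr w (pivotal (escBool φ F n) i) =
        σ * ∑ x, q (.inr x) - κ * ∑ z ∈ G, q (.inl z) := by
      rw [Fintype.sum_sum_type, hG, Finset.sum_filter, Finset.mul_sum, Finset.mul_sum, add_comm,
        sub_eq_add_neg, ← Finset.sum_neg_distrib]
      congr 1
      · simp only [slope, Sum.elim_inr, hq]
      · refine Finset.sum_congr rfl fun z _ => ?_
        simp only [slope, Sum.elim_inl, hq]
        split_ifs <;> simp
    have h2 : δ ^ (2 * M) * ∑ z ∈ G, q (.inl z) ≤ M * ∑ x, q (.inr x) := by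
      calc δ ^ (2 * M) * ∑ z ∈ G, q (.inl z)
          ≤ ∑ z ∈ G, ∑ x ∈ Finset.univ.filter fun x : F => (x : Site) ∈ box (z : Site) L, q (.inr x) := by
            rw [Finset.mul_sum]
            refine Finset.sum_le_sum fun z hz => ?_
            simp only [hG, Finset.mem_filter, Finset.mem_univ, true_and] at hz
            rw [hM, hq]
            exact bernPr_pivotal_inl_le hφ hL hF hδ hwδ hz.1 hz.2
        _ ≤ ∑ z : F, ∑ x ∈ Finset.univ.filter fun x : F => (x : Site) ∈ box (z : Site) L, q (.inr x) :=
            Finset.sum_le_sum_of_subset_of_nonneg (Finset.subset_univ _) fun z _ _ =>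
              Finset.sum_nonneg fun x _ => hq0 _
        _ = ∑ x : F, ∑ z ∈ Finset.univ.filter fun z : F => (z : Site) ∈ box (x : Site) L, q (.inr x) := by
            refine Finset.sum_comm' fun x y => ?_
            simp only [Finset.mem_univ, Finset.mem_filter, true_and, and_true, mem_box]
            omega
        _ ≤ M * ∑ x, q (.inr x) := by
            rw [Finset.mul_sum]
            refine Finset.sum_le_sum fun x _ => ?_
            rw [Finset.sum_const, nsmul_eq_mul, hM]
            exact mul_le_mul_of_nonneg_right (by exact_mod_cast card_filter_box_le F x L) (hq0 _)
    rw [h1, sub_nonneg]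
    rw [← hM] at hκσ
    have hδM : 0 < δ ^ (2 * M) := pow_pos hδ _
    have hA : 0 ≤ ∑ x, q (.inr x) := Finset.sum_nonneg fun x _ => hq0 _
    refine le_of_mul_le_mul_left ?_ hδM
    calc δ ^ (2 * M) * (κ * ∑ z ∈ G, q (.inl z)) = κ * (δ ^ (2 * M) * ∑ z ∈ G, q (.inl z)) := by ring
      _ ≤ κ * (M * ∑ x, q (.inr x)) := mul_le_mul_of_nonneg_left h2 hκ
      _ = (κ * M) * ∑ x, q (.inr x) := by ring
      _ ≤ (σ * δ ^ (2 * M)) * ∑ x, q (.inr x) := mul_le_mul_of_nonneg_right hκσ hA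
      _ = _ := by ring
  have := hmon (left_mem_Icc.2 zero_le_one) (right_mem_Icc.2 zero_le_one) zero_le_one
  simpa [bernPr] using this

theorem slope_param_mem {F : Finset Site} {n L : ℤ} {p s κ σ : ℝ} (hκ : 0 ≤ κ) (hσ : 0 ≤ σ)
    (hp1 : 0 ≤ p - κ) (hp2 : p ≤ 1) (hs1 : 0 ≤ s) (hs2 : s + σ ≤ 1) (i : F ⊕ F) :
    pairWeight F p s i + slope F n L κ σ i ∈ Icc (0:ℝ) 1 := by
  rcases i with i | i
  · simp only [pairWeight, slope, Sum.elim_inl, mem_Icc]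
    split_ifs
    · constructor <;> linarith
    · constructor <;> linarith
  · simp only [pairWeight, slope, Sum.elim_inr, mem_Icc]
    constructor <;> linarith

/-- In finite volume, the interpolated parameters are comparable to homogeneous ones. -/
theorem prod_mul_bernPr_slope_le (hφ : BoxRange R φ) (hmono : Monotonic φ) {L n m : ℤ}
    (hm : m + 2 * R + L ≤ n - 1) {F : Finset Site} {p s κ σ : ℝ} (hκ : 0 ≤ κ) (hσ : 0 ≤ σ)
    (hp1 : 0 ≤ p - κ) (hp2 : p ≤ 1) (hs1 : 0 ≤ s) (hs2 : s + σ ≤ 1) :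
    (p - κ) ^ (boxFinset 0 L).card *
        bernPr (fun i => pairWeight F p s i + slope F n L κ σ i) (escBool φ F m) ≤
      bernPr (pairWeight F (p - κ) (s + σ)) (escBool φ F m) := by
  classical
  have hlo : ∀ i, pairWeight F (p - κ) (s + σ) i ∈ Icc (0:ℝ) 1 :=
    pairWeight_mem ⟨hp1, by linarith⟩ ⟨by linarith, hs2⟩
  obtain ⟨D, hD⟩ : ∃ D : Finset (F ⊕ F), D = (Finset.univ.filter
    fun x : F => (x : Site) ∈ box 0 L).map Function.Embedding.inl := ⟨_, rfl⟩
  have hDcard : D.card ≤ (boxFinset 0 L).card := by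
    rw [hD, Finset.card_map]; exact card_filter_box_le F 0 L
  have hDprod : ∏ i ∈ D, pairWeight F (p - κ) (s + σ) i = (p - κ) ^ D.card := by
    rw [hD, Finset.prod_map, Finset.card_map]
    simp [pairWeight]
  have hDin : ∀ z : F, Sum.inl z ∈ D ↔ (z : Site) ∈ box 0 L := by intro z; simp [hD]
  have hDnr : ∀ z : F, Sum.inr z ∉ D := by intro z; simp [hD]
  have hsw := slope_param_mem (F := F) (n := n) (L := L) hκ hσ hp1 hp2 hs1 hs2
  have h1 : bernPr (fun i => pairWeight F p s i + slope F n L κ σ i) (escBool φ F m) ≤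
      bernPr (D.piecewise (1 : F ⊕ F → ℝ) (pairWeight F (p - κ) (s + σ))) (escBool φ F m) := by
    refine bernExp_le_bernExp hsw (fun i => ?_) fun i b => ?_
    · by_cases hi : i ∈ D
      · simp [hi]
      · simpa [hi] using hlo i
    · have hup := sub_nonneg.2 (indicator_escEvent_update_le hmono m F i b)
      rcases i with z | z
      · by_cases hz : (z : Site) ∈ box 0 L
        · refine mul_nonneg (sub_nonneg.2 ?_) hup
          rw [Finset.piecewise_eq_of_mem _ _ _ ((hDin z).2 hz)]
          exact (hsw _).2
        · rw [Finset.piecewise_eq_of_notMem _ _ _ fun h => hz ((hDin z).1 h)]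
          have h0 : (0 : Site) ∉ box (z : Site) L := by
            simp only [mem_box, Prod.fst_zero, Prod.snd_zero] at hz ⊢; omega
          by_cases hzm : (z : Site) ∈ box 0 (m + 2 * R)
          · have hzn : box (z : Site) L ⊆ box 0 (n - 1) := by
              intro v hv
              rw [mem_box_zero] at *; rw [mem_box] at hv; omega
            simp [pairWeight, slope, h0, hzn, ← sub_eq_add_neg]
          · have hdep := dependsOn_escEvent hφ (n := m) (F := boxFinset 0 (m + 2 * R))
              fun v hv => mem_boxFinset.2 hv
            have hagree : ∀ v v' : Bool, Function.update b (Sum.inl z) v ∈ escBool φ F m →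
                Function.update b (Sum.inl z) v' ∈ escBool φ F m := by
              intro v v' h
              refine hdep _ _ (fun x hx => ?_) h
              rw [extendPair_update_inl, extendPair_update_inl]
              have hxz : x ≠ z := by rintro rfl; exact hzm (mem_boxFinset.1 hx)
              simp [hxz]
            have heq : (escBool φ F m).indicator (1 : (F ⊕ F → Bool) → ℝ)
                (Function.update b (Sum.inl z) true) =
                (escBool φ F m).indicator 1 (Function.update b (Sum.inl z) false) := by
              by_cases h1 : Function.update b (Sum.inl z) true ∈ escBool φ F m
              · rw [indicator_of_mem h1, indicator_of_mem (hagree _ false h1)]; rfl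
              · rw [indicator_of_notMem h1, indicator_of_notMem fun h2 => h1 (hagree _ true h2)]
            rw [heq, sub_self, mul_zero]
      · rw [Finset.piecewise_eq_of_notMem _ _ _ (hDnr z)]
        simp [pairWeight, slope]
  have h2 := prod_mul_bernExp_le hlo (f := (escBool φ F m).indicator 1)
    (fun b => indicator_nonneg (fun _ _ => zero_le_one) b) D
  rw [hDprod] at h2
  refine le_trans ?_ h2
  exact mul_le_mul (pow_le_pow_of_le_one hp1 (by linarith) hDcard) h1
    (bernPr_nonneg hsw _) (pow_nonneg hp1 _)

/-- A small decrease of the density of open sites can be compensated by activations. -/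
theorem exists_mul_theta_le_thetaEnh (hφ : BoxRange R φ) (hmono : Monotonic φ) {L : ℤ}
    (hL0 : 0 ≤ L) (hL : LocalModification φ L) {p s κ σ δ : ℝ} (hδ : 0 < δ) (hκ : 0 ≤ κ)
    (hσ : 0 ≤ σ) (hp1 : δ ≤ p - κ) (hp2 : p ≤ 1 - δ) (hs1 : δ ≤ s) (hs2 : s + σ ≤ 1 - δ)
    (hκσ : κ * (boxFinset 0 L).card ≤ σ * δ ^ (2 * (boxFinset 0 L).card))
    {μ μ' ν' : Measure (Site → Bool)} (hμ : IsBernoulli p μ) (hμ' : IsBernoulli (p - κ) μ')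
    (hν' : IsBernoulli (s + σ) ν') :
    (p - κ) ^ (boxFinset 0 L).card * theta adjZ2 μ ≤ thetaEnh adjZ2 φ μ' ν' := by
  have := hμ.1
  have := hμ'.1
  have := hν'.1
  have hR := hφ.nonneg
  refine ge_of_tendsto' (tendsto_escEvent hφ) fun k => ?_
  obtain ⟨n, hn⟩ : ∃ n : ℕ, (n : ℤ) = k + 2 * R + L + 1 := ⟨(k + 2 * R + L + 1).toNat, by omega⟩
  obtain ⟨F, hF⟩ : ∃ F, F = boxFinset 0 ((n : ℤ) + 2 * R) := ⟨_, rfl⟩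
  have hFsub : box 0 ((n : ℤ) + 2 * R) ⊆ F := by rw [hF]; exact fun v hv => mem_boxFinset.2 hv
  have hpc : 0 ≤ p - κ := by linarith
  have hpI : p ∈ Icc (0:ℝ) 1 := ⟨by linarith, by linarith⟩
  have hsσ : s + σ ∈ Icc (0:ℝ) 1 := ⟨by linarith, by linarith⟩
  have hsI : s ∈ Icc (0:ℝ) 1 := ⟨by linarith, by linarith⟩
  have hsw := slope_param_mem (F := F) (n := n) (L := L) hκ hσ hpc hpI.2 hsI.1 hsσ.2
  rw [measureReal_escEvent hφ ⟨hpc, by linarith⟩ hsσ hμ' hν' (m := (n : ℤ) + 2 * R) (by omega),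
    ← hF]
  refine le_trans ?_ (prod_mul_bernPr_slope_le hφ hmono (n := n) (m := k) (L := L) (by omega)
    hκ hσ hpc hpI.2 hsI.1 hsσ.2)
  refine mul_le_mul_of_nonneg_left ?_ (pow_nonneg hpc _)
  calc theta adjZ2 μ
      ≤ (μ.prod ν').real (escEvent (fun _ => ∅) n) := by
        rw [← thetaEnh_empty (ν := ν')]; exact thetaEnh_le n
    _ = bernPr (pairWeight F p (s + σ)) (escBool (fun _ => ∅) F n) := by
        rw [measureReal_escEvent (boxRange_empty R hR) hpI hsσ hμ hν' le_rfl, ← hF]; rfl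
    _ ≤ bernPr (pairWeight F p s) (escBool (fun _ => ∅) F n) := by
        refine bernExp_le_bernExp (pairWeight_mem hpI hsσ) (pairWeight_mem hpI hsI) fun i b => ?_
        rcases i with z | z
        · simp [pairWeight]
        · have h : ∀ v v' : Bool, Function.update b (Sum.inr z) v ∈ escBool (fun _ => ∅) F n →
              Function.update b (Sum.inr z) v' ∈ escBool (fun _ => ∅) F n := by
            intro v v' h
            refine Esc.mono (Y := enhanced _ _ _) (inter_subset_left.trans ?_) h
            rintro x (hx | ⟨y, -, w, hw, -⟩)
            · exact Or.inl (by simpa [toConfig, extendPair] using hx)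
            · exact absurd hw (notMem_empty _)
          by_cases h1 : Function.update b (Sum.inr z) true ∈ escBool (fun _ => ∅) F n
          · rw [indicator_of_mem h1, indicator_of_mem (h _ false h1)]; simp
          · rw [indicator_of_notMem h1, indicator_of_notMem fun h2 => h1 (h _ true h2)]; simp
    _ ≤ bernPr (pairWeight F p s) (escBool φ F n) := by
        refine bernPr_mono (pairWeight_mem hpI hsI) fun b hb => ?_
        refine Esc.mono (Y := enhanced _ _ _) (inter_subset_left.trans ?_) hb
        rintro x (hx | ⟨y, -, w, hw, -⟩)
        · exact Or.inl hx
        · exact absurd hw (notMem_empty _)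
    _ ≤ bernPr (fun i => pairWeight F p s i + slope F n L κ σ i) (escBool φ F n) :=
        bernPr_le_bernPr_add_slope hφ hmono hL hFsub hδ hκ hσ hp1 hp2 hs1 hs2 hκσ
    _ ≤ bernPr (fun i => pairWeight F p s i + slope F n L κ σ i) (escBool φ F k) :=
        bernPr_mono hsw fun b hb => escEvent_anti (by omega) (by omega) hb

end enhancedEvents

/-! ### Percolation at high densities -/

/-- The nine sites of the `3 × 3` block indexed by `u`. -/
noncomputable def block (u : Site) : Finset Site :=
  Finset.Icc (3 * u.1) (3 * u.1 + 2) ×ˢ Finset.Icc (3 * u.2) (3 * u.2 + 2)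

theorem mem_block {u v : Site} : v ∈ block u ↔
    (3 * u.1 ≤ v.1 ∧ v.1 ≤ 3 * u.1 + 2) ∧ 3 * u.2 ≤ v.2 ∧ v.2 ≤ 3 * u.2 + 2 := by
  simp [block]

/-- The blocks missing at most one site of `X`. -/
def coarse (X : Set Site) : Set Site :=
  {u | ∀ a ∈ block u, ∀ b ∈ block u, a ∉ X → b ∉ X → a = b}

theorem mem_of_mem_coarse {X : Set Site} {u a b : Site} (hu : u ∈ coarse X) (ha : a ∈ block u)
    (hb : b ∈ block u) (hab : a ≠ b) (haX : a ∉ X) : b ∈ X := by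
  by_contra hbX
  exact hab (hu a ha b hb haX hbX)

theorem exists_reachIn_block {X : Set Site} {u : Site} (hu : u ∈ coarse X) :
    ∃ c, ∀ a ∈ block u, a ∈ X → ReachIn X c a := by
  obtain ⟨x, y⟩ := u
  by_cases hc : (3 * x + 1, 3 * y + 1) ∈ X
  · refine ⟨(3 * x + 1, 3 * y + 1), fun a ha haX => ?_⟩
    have hmid : ∀ b : Site, adjZ2 (3 * x + 1, 3 * y + 1) b → b ∈ X →
        ReachIn X (3 * x + 1, 3 * y + 1) b := fun b h hb => .single hc h hb
    by_cases hac : a = (3 * x + 1, 3 * y + 1)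
    · rw [hac]; exact .refl hc
    by_cases had : adjZ2 (3 * x + 1, 3 * y + 1) a
    · exact hmid a had haX
    obtain ⟨i, j⟩ := a
    simp only [mem_block, adjZ2_iff, Prod.mk.injEq] at ha hac had
    by_cases hm : (3 * x + 1, j) ∈ X
    · refine (hmid _ ?_ hm).tail ?_ haX <;> rw [adjZ2_iff] <;> dsimp only <;> omega
    · have hm' : (i, 3 * y + 1) ∈ X := by
        refine mem_of_mem_coarse hu ?_ ?_ ?_ hm <;>
          simp only [mem_block, ne_eq, Prod.mk.injEq] <;> omega
      refine (hmid _ ?_ hm').tail ?_ haX <;> rw [adjZ2_iff] <;> dsimp only <;> omega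
  · have hX : ∀ i j, 3 * x ≤ i → i ≤ 3 * x + 2 → 3 * y ≤ j → j ≤ 3 * y + 2 →
        ¬ (i = 3 * x + 1 ∧ j = 3 * y + 1) → (i, j) ∈ X := by
      intro i j h1 h2 h3 h4 h5
      refine mem_of_mem_coarse hu ?_ ?_ ?_ hc <;>
        simp only [mem_block, ne_eq, Prod.mk.injEq] <;> omega
    refine ⟨(3 * x, 3 * y), fun a ha haX => ?_⟩
    obtain ⟨i, j⟩ := a
    simp only [mem_block] at ha
    by_cases hi : i = 3 * x ∨ j = 3 * y + 2
    · exact (reachIn_vline (b := j) (by omega) fun t _ _ =>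
        hX _ _ (by omega) (by omega) (by omega) (by omega) (by omega)).trans
        (reachIn_hline (by omega) fun t _ _ => by
          by_cases ht : t = i
          · rw [ht]; exact haX
          · exact hX _ _ (by omega) (by omega) (by omega) (by omega) (by omega))
    · exact (reachIn_hline (b := i) (by omega) fun t _ _ =>
        hX _ _ (by omega) (by omega) (by omega) (by omega) (by omega)).trans
        (reachIn_vline (by omega) fun t _ _ => by
          by_cases ht : t = j
          · rw [ht]; exact haX
          · by_cases hc' : i = 3 * x + 1 ∧ j = 3 * y + 1
            · exact absurd (by rw [← hc'.1, ← hc'.2]; exact haX) hc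
            · refine hX _ _ (by omega) (by omega) (by omega) (by omega) (by omega))

theorem reachIn_of_mem_block {X : Set Site} {u a b : Site} (hu : u ∈ coarse X) (ha : a ∈ block u)
    (haX : a ∈ X) (hb : b ∈ block u) (hbX : b ∈ X) : ReachIn X a b := by
  obtain ⟨c, hc⟩ := exists_reachIn_block hu
  exact (hc a ha haX).symm.trans (hc b hb hbX)

/-- Adjacent blocks, each missing at most one site of `X`, are joined by an edge of `X`. -/
theorem exists_adj_of_adj {X : Set Site} {u v : Site} (hu : u ∈ coarse X) (hv : v ∈ coarse X)
    (huv : adjZ2 u v) : ∃ a ∈ block u, ∃ b ∈ block v, a ∈ X ∧ b ∈ X ∧ adjZ2 a b := by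
  obtain ⟨a, b, hab, ha, hb, hinj⟩ : ∃ a b : Fin 3 → Site, (∀ i, adjZ2 (a i) (b i)) ∧
      (∀ i, a i ∈ block u) ∧ (∀ i, b i ∈ block v) ∧
      ∀ i j, i ≠ j → a i ≠ a j ∧ b i ≠ b j := by
    obtain ⟨x, y⟩ := u
    obtain ⟨x', y'⟩ := v
    rw [adjZ2_iff] at huv
    dsimp only at huv
    have key : ∀ i j : Fin 3, i ≠ j → ((i : ℕ) : ℤ) ≠ (j : ℕ) := fun i j h h' =>
      h (Fin.ext (by exact_mod_cast h'))
    rcases huv with ⟨h, h' | h'⟩ | ⟨h, h' | h'⟩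
    · refine ⟨fun i => (3 * x + (i : ℕ), 3 * y), fun i => (3 * x + (i : ℕ), 3 * y - 1),
        fun i => ?_, fun i => ?_, fun i => ?_, fun i j hij => ?_⟩
      · rw [adjZ2_iff]; dsimp only; omega
      · rw [mem_block]; dsimp only; omega
      · rw [mem_block]; dsimp only; omega
      · have := key i j hij
        simp only [ne_eq, Prod.mk.injEq]; omega
    · refine ⟨fun i => (3 * x + (i : ℕ), 3 * y + 2), fun i => (3 * x + (i : ℕ), 3 * y + 3),
        fun i => ?_, fun i => ?_, fun i => ?_, fun i j hij => ?_⟩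
      · rw [adjZ2_iff]; dsimp only; omega
      · rw [mem_block]; dsimp only; omega
      · rw [mem_block]; dsimp only; omega
      · have := key i j hij
        simp only [ne_eq, Prod.mk.injEq]; omega
    · refine ⟨fun i => (3 * x, 3 * y + (i : ℕ)), fun i => (3 * x - 1, 3 * y + (i : ℕ)),
        fun i => ?_, fun i => ?_, fun i => ?_, fun i j hij => ?_⟩
      · rw [adjZ2_iff]; dsimp only; omega
      · rw [mem_block]; dsimp only; omega
      · rw [mem_block]; dsimp only; omega
      · have := key i j hij
        simp only [ne_eq, Prod.mk.injEq]; omega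
    · refine ⟨fun i => (3 * x + 2, 3 * y + (i : ℕ)), fun i => (3 * x + 3, 3 * y + (i : ℕ)),
        fun i => ?_, fun i => ?_, fun i => ?_, fun i j hij => ?_⟩
      · rw [adjZ2_iff]; dsimp only; omega
      · rw [mem_block]; dsimp only; omega
      · rw [mem_block]; dsimp only; omega
      · have := key i j hij
        simp only [ne_eq, Prod.mk.injEq]; omega
  have hA : ∀ i j, i ≠ j → a i ∉ X → a j ∈ X := fun i j hij =>
    mem_of_mem_coarse hu (ha i) (ha j) (hinj i j hij).1
  have hB : ∀ i j, i ≠ j → b i ∉ X → b j ∈ X := fun i j hij =>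
    mem_of_mem_coarse hv (hb i) (hb j) (hinj i j hij).2
  have h01 : (0 : Fin 3) ≠ 1 := by decide
  have h02 : (0 : Fin 3) ≠ 2 := by decide
  have h12 : (1 : Fin 3) ≠ 2 := by decide
  have : ∃ i, a i ∈ X ∧ b i ∈ X := by
    by_contra hcon
    push Not at hcon
    have := hcon 0
    have := hcon 1
    have := hcon 2
    have := hA 0 1 h01
    have := hA 0 2 h02
    have := hA 1 2 h12
    have := hB 0 1 h01
    have := hB 0 2 h02
    have := hB 1 2 h12
    tauto
  obtain ⟨i, h1, h2⟩ := this
  exact ⟨a i, ha i, b i, hb i, h1, h2, hab i⟩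

theorem ReachIn.of_coarse {X : Set Site} {u v a b : Site} (h : ReachIn (coarse X) u v)
    (ha : a ∈ block u) (haX : a ∈ X) (hb : b ∈ block v) (hbX : b ∈ X) : ReachIn X a b := by
  refine h.induct (P := fun v => ∀ b ∈ block v, b ∈ X → ReachIn X a b)
    (fun b hb hbX => reachIn_of_mem_block h.1 ha haX hb hbX)
    (fun v w hv ih hvw hw b hb hbX => ?_) b hb hbX
  obtain ⟨c, hc, d, hd, hcX, hdX, hcd⟩ := exists_adj_of_adj hv.right_mem hw hvw
  exact ((ih c hc hcX).tail hcd hdX).trans (reachIn_of_mem_block hw hd hdX hb hbX)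

/-- The `k`-fold coarse graining of `X`. -/
def coarseIter (X : Set Site) : ℕ → Set Site
  | 0 => X
  | k + 1 => coarse (coarseIter X k)

theorem exists_reachIn_of_coarseIter {X : Set Site} (h0 : ∀ k, 0 ∈ coarseIter X k) {k : ℕ} :
    ∀ {u : Site}, ReachIn (coarseIter X k) 0 u →
      ∃ v, ReachIn X 0 v ∧ 3 ^ k * u.1 ≤ v.1 ∧ 3 ^ k * u.2 ≤ v.2 := by
  induction k with
  | zero => exact fun {u} h => ⟨u, h, by simp, by simp⟩
  | succ k ih =>
    intro u h
    obtain ⟨b, hb, hbX⟩ : ∃ b ∈ block u, b ∈ coarseIter X k := by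
      by_cases h1 : (3 * u.1, 3 * u.2) ∈ coarseIter X k
      · exact ⟨_, by rw [mem_block]; dsimp only; omega, h1⟩
      · refine ⟨(3 * u.1 + 1, 3 * u.2), ?_, mem_of_mem_coarse h.right_mem ?_ ?_ ?_ h1⟩ <;>
          simp only [mem_block, ne_eq, Prod.mk.injEq] <;> omega
    obtain ⟨v, hv, h1, h2⟩ := ih (h.of_coarse (a := 0) (by simp [mem_block]) (h0 k) hb hbX)
    rw [mem_block] at hb
    have h3 : (0:ℤ) ≤ 3 ^ k := by positivity
    rw [pow_succ, mul_assoc, mul_assoc]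
    exact ⟨v, hv, (mul_le_mul_of_nonneg_left hb.1.1 h3).trans h1,
      (mul_le_mul_of_nonneg_left hb.2.1 h3).trans h2⟩

theorem inInfiniteCluster_of_coarseIter {X : Set Site} (h0 : ∀ k, 0 ∈ coarseIter X k) :
    InInfiniteCluster adjZ2 X 0 := by
  rw [inInfiniteCluster_iff]
  intro n
  obtain ⟨u, hu, hu'⟩ : ∃ u, ReachIn (coarseIter X n) 0 u ∧ (1 ≤ u.1 ∨ 1 ≤ u.2) := by
    have hb : ∀ v ∈ block 0, v ∈ coarseIter X n → ReachIn (coarseIter X n) 0 v := fun v hv hvX =>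
      reachIn_of_mem_block (h0 (n + 1)) (by simp [mem_block]) (h0 n) hv hvX
    by_cases h1 : ((1, 0) : Site) ∈ coarseIter X n
    · exact ⟨_, hb _ (by simp [mem_block]) h1, by simp⟩
    · exact ⟨(0, 1), hb _ (by simp [mem_block]) (mem_of_mem_coarse (h0 (n + 1))
        (by simp [mem_block]) (by simp [mem_block]) (by simp) h1), by simp⟩
  obtain ⟨v, hv, h1, h2⟩ := exists_reachIn_of_coarseIter h0 hu
  refine .of_reachIn (by omega) hv fun hbox => ?_
  rw [mem_box_zero] at hbox
  have h3 : (n : ℤ) < 3 ^ n := by exact_mod_cast Nat.lt_pow_self (by norm_num)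
  rcases hu' with h | h <;> nlinarith

/-- The sets of closed sites which force `u` not to survive `k` coarse grainings. -/
noncomputable def obstructions : ℕ → Site → Finset (Finset Site)
  | 0, u => {{u}}
  | k + 1, u => (block u).offDiag.biUnion fun ab =>
      Finset.image₂ (· ∪ ·) (obstructions k ab.1) (obstructions k ab.2)

theorem exists_obstruction {X : Set Site} {k : ℕ} : ∀ {u : Site}, u ∉ coarseIter X k →
    ∃ W ∈ obstructions k u, ∀ x ∈ W, x ∉ X := by
  induction k with
  | zero => exact fun {u} h => ⟨{u}, by simp [obstructions], by simpa [coarseIter] using h⟩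
  | succ k ih =>
    intro u h
    simp only [coarseIter, coarse, mem_ofPred_eq, not_forall] at h
    obtain ⟨a, ha, b, hb, haX, hbX, hab⟩ := h
    obtain ⟨W, hW, hWX⟩ := ih haX
    obtain ⟨W', hW', hWX'⟩ := ih hbX
    refine ⟨W ∪ W', ?_, fun x hx => ?_⟩
    · exact Finset.mem_biUnion.2 ⟨(a, b), Finset.mem_offDiag.2 ⟨ha, hb, hab⟩,
        Finset.mem_image₂_of_mem hW hW'⟩
    · rcases Finset.mem_union.1 hx with hx | hx
      exacts [hWX x hx, hWX' x hx]

theorem card_of_mem_obstructions {k : ℕ} : ∀ {u : Site} {W : Finset Site}, W ∈ obstructions k u →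
    W.card = 2 ^ k ∧ ∀ x ∈ W, x.1 / 3 ^ k = u.1 ∧ x.2 / 3 ^ k = u.2 := by
  induction k with
  | zero => simp [obstructions]
  | succ k ih =>
    intro u W hW
    simp only [obstructions, Finset.mem_biUnion, Finset.mem_offDiag, Finset.mem_image₂] at hW
    obtain ⟨⟨a, b⟩, ⟨ha, hb, hab⟩, W₁, hW₁, W₂, hW₂, rfl⟩ := hW
    obtain ⟨hc₁, hd₁⟩ := ih hW₁
    obtain ⟨hc₂, hd₂⟩ := ih hW₂
    have hstep : ∀ {c x : Site}, c ∈ block u → x.1 / 3 ^ k = c.1 ∧ x.2 / 3 ^ k = c.2 →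
        x.1 / 3 ^ (k + 1) = u.1 ∧ x.2 / 3 ^ (k + 1) = u.2 := by
      rintro c x hc ⟨h1, h2⟩
      rw [mem_block] at hc
      rw [pow_succ, ← Int.ediv_ediv_of_nonneg (by positivity),
        ← Int.ediv_ediv_of_nonneg (by positivity), h1, h2]
      omega
    refine ⟨?_, fun x hx => ?_⟩
    · rw [Finset.card_union_of_disjoint, hc₁, hc₂, pow_succ]
      · ring
      · refine Finset.disjoint_left.2 fun x hx hx' => hab ?_
        have h1 := hd₁ x hx
        have h2 := hd₂ x hx'
        exact Prod.ext (h1.1.symm.trans h2.1) (h1.2.symm.trans h2.2)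
    · rcases Finset.mem_union.1 hx with hx | hx
      exacts [hstep ha (hd₁ x hx), hstep hb (hd₂ x hx)]

theorem card_obstructions_le (k : ℕ) : ∀ u, 81 * (obstructions k u).card ≤ 81 ^ 2 ^ k := by
  induction k with
  | zero => simp [obstructions]
  | succ k ih =>
    intro u
    have hblock : (block u).card = 9 := by
      rw [block, Finset.card_product, Int.card_Icc, Int.card_Icc,
        show 3 * u.1 + 2 + 1 - 3 * u.1 = 3 by ring, show 3 * u.2 + 2 + 1 - 3 * u.2 = 3 by ring]
      rfl
    have h1 : 81 * (81 * (obstructions (k + 1) u).card) ≤ 81 * (81 ^ 2 ^ k * 81 ^ 2 ^ k) := by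
      calc 81 * (81 * (obstructions (k + 1) u).card)
          ≤ 81 * (81 * ∑ ab ∈ (block u).offDiag,
              (obstructions k ab.1).card * (obstructions k ab.2).card) := by
            gcongr
            exact Finset.card_biUnion_le.trans
              (Finset.sum_le_sum fun ab _ => Finset.card_image₂_le _ _ _)
        _ = ∑ ab ∈ (block u).offDiag,
              (81 * (obstructions k ab.1).card) * (81 * (obstructions k ab.2).card) := by
            rw [← mul_assoc, Finset.mul_sum]
            exact Finset.sum_congr rfl fun _ _ => by ring
        _ ≤ ∑ ab ∈ (block u).offDiag, 81 ^ 2 ^ k * 81 ^ 2 ^ k :=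
            Finset.sum_le_sum fun ab _ => Nat.mul_le_mul (ih _) (ih _)
        _ ≤ 81 * (81 ^ 2 ^ k * 81 ^ 2 ^ k) := by
            rw [Finset.sum_const, smul_eq_mul, Finset.offDiag_card, hblock]
            gcongr
            norm_num
    have h2 := Nat.le_of_mul_le_mul_left h1 (by norm_num)
    rwa [← pow_add, ← two_mul, ← pow_succ'] at h2

/-- Percolation occurs at high density. -/
theorem theta_ne_zero {p : ℝ} (hp : 323 / 324 ≤ p) {μ : Measure (Site → Bool)}
    (hμ : IsBernoulli p μ) : theta adjZ2 μ ≠ 0 := by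
  have := hμ.1
  intro hθ
  have hinf : μ {η | InInfiniteCluster adjZ2 (toConfig η) 0} = 0 :=
    (measureReal_eq_zero_iff).1 hθ
  have hq : 81 * ENNReal.ofReal (1 - p) ≤ 4⁻¹ := by
    calc 81 * ENNReal.ofReal (1 - p) ≤ ENNReal.ofReal 81 * ENNReal.ofReal (1 / 324) := by
          gcongr
          · simp
          · linarith
      _ = 4⁻¹ := by
          rw [← ENNReal.ofReal_mul (by norm_num), show (81:ℝ) * (1 / 324) = 4⁻¹ by norm_num,
            ENNReal.ofReal_inv_of_pos (by norm_num)]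
          simp
  have hcyl : ∀ k, ∀ W ∈ obstructions k 0, μ (cylinder W fun _ => false) =
      ENNReal.ofReal (1 - p) ^ 2 ^ k := by
    intro k W hW
    rw [hμ.2]
    simp [(card_of_mem_obstructions hW).1]
  have hlevel : ∀ k, μ (⋃ W ∈ obstructions k 0, cylinder W fun _ => false) ≤ 4⁻¹ ^ (k + 1) := by
    intro k
    calc μ (⋃ W ∈ obstructions k 0, cylinder W fun _ => false)
        ≤ ∑ W ∈ obstructions k 0, μ (cylinder W fun _ => false) :=
          measure_biUnion_finset_le _ _
      _ = (obstructions k 0).card * ENNReal.ofReal (1 - p) ^ 2 ^ k := by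
          rw [Finset.sum_congr rfl (hcyl k), Finset.sum_const, nsmul_eq_mul]
      _ ≤ 81 ^ 2 ^ k * ENNReal.ofReal (1 - p) ^ 2 ^ k := by
          gcongr
          exact_mod_cast (Nat.le_mul_of_pos_left _ (by norm_num)).trans (card_obstructions_le k 0)
      _ = (81 * ENNReal.ofReal (1 - p)) ^ 2 ^ k := (mul_pow _ _ _).symm
      _ ≤ 4⁻¹ ^ 2 ^ k := by gcongr
      _ ≤ 4⁻¹ ^ (k + 1) := pow_le_pow_of_le_one zero_le (by simp) Nat.lt_two_pow_self
  have hcover : (univ : Set (Site → Bool)) ⊆ {η | InInfiniteCluster adjZ2 (toConfig η) 0} ∪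
      ⋃ k, ⋃ W ∈ obstructions k 0, cylinder W fun _ => false := by
    intro η _
    by_cases h : ∀ k, 0 ∈ coarseIter (toConfig η) k
    · exact Or.inl (inInfiniteCluster_of_coarseIter h)
    · push Not at h
      obtain ⟨k, hk⟩ := h
      obtain ⟨W, hW, hWX⟩ := exists_obstruction hk
      exact Or.inr (mem_iUnion.2 ⟨k, mem_biUnion hW fun x hx => by
        simpa [toConfig] using hWX x hx⟩)
  have hone : (1 : ℝ≥0∞) ≤ 4⁻¹ * (1 - 4⁻¹)⁻¹ := by
    calc (1 : ℝ≥0∞) = μ univ := measure_univ.symm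
      _ ≤ 0 + ∑' k : ℕ, 4⁻¹ ^ (k + 1) := by
          rw [← hinf]
          exact (measure_mono hcover).trans ((measure_union_le _ _).trans
            (add_le_add_right ((measure_iUnion_le _).trans (ENNReal.tsum_le_tsum hlevel)) _))
      _ = 4⁻¹ * (1 - 4⁻¹)⁻¹ := by rw [zero_add, ENNReal.tsum_geometric_add_one]
  have h2 := ENNReal.toReal_mono (by
    refine ENNReal.mul_ne_top (by simp) (ENNReal.inv_ne_top.2 ?_)
    simp [tsub_eq_zero_iff_le]) hone
  rw [ENNReal.toReal_mul, ENNReal.toReal_inv, ENNReal.toReal_inv,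
    ENNReal.toReal_sub_of_le (by simp) (by simp), ENNReal.toReal_inv] at h2
  norm_num at h2

/-! ### The critical point -/

section criticalPoint

variable {P : ℝ → Measure (Site → Bool)}

theorem bddAbove_theta_eq_zero :
    BddAbove {p | p ∈ Icc (0:ℝ) 1 ∧ theta adjZ2 (P p) = 0} := ⟨1, fun _ h => h.1.2⟩

theorem theta_nonneg (μ : Measure (Site → Bool)) : 0 ≤ theta adjZ2 μ := ENNReal.toReal_nonneg

theorem theta_mono {p p' : ℝ} (hp : 0 ≤ p) (hpp' : p ≤ p') (hp' : p' ≤ 1)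
    {μ μ' : Measure (Site → Bool)} (hμ : IsBernoulli p μ) (hμ' : IsBernoulli p' μ') :
    theta adjZ2 μ ≤ theta adjZ2 μ' := by
  have := hμ.1
  have := hμ'.1
  rw [← thetaEnh_empty (ν := μ) (μ := μ), ← thetaEnh_empty (ν := μ') (μ := μ')]
  exact thetaEnh_mono (boxRange_empty 0 le_rfl) (fun _ _ _ => le_rfl) hp hp hpp' hpp' hp' hp'
    hμ hμ hμ' hμ'

theorem pcOf_lt_one (hP : ∀ p ∈ Icc (0:ℝ) 1, IsBernoulli p (P p)) : pcOf adjZ2 P < 1 := by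
  refine (Real.sSup_le (a := 323 / 324) (fun p hp => ?_) (by norm_num)).trans_lt (by norm_num)
  by_contra! h
  exact theta_ne_zero h.le (hP p hp.1) hp.2

theorem theta_pos_of_pcOf_lt {p : ℝ} (hp : p ∈ Icc (0:ℝ) 1) (h : pcOf adjZ2 P < p) :
    0 < theta adjZ2 (P p) :=
  (theta_nonneg _).lt_of_ne fun h0 => h.not_ge (le_csSup bddAbove_theta_eq_zero ⟨hp, h0.symm⟩)

theorem theta_eq_zero_of_lt_pcOf (hP : ∀ p ∈ Icc (0:ℝ) 1, IsBernoulli p (P p)) {p : ℝ}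
    (hp : 0 ≤ p) (h : p < pcOf adjZ2 P) : theta adjZ2 (P p) = 0 := by
  have hne : {p | p ∈ Icc (0:ℝ) 1 ∧ theta adjZ2 (P p) = 0}.Nonempty := by
    rw [nonempty_iff_ne_empty]
    intro he
    rw [pcOf, he, Real.sSup_empty] at h
    linarith
  obtain ⟨p', ⟨hp', h0⟩, hlt⟩ := exists_lt_of_lt_csSup hne h
  exact le_antisymm ((theta_mono hp hlt.le hp'.2 (hP p ⟨hp, hlt.le.trans hp'.2⟩)
    (hP p' hp')).trans_eq h0) (theta_nonneg _)

end criticalPoint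

/-- suppose `p_c > 0` and `s > 0`. A monotonic enhancement shifts the
critical point (i.e. there is `π(s) < p_c` with `θ(p,s) > 0` for all `p > π(s)`) if
and only if it is essential. -/
theorem monotonic_shifts_pc_iff_essential
    (P : ℝ → Measure (Site → Bool))
    (hP : ∀ p ∈ Icc (0:ℝ) 1, IsBernoulli p (P p))
    (R₀ : ℝ) (φ : Config → Config) (hφ : IsEnhancement R₀ φ) (hmono : Monotonic φ)
    (hpc : 0 < pcOf adjZ2 P) (s : ℝ) (hs : 0 < s) (hs1 : s ≤ 1) :
    (∃ π : ℝ, π < pcOf adjZ2 P ∧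
        ∀ p : ℝ, π < p → p ≤ 1 → 0 < thetaEnh adjZ2 φ (P p) (P s)) ↔
      Essential adjZ2 φ := by
  obtain ⟨R, hR⟩ := hφ.exists_boxRange
  have hpc1 := pcOf_lt_one hP
  constructor
  · rintro ⟨π, hπ, h⟩
    by_contra hess
    obtain ⟨p, hp1, hp2⟩ := exists_between (max_lt hπ hpc)
    obtain ⟨hπp, hp0⟩ := max_lt_iff.1 hp1
    obtain ⟨c, hc, hle⟩ := exists_mul_thetaEnh_le hR hmono hess hp0 (hp2.trans hpc1) ⟨hs.le, hs1⟩
      (hP p ⟨hp0.le, by linarith⟩) (hP s ⟨hs.le, hs1⟩)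
    rw [theta_eq_zero_of_lt_pcOf hP hp0.le hp2] at hle
    exact hle.not_gt (mul_pos hc (h p hπp (by linarith)))
  · intro hess
    obtain ⟨L, hL0, hL⟩ := hess.exists_pivotal hR hmono
    obtain ⟨q, hq⟩ : ∃ q, q = pcOf adjZ2 P := ⟨_, rfl⟩
    rw [← hq] at hpc hpc1 ⊢
    obtain ⟨s₁, hs₁, hs₁s, hs₁2⟩ : ∃ s₁, 0 < s₁ ∧ s₁ ≤ s ∧ s₁ ≤ 1 / 2 :=
      ⟨min s (1 / 2), by positivity, min_le_left _ _, min_le_right _ _⟩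
    obtain ⟨δ, hδ, hδ1, hδ2, hδ3⟩ : ∃ δ, 0 < δ ∧ δ ≤ q / 2 ∧ δ ≤ (1 - q) / 2 ∧ δ ≤ s₁ / 2 :=
      ⟨min (q / 2) (min ((1 - q) / 2) (s₁ / 2)),
        lt_min (by linarith) (lt_min (by linarith) (by linarith)), min_le_left _ _,
        (min_le_right _ _).trans (min_le_left _ _), (min_le_right _ _).trans (min_le_right _ _)⟩
    obtain ⟨M, hM⟩ : ∃ M, M = (boxFinset 0 L).card := ⟨_, rfl⟩
    have hw : 0 < s₁ / 2 * δ ^ (2 * M) / (2 * (M + 1)) := by positivity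
    obtain ⟨ε, hε, hε1, hε2, hε3⟩ : ∃ ε, 0 < ε ∧ ε ≤ q / 2 ∧ ε ≤ (1 - q) / 2 ∧
        ε ≤ s₁ / 2 * δ ^ (2 * M) / (2 * (M + 1)) :=
      ⟨min (q / 2) (min ((1 - q) / 2) _),
        lt_min (by linarith) (lt_min (by linarith) hw), min_le_left _ _,
        (min_le_right _ _).trans (min_le_left _ _), (min_le_right _ _).trans (min_le_right _ _)⟩
    have hκσ : 2 * ε * M ≤ s₁ / 2 * δ ^ (2 * M) := by
      rw [le_div_iff₀ (by positivity)] at hε3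
      linarith
    have hlow := hP (q + ε - 2 * ε) ⟨by linarith, by linarith⟩
    have hact := hP (s₁ / 2 + s₁ / 2) ⟨by linarith, by linarith⟩
    have hmain := exists_mul_theta_le_thetaEnh hR hmono hL0 hL hδ (p := q + ε) (s := s₁ / 2)
      (κ := 2 * ε) (σ := s₁ / 2) (by linarith) (by linarith) (by linarith) (by linarith) hδ3
      (by linarith) (by rwa [← hM]) (hP _ ⟨by linarith, by linarith⟩) hlow hact
    have hpos := theta_pos_of_pcOf_lt (P := P) (p := q + ε) ⟨by linarith, by linarith⟩
      (by rw [← hq]; linarith)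
    refine ⟨q - ε, by linarith, fun p hp hp1 => ?_⟩
    refine ((mul_pos (pow_pos (by linarith) _) hpos).trans_le hmain).trans_le ?_
    exact thetaEnh_mono hR hmono (by linarith) (by linarith) (by linarith) (by linarith) hp1 hs1
      hlow hact (hP p ⟨by linarith, hp1⟩) (hP s ⟨hs.le, hs1⟩)

end PercEnh
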